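/- Let Ω ⊂ ℝ² be a Jordan domain with |∂Ω| = 0 which has no necks of radius r = 1/h(Ω), and assume moreover that Ω^r equals the closure of its interior, i.e. cl(int(Ω^r)) = Ω^r. Then Ω has a unique Cheeger set (the maximal Cheeger set is also minimal). -/

import Mathlib

open MeasureTheory Metric Set ENNReal

/-- Divergence of a vector field on `ℝ²`. -/
noncomputable def vdiv (φ : EuclideanSpace ℝ (Fin 2) → EuclideanSpace ℝ (Fin 2))
    (x : EuclideanSpace ℝ (Fin 2)) : ℝ :=
  ∑ i : Fin 2, fderiv ℝ φ x (EuclideanSpace.single i 1) i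

/-- Relative (distributional) perimeter of `E` in the open set `A`. -/
noncomputable def perimeterIn (E A : Set (EuclideanSpace ℝ (Fin 2))) : ℝ≥0∞ :=
  ⨆ (φ : EuclideanSpace ℝ (Fin 2) → EuclideanSpace ℝ (Fin 2)) (_ : ContDiff ℝ 1 φ)
    (_ : HasCompactSupport φ) (_ : tsupport φ ⊆ A) (_ : ∀ x, ‖φ x‖ ≤ 1),
    ENNReal.ofReal (∫ x in E, vdiv φ x)

noncomputable def perimeter (E : Set (EuclideanSpace ℝ (Fin 2))) : ℝ≥0∞ :=
  perimeterIn E Set.univ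

noncomputable def cheegerConst (Ω : Set (EuclideanSpace ℝ (Fin 2))) : ℝ≥0∞ :=
  ⨅ (F : Set (EuclideanSpace ℝ (Fin 2))) (_ : MeasurableSet F) (_ : F ⊆ Ω)
    (_ : 0 < volume F), perimeter F / volume F

def IsCheegerSet (Ω E : Set (EuclideanSpace ℝ (Fin 2))) : Prop :=
  MeasurableSet E ∧ E ⊆ Ω ∧ 0 < volume E ∧ perimeter E / volume E = cheegerConst Ω

def maximalCheegerSet (Ω : Set (EuclideanSpace ℝ (Fin 2))) : Set (EuclideanSpace ℝ (Fin 2)) :=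
  ⋃₀ {E | IsCheegerSet Ω E}

def IsJordanCurve (Γ : Set (EuclideanSpace ℝ (Fin 2))) : Prop :=
  Nonempty (↥(Metric.sphere (0 : EuclideanSpace ℝ (Fin 2)) 1) ≃ₜ ↥Γ)

def IsJordanDomain (Ω : Set (EuclideanSpace ℝ (Fin 2))) : Prop :=
  ∃ Γ : Set (EuclideanSpace ℝ (Fin 2)), IsJordanCurve Γ ∧ IsOpen Ω ∧
    Bornology.IsBounded Ω ∧ IsConnected Ω ∧ frontier Ω = Γ ∧
    ∀ x ∈ Ω, connectedComponentIn Γᶜ x = Ω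

def HasNoNecks (Ω : Set (EuclideanSpace ℝ (Fin 2))) (r : ℝ) : Prop :=
  ∀ x₀ x₁ : EuclideanSpace ℝ (Fin 2), Metric.ball x₀ r ⊆ Ω → Metric.ball x₁ r ⊆ Ω →
    ∃ γ : ℝ → EuclideanSpace ℝ (Fin 2), ContinuousOn γ (Set.Icc 0 1) ∧
      γ 0 = x₀ ∧ γ 1 = x₁ ∧ ∀ t ∈ Set.Icc (0:ℝ) 1, Metric.ball (γ t) r ⊆ Ω

/-- The inner parallel set `Ω^r = {x ∈ Ω : dist(x, ∂Ω) ≥ r}`. -/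
def innerPar (Ω : Set (EuclideanSpace ℝ (Fin 2))) (r : ℝ) : Set (EuclideanSpace ℝ (Fin 2)) :=
  {x ∈ Ω | r ≤ Metric.infDist x (frontier Ω)}

/-! ## Part II: logarithms and a Borsuk-Eilenberg lemma -/

lemma cs_exists_log {A : Type*} [TopologicalSpace A] [SimplyConnectedSpace A]
    [LocallyPathConnectedSpace A] (F : A → ℂ) (hF : Continuous F) (h0 : ∀ a, F a ≠ 0) :
    ∃ L : A → ℂ, Continuous L ∧ ∀ a, Complex.exp (L a) = F a := by
  have a0 : A := (PathConnectedSpace.nonempty (X := A)).some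
  obtain ⟨e0, he0⟩ : ∃ e0, Complex.exp e0 = F a0 :=
    ⟨Complex.log (F a0), Complex.exp_log (h0 a0)⟩
  let f : C(A, {z : ℂ // z ≠ 0}) := ⟨fun a => ⟨F a, h0 a⟩, by fun_prop⟩
  obtain ⟨L, ⟨_, hL2⟩, _⟩ := Complex.isCoveringMap_exp.existsUnique_continuousMap_lifts
    f a0 e0 (Subtype.ext he0)
  refine ⟨L, L.continuous, fun a => ?_⟩
  have := congrFun hL2 a
  exact congrArg Subtype.val this

lemma cs_const_of_exp {A : Type*} [TopologicalSpace A] [PreconnectedSpace A]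
    (g : A → ℂ) (hg : Continuous g) (h : ∀ a b, Complex.exp (g a) = Complex.exp (g b)) (a b : A) :
    g a = g b :=
  Complex.isCoveringMap_exp.const_of_comp hg (fun a a' => Subtype.ext (h a a')) a b

lemma cs_const_of_exp_on {X : Type*} [TopologicalSpace X] {S : Set X} (hS : IsPreconnected S)
    (g : X → ℂ) (hg : ContinuousOn g S)
    (h : ∀ a ∈ S, ∀ b ∈ S, Complex.exp (g a) = Complex.exp (g b)) {a b : X} (ha : a ∈ S)
    (hb : b ∈ S) : g a = g b := by
  have := isPreconnected_iff_preconnectedSpace.1 hS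
  exact cs_const_of_exp (fun x : S => g x) hg.domRestrict (fun a b => h a a.2 b b.2) ⟨a, ha⟩ ⟨b, hb⟩

/-- Borsuk-Eilenberg type lemma. -/
lemma cs_eilenberg {K U : Set ℂ} (hK : IsClosed K) (hU : IsOpen U)
    (hUb : Bornology.IsBounded U) (hfr : frontier U ⊆ K) {p : ℂ} (hp : p ∈ U) (n : ℤ)
    (G : ℂ → ℂ) (hG : ContinuousOn G (closure U)) (hG0 : ∀ z ∈ closure U, G z ≠ 0)
    (φ : ℂ → ℂ) (hφ : ContinuousOn φ K)
    (h : ∀ z ∈ frontier U, (z - p) ^ n = G z * Complex.exp (φ z)) : n = 0 := by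
  classical
  obtain ⟨ψ, hψ⟩ := ContinuousMap.exists_restrict_eq hK (⟨K.domRestrict φ, hφ.domRestrict⟩ : C(K, ℂ))
  have hψ' : ∀ z ∈ K, ψ z = φ z := fun z hz => by
    have := congrArg (fun f : C(K, ℂ) => f ⟨z, hz⟩) hψ
    exact this
  let F : ℂ → ℂ := U.piecewise (fun z => G z * Complex.exp (ψ z)) (fun z => (z - p) ^ n)
  have hFc : Continuous F := by
    refine continuous_piecewise ?_ ?_ ?_
    · intro a ha
      rw [hψ' a (hfr ha), h a ha]
    · exact hG.mul (by fun_prop)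
    · rw [hU.isClosed_compl.closure_eq]
      refine ContinuousOn.zpow₀ (by fun_prop) n ?_
      intro a ha; left
      rw [sub_ne_zero]; rintro rfl; exact ha hp
  have hF0 : ∀ z, F z ≠ 0 := by
    intro z
    by_cases hz : z ∈ U
    · simp only [F, Set.piecewise_eq_of_mem _ _ _ hz]
      exact mul_ne_zero (hG0 z (subset_closure hz)) (Complex.exp_ne_zero _)
    · simp only [F, Set.piecewise_eq_of_notMem _ _ _ hz]
      refine zpow_ne_zero _ ?_
      rw [sub_ne_zero]; rintro rfl; exact hz hp
  obtain ⟨L, hLc, hL⟩ := cs_exists_log F hFc hF0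
  obtain ⟨ρ, hρ0, hρ⟩ : ∃ ρ : ℝ, 0 < ρ ∧ U ⊆ ball p ρ := hUb.subset_ball_lt 0 p
  have hcirc : ∀ θ : ℝ, F (p + ρ * Complex.exp (θ * Complex.I)) =
      (ρ : ℂ) ^ n * Complex.exp (n * (θ * Complex.I)) := by
    intro θ
    have hz : p + ρ * Complex.exp (θ * Complex.I) ∉ U := by
      intro hz
      have := hρ hz
      rw [mem_ball, dist_eq_norm, add_sub_cancel_left, norm_mul, Complex.norm_exp_ofReal_mul_I] at this
      simp [abs_of_pos hρ0] at this
    simp only [F, Set.piecewise_eq_of_notMem _ _ _ hz]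
    rw [add_sub_cancel_left, mul_zpow, ← Complex.exp_int_mul]
  have hcon := cs_const_of_exp
    (fun θ : ℝ => L (p + ρ * Complex.exp (θ * Complex.I)) - n * (θ * Complex.I))
    (by fun_prop) (by
      intro a b
      simp only [Complex.exp_sub, hL, hcirc]
      rw [mul_div_cancel_right₀ _ (Complex.exp_ne_zero _),
        mul_div_cancel_right₀ _ (Complex.exp_ne_zero _)]) 0 (2 * Real.pi)
  have e1 : Complex.exp ((2 * Real.pi : ℝ) * Complex.I) = 1 := by
    push_cast; exact Complex.exp_two_pi_mul_I
  simp only [e1] at hcon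
  have h2 : (n : ℂ) * (2 * Real.pi * Complex.I) = 0 := by
    simp at hcon
    linear_combination hcon
  have h3 : (2 * Real.pi * Complex.I : ℂ) ≠ 0 := by
    simp [Real.pi_ne_zero]
  exact_mod_cast (mul_eq_zero.1 h2).resolve_right h3

lemma cs_ring_preconnected {I : Set ℝ} (hI : IsPreconnected I) (h0 : ∀ s ∈ I, 0 ≤ s) :
    IsPreconnected {z : ℂ | ‖z‖ ∈ I} := by
  have h : {z : ℂ | ‖z‖ ∈ I} =
      (fun q : ℝ × ℝ => (q.1 : ℂ) * Complex.exp (q.2 * Complex.I)) '' (I ×ˢ univ) := by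
    ext z
    constructor
    · intro hz
      exact ⟨(‖z‖, z.arg), ⟨hz, trivial⟩, Complex.norm_mul_exp_arg_mul_I z⟩
    · rintro ⟨⟨s, θ⟩, ⟨hs, -⟩, rfl⟩
      have : ‖(s : ℂ) * Complex.exp (θ * Complex.I)‖ = s := by
        rw [norm_mul, Complex.norm_exp_ofReal_mul_I]; simp [abs_of_nonneg (h0 s hs)]
      simpa only [mem_setOf_eq, this] using hs
  rw [h]
  exact (hI.prod isPreconnected_univ).image _ (by fun_prop)

lemma cs_frontier_component {O : Set ℂ} (hO : IsOpen O) (q : ℂ) :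
    frontier (connectedComponentIn O q) ⊆ Oᶜ := by
  intro z hz hzO
  have hU : IsOpen (connectedComponentIn O q) := hO.connectedComponentIn
  have hz' : IsOpen (connectedComponentIn O z) := hO.connectedComponentIn
  have hzm : z ∈ connectedComponentIn O z := mem_connectedComponentIn hzO
  have hcl : z ∈ closure (connectedComponentIn O q) := frontier_subset_closure hz
  obtain ⟨w, hw1, hw2⟩ := mem_closure_iff.1 hcl _ hz' hzm
  have e1 := connectedComponentIn_eq hw1
  have e2 := connectedComponentIn_eq hw2
  have : z ∈ connectedComponentIn O q := by rw [e2, ← e1]; exact hzm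
  rw [hU.frontier_eq] at hz
  exact hz.2 this

/-- Descending a function along a parametrization. -/
lemma cs_descend {c : ℝ → ℂ} {D : Set ℝ} (hD : IsCompact D) (hc : ContinuousOn c D)
    (g : ℝ → ℂ) (hg : ContinuousOn g D) (h : ∀ s ∈ D, ∀ t ∈ D, c s = c t → g s = g t) :
    ∃ φ : ℂ → ℂ, ContinuousOn φ (c '' D) ∧ ∀ t ∈ D, φ (c t) = g t := by
  classical
  have key : ∃ φ : ℂ → ℂ, ∀ t ∈ D, φ (c t) = g t := by
    refine ⟨fun z => if hz : ∃ t ∈ D, c t = z then g hz.choose else 0, fun t ht => ?_⟩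
    have hz : ∃ s ∈ D, c s = c t := ⟨t, ht, rfl⟩
    simp only [hz, dif_pos]
    exact h _ hz.choose_spec.1 _ ht hz.choose_spec.2
  obtain ⟨φ, hφ⟩ := key
  refine ⟨φ, ?_, hφ⟩
  rw [continuousOn_iff_isClosed]
  intro C hC
  refine ⟨c '' (D ∩ g ⁻¹' C), ?_, ?_⟩
  · obtain ⟨u, hu, hu2⟩ := continuousOn_iff_isClosed.1 hg C hC
    have : IsCompact (D ∩ g ⁻¹' C) := by
      rw [inter_comm, hu2, inter_comm]; exact hD.inter_right hu
    exact (this.image_of_continuousOn (hc.mono inter_subset_left)).isClosed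
  · ext z
    constructor
    · rintro ⟨hz, t, ht, rfl⟩
      refine ⟨⟨t, ⟨ht, ?_⟩, rfl⟩, ⟨t, ht, rfl⟩⟩
      simpa [hφ t ht] using hz
    · rintro ⟨⟨t, ⟨ht, htC⟩, rfl⟩, -⟩
      refine ⟨?_, ⟨t, ht, rfl⟩⟩
      simpa [hφ t ht] using htC

lemma cs_exp_eq_exp_diff {a b : ℂ} (h : Complex.exp a = Complex.exp b) :
    ∃ m : ℤ, a - b = m * (2 * Real.pi * Complex.I) := by
  obtain ⟨m, hm⟩ := Complex.exp_eq_exp_iff_exists_int.1 h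
  exact ⟨m, by rw [hm]; ring⟩

/-- Abstract parametrized Jordan curve. -/
def CsJordan (Γ : Set ℂ) : Prop :=
  ∀ p ∈ Γ, ∃ c : ℝ → ℂ, Continuous c ∧ c 0 = p ∧ c 1 = p ∧ c '' Icc 0 1 = Γ ∧ InjOn c (Ico 0 1)

lemma CsJordan.isCompact {Γ : Set ℂ} (h : CsJordan Γ) : IsCompact Γ := by
  rcases Γ.eq_empty_or_nonempty with rfl | ⟨p, hp⟩
  · exact isCompact_empty
  · obtain ⟨c, hc, -, -, h, -⟩ := h p hp
    rw [← h]; exact isCompact_Icc.image hc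

lemma cs_jordan_ext {Γ Ω : Set ℂ} (hΓ : CsJordan Γ) (hΩo : IsOpen Ω)
    (hΩb : Bornology.IsBounded Ω) (hΩc : IsConnected Ω) (hfr : frontier Ω = Γ)
    (hcomp : ∀ x ∈ Ω, connectedComponentIn Γᶜ x = Ω) :
    IsPreconnected (closure Ω)ᶜ ∧ interior (closure Ω) = Ω := by
  have hΓc := hΓ.isCompact
  have hO : IsOpen Γᶜ := hΓc.isClosed.isOpen_compl
  obtain ⟨p0, hp0⟩ := hΩc.nonempty
  have hclΩ : closure Ω = Ω ∪ Γ := by rw [closure_eq_self_union_frontier, hfr]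
  have hdisj : Disjoint Ω Γ := by rw [← hfr]; exact (disjoint_frontier_iff_isOpen.2 hΩo).symm
  have hΓne : Γ.Nonempty := by
    rw [← hfr]
    by_contra hne
    rw [not_nonempty_iff_eq_empty, frontier_eq_empty_iff] at hne
    rcases hne with h | h
    · simp [h] at hp0
    · rw [h] at hΩb; exact NormedSpace.unbounded_univ ℝ ℂ hΩb
  -- logs on [0,1]
  have hlog : ∀ (c : ℝ → ℂ), Continuous c → c '' Icc 0 1 = Γ → ∀ y ∉ Γ,
      ∃ L : ℝ → ℂ, ContinuousOn L (Icc 0 1) ∧ ∀ t ∈ Icc (0:ℝ) 1, Complex.exp (L t) = c t - y := by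
    intro c hc hcΓ y hy
    obtain ⟨L, hL1, hL2⟩ := cs_exists_log
      (fun t : ℝ => c (projIcc (0:ℝ) 1 zero_le_one t) - y)
      (by fun_prop) (by
        intro t
        rw [sub_ne_zero]
        rintro h
        apply hy; rw [← h, ← hcΓ]
        exact ⟨_, (projIcc (0:ℝ) 1 zero_le_one t).2, rfl⟩)
    refine ⟨L, hL1.continuousOn, fun t ht => ?_⟩
    rw [hL2, projIcc_of_mem _ ht]
  constructor
  · -- unbounded components
    have hcompU : ∀ q ∉ closure Ω, connectedComponentIn Γᶜ q ⊆ (closure Ω)ᶜ := by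
      intro q hq z hz hzc
      have hzΓ := connectedComponentIn_subset _ _ hz
      have hzΩ : z ∈ Ω := by
        rw [hclΩ] at hzc; exact hzc.resolve_right hzΓ
      have e1 := hcomp z hzΩ
      have e2 := connectedComponentIn_eq hz
      have : q ∈ connectedComponentIn Γᶜ q := by
        refine mem_connectedComponentIn ?_
        intro hqΓ; apply hq; rw [hclΩ]; exact Or.inr hqΓ
      rw [e2, e1] at this
      exact hq (subset_closure this)
    have hunb : ∀ q ∉ closure Ω, ¬ Bornology.IsBounded (connectedComponentIn Γᶜ q) := by
      intro q hq hb
      set U := connectedComponentIn Γᶜ q with hU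
      have hUo : IsOpen U := hO.connectedComponentIn
      have hqΓ : q ∉ Γ := by
        intro hqΓ; apply hq; rw [hclΩ]; exact Or.inr hqΓ
      have hqU : q ∈ U := mem_connectedComponentIn hqΓ
      have hUfr : frontier U ⊆ Γ := by simpa using cs_frontier_component hO q
      have hp0Γ : p0 ∉ Γ := fun h => hdisj.le_bot ⟨hp0, h⟩
      obtain ⟨a, ha⟩ := hΓne
      obtain ⟨c, hc, hc0, hc1, hcΓ, hinj⟩ := hΓ a ha
      obtain ⟨Lp, hLp, hLp'⟩ := hlog c hc hcΓ p0 hp0Γ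
      obtain ⟨Lq, hLq, hLq'⟩ := hlog c hc hcΓ q hqΓ
      have m0 : (0:ℝ) ∈ Icc (0:ℝ) 1 := by simp
      have m1 : (1:ℝ) ∈ Icc (0:ℝ) 1 := by simp
      obtain ⟨m, hm⟩ := cs_exp_eq_exp_diff (a := Lp 1) (b := Lp 0)
        (by rw [hLp' 1 m1, hLp' 0 m0, hc0, hc1])
      obtain ⟨n, hn⟩ := cs_exp_eq_exp_diff (a := Lq 1) (b := Lq 0)
        (by rw [hLq' 1 m1, hLq' 0 m0, hc0, hc1])
      have hglue : ∀ g : ℝ → ℂ, g 0 = g 1 → ∀ s ∈ Icc (0:ℝ) 1, ∀ t ∈ Icc (0:ℝ) 1,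
          c s = c t → g s = g t := by
        intro g hg s hs t ht hst
        have hc01 : c 0 = c 1 := by rw [hc0, hc1]
        rcases eq_or_lt_of_le hs.2 with rfl | hs1 <;> rcases eq_or_lt_of_le ht.2 with rfl | ht1
        · rfl
        · rw [← hc01] at hst
          rw [← hg, hinj ⟨le_rfl, one_pos⟩ ⟨ht.1, ht1⟩ hst]
        · rw [← hc01] at hst
          rw [← hg, hinj ⟨hs.1, hs1⟩ ⟨le_rfl, one_pos⟩ hst]
        · rw [hinj ⟨hs.1, hs1⟩ ⟨ht.1, ht1⟩ hst]
      obtain ⟨φ, hφ1, hφ2⟩ := cs_descend isCompact_Icc hc.continuousOn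
        (fun t => n * Lp t - m * Lq t) (by fun_prop) (hglue _ (by
          linear_combination (m : ℂ) * hn - (n : ℂ) * hm))
      rw [hcΓ] at hφ1
      have hn0 : n = 0 := by
        refine cs_eilenberg hΓc.isClosed hΩo hΩb hfr.subset hp0 n (fun z => (z - q) ^ m) ?_ ?_ φ hφ1 ?_
        · refine ContinuousOn.zpow₀ (by fun_prop) _ ?_
          intro z hz; left; rw [sub_ne_zero]; rintro rfl; exact hq hz
        · intro z hz; refine zpow_ne_zero _ ?_
          rw [sub_ne_zero]; rintro rfl; exact hq hz
        · intro z hz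
          rw [hfr, ← hcΓ] at hz
          obtain ⟨t, ht, rfl⟩ := hz
          rw [hφ2 t ht, Complex.exp_sub, Complex.exp_int_mul, Complex.exp_int_mul, hLp' t ht,
            hLq' t ht]
          rw [mul_div_cancel₀]
          refine zpow_ne_zero _ ?_
          rw [← hLq' t ht]; exact Complex.exp_ne_zero _
      obtain ⟨ψ, hψ1, hψ2⟩ := cs_descend isCompact_Icc hc.continuousOn Lq hLq (hglue _ (by
          rw [hn0] at hn; simp at hn; linear_combination -hn))
      rw [hcΓ] at hψ1
      have : (1 : ℤ) = 0 := by
        refine cs_eilenberg hΓc.isClosed hUo hb hUfr hqU 1 (fun z => 1) (by fun_prop) (by simp)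
          ψ hψ1 ?_
        intro z hz
        have hz := hUfr hz
        rw [← hcΓ] at hz
        obtain ⟨t, ht, rfl⟩ := hz
        rw [hψ2 t ht, hLq' t ht]; simp
      norm_num at this
    obtain ⟨ρ, hρ0, hρ⟩ : ∃ ρ : ℝ, 0 < ρ ∧ Γ ⊆ ball 0 ρ := hΓc.isBounded.subset_ball_lt 0 0
    have hB : IsPreconnected {z : ℂ | ‖z‖ ∈ Ici ρ} :=
      cs_ring_preconnected isPreconnected_Ici (fun s hs => hρ0.le.trans hs)
    have hBΓ : {z : ℂ | ‖z‖ ∈ Ici ρ} ⊆ Γᶜ := by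
      intro z hz hzΓ
      have := hρ hzΓ
      rw [mem_ball_zero_iff] at this
      exact absurd hz (not_le.2 this)
    have hsub : ∀ q ∉ closure Ω, {z : ℂ | ‖z‖ ∈ Ici ρ} ⊆ connectedComponentIn Γᶜ q := by
      intro q hq
      have : ∃ z ∈ connectedComponentIn Γᶜ q, ρ ≤ ‖z‖ := by
        by_contra hcon
        push Not at hcon
        refine hunb q hq ((Metric.isBounded_ball (x := (0:ℂ)) (r := ρ)).subset ?_)
        intro z hz; rw [mem_ball_zero_iff]; exact hcon z hz
      obtain ⟨z, hz, hzρ⟩ := this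
      rw [connectedComponentIn_eq hz]
      exact hB.subset_connectedComponentIn hzρ hBΓ
    rcases (closure Ω)ᶜ.eq_empty_or_nonempty with h | ⟨q, hq⟩
    · rw [h]; exact isPreconnected_empty
    have : (closure Ω)ᶜ = connectedComponentIn Γᶜ q := by
      refine subset_antisymm ?_ (hcompU q hq)
      intro z hz
      have hw : (ρ : ℂ) ∈ {z : ℂ | ‖z‖ ∈ Ici ρ} := by simp [abs_of_pos hρ0]
      have h1 := connectedComponentIn_eq (hsub q hq hw)
      have h2 := connectedComponentIn_eq (hsub z hz hw)
      rw [h1, ← h2]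
      refine mem_connectedComponentIn ?_
      intro hzΓ; apply hz; rw [hclΩ]; exact Or.inr hzΓ
    rw [this]; exact isPreconnected_connectedComponentIn
  · refine subset_antisymm ?_ (interior_maximal subset_closure hΩo)
    intro p hp
    by_contra hpΩ
    have hpΓ : p ∈ Γ := by
      have := interior_subset hp
      rw [hclΩ] at this
      exact this.resolve_left hpΩ
    obtain ⟨ε, hε, hball⟩ := Metric.isOpen_iff.1 isOpen_interior p hp
    obtain ⟨c, hc, hc0, hc1, hcΓ, hinj⟩ := hΓ p hpΓ
    have hp0Γ : p0 ∉ Γ := fun h => hdisj.le_bot ⟨hp0, h⟩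
    obtain ⟨L, hL, hL'⟩ := hlog c hc hcΓ p0 hp0Γ
    let D : Set ℝ := Icc 0 1 ∩ c ⁻¹' (ball p ε)ᶜ
    have hD : IsCompact D := isCompact_Icc.inter_right (isOpen_ball.isClosed_compl.preimage hc)
    have hDsub : ∀ t ∈ D, t ∈ Ico (0:ℝ) 1 := by
      intro t ht
      refine ⟨ht.1.1, lt_of_le_of_ne ht.1.2 ?_⟩
      rintro rfl
      apply ht.2; rw [hc1]; exact mem_ball_self hε
    obtain ⟨φ, hφ1, hφ2⟩ := cs_descend hD hc.continuousOn L (hL.mono inter_subset_left)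
      (fun s hs t ht hst => by rw [hinj (hDsub s hs) (hDsub t ht) hst])
    have hcD : c '' D = Γ \ ball p ε := by
      ext z
      constructor
      · rintro ⟨t, ht, rfl⟩
        exact ⟨hcΓ ▸ ⟨t, ht.1, rfl⟩, ht.2⟩
      · rintro ⟨hz, hzb⟩
        rw [← hcΓ] at hz
        obtain ⟨t, ht, rfl⟩ := hz
        exact ⟨t, ⟨ht, hzb⟩, rfl⟩
    have hUfr : frontier (interior (closure Ω)) ⊆ c '' D := by
      intro z hz
      rw [hcD]
      refine ⟨?_, fun hzb => ?_⟩
      · rw [← hfr]; exact frontier_closure_subset (frontier_interior_subset hz)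
      · exact (disjoint_frontier_iff_isOpen.2 (isOpen_interior (s := closure Ω))).le_bot ⟨hz, hball hzb⟩
    have : (1 : ℤ) = 0 := by
      refine cs_eilenberg (hD.image hc).isClosed isOpen_interior
        (hΩb.closure.subset interior_subset) hUfr
        (interior_maximal subset_closure hΩo hp0) 1 (fun z => 1) (by fun_prop) (by simp)
          φ hφ1 ?_
      intro z hz
      obtain ⟨t, ht, rfl⟩ := hUfr hz
      rw [hφ2 t ht, hL' t ht.1]; simp
    norm_num at this

/-! ## Part III: areas of unions of discs -/

lemma cs_theta_set (a ρ β₁ β₂ : ℝ) (ha : 0 < a) (hρ : 0 < ρ) :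
    volume {θ : ℝ | θ ∈ Ioo (-Real.pi) Real.pi ∧ a < ρ * Real.cos θ ∧ -β₂ ≤ θ ∧ θ ≤ β₁} =
      ENNReal.ofReal (max 0 (min (Real.arccos (a / ρ)) β₁ + min (Real.arccos (a / ρ)) β₂)) := by
  have hset : {θ : ℝ | θ ∈ Ioo (-Real.pi) Real.pi ∧ a < ρ * Real.cos θ ∧ -β₂ ≤ θ ∧ θ ≤ β₁} =
      Ioo (-Real.arccos (a / ρ)) (Real.arccos (a / ρ)) ∩ Icc (-β₂) β₁ := by
    ext θ
    simp only [mem_ofPred_eq, mem_inter_iff, mem_Icc, ← and_assoc]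
    have key : (θ ∈ Ioo (-Real.pi) Real.pi ∧ a < ρ * Real.cos θ) ↔
        θ ∈ Ioo (-Real.arccos (a / ρ)) (Real.arccos (a / ρ)) := by
      rw [mem_Ioo, mem_Ioo, ← abs_lt, ← abs_lt]
      have h1 : a < ρ * Real.cos θ ↔ a / ρ < Real.cos |θ| := by
        rw [Real.cos_abs, div_lt_iff₀ hρ, mul_comm]
      rw [h1]
      constructor
      · rintro ⟨h2, h3⟩
        have : a / ρ ≤ 1 := h3.le.trans (Real.cos_le_one _)
        by_contra h4
        push Not at h4
        have h5 := Real.cos_le_cos_of_nonneg_of_le_pi (Real.arccos_nonneg _) h2.le h4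
        rw [Real.cos_arccos (by have : 0 < a / ρ := by positivity
                                linarith) this] at h5
        linarith
      · intro h2
        have hlt := h2.trans_le (Real.arccos_le_pi _)
        refine ⟨hlt, ?_⟩
        have h3 : 0 < Real.arccos (a / ρ) := (abs_nonneg _).trans_lt h2
        have h4 : a / ρ < 1 := by
          by_contra h; push Not at h
          rw [Real.arccos_of_one_le h] at h3; exact lt_irrefl _ h3
        have h5 := Real.cos_lt_cos_of_nonneg_of_le_pi (abs_nonneg θ) (Real.arccos_le_pi _) h2
        rwa [Real.cos_arccos (by have : 0 < a / ρ := by positivity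
                                 linarith) h4.le] at h5
    rw [key]
  rw [hset, measure_congr (show (Ioo (-Real.arccos (a / ρ)) (Real.arccos (a / ρ)) ∩ Icc (-β₂) β₁ : Set ℝ)
    =ᵐ[volume] (Icc (-Real.arccos (a / ρ)) (Real.arccos (a / ρ)) ∩ Icc (-β₂) β₁ : Set ℝ) from
    Ioo_ae_eq_Icc.inter (ae_eq_refl _)), Icc_inter_Icc, Real.volume_Icc]
  rw [max_comm 0, ENNReal.ofReal_max]
  simp only [ENNReal.ofReal_zero, max_zero]
  congr 1
  rw [← neg_neg (max (-Real.arccos (a / ρ)) (-β₂)), ← min_neg_neg (-Real.arccos (a/ρ))]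
  simp only [neg_neg]; ring

lemma cs_sector_area (a β₁ β₂ t : ℝ) (ha : 0 < a) (Q : Set ℂ) (hQ : MeasurableSet Q)
    (h : ∀ ρ θ : ℝ, 0 < ρ → -(Real.pi / 2) < θ → θ < Real.pi / 2 →
      ((ρ * (Real.cos θ + Real.sin θ * Complex.I) : ℂ) ∈ Q ↔ -β₂ ≤ θ ∧ θ ≤ β₁)) :
    volume {w : ℂ | ‖w‖ ≤ t ∧ a < w.re ∧ w ∈ Q} =
      ∫⁻ ρ in Ioc 0 t, ENNReal.ofReal (ρ * max 0 (min (Real.arccos (a / ρ)) β₁ +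
        min (Real.arccos (a / ρ)) β₂)) := by
  have hm : MeasurableSet {w : ℂ | ‖w‖ ≤ t ∧ a < w.re ∧ w ∈ Q} := by
    refine MeasurableSet.inter ?_ (MeasurableSet.inter ?_ hQ)
    · exact measurableSet_le measurable_norm measurable_const
    · exact measurableSet_lt measurable_const Complex.measurable_re
  rw [← lintegral_indicator_one hm, ← Complex.lintegral_comp_polarCoord_symm]
  rw [polarCoord_target, Measure.volume_eq_prod, ← Measure.prod_restrict, lintegral_prod _ (by
    refine Measurable.aemeasurable ?_
    refine Measurable.smul (ENNReal.measurable_ofReal.comp measurable_fst) ?_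
    refine (measurable_const.indicator hm).comp ?_
    have e : (Complex.polarCoord.symm : ℝ × ℝ → ℂ) =
      fun p => (p.1 * (Real.cos p.2 + Real.sin p.2 * Complex.I) : ℂ) :=
      funext fun p => Complex.polarCoord_symm_apply p
    rw [e]
    fun_prop)]
  rw [← lintegral_indicator measurableSet_Ioi, ← lintegral_indicator measurableSet_Ioc]
  congr 1
  ext ρ
  by_cases hρ : 0 < ρ
  swap
  · rw [indicator_of_notMem, indicator_of_notMem]
    · simp; intro h; exact absurd h hρ
    · simpa using hρ
  rw [indicator_of_mem (by simpa using hρ)]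
  have hnorm : ∀ θ : ℝ, ‖Complex.polarCoord.symm (ρ, θ)‖ = ρ := by
    intro θ
    rw [Complex.norm_polarCoord_symm]; exact abs_of_pos hρ
  have hre : ∀ θ : ℝ, (Complex.polarCoord.symm (ρ, θ)).re = ρ * Real.cos θ := by
    intro θ
    rw [Complex.polarCoord_symm_apply]
    simp [-Complex.ofReal_cos, -Complex.ofReal_sin]
  simp only [smul_eq_mul]
  rw [lintegral_const_mul']
  swap
  · exact ENNReal.ofReal_ne_top
  by_cases hρt : ρ ≤ t
  · rw [indicator_of_mem (show ρ ∈ Ioc 0 t from ⟨hρ, hρt⟩), ENNReal.ofReal_mul hρ.le, ← cs_theta_set a ρ β₁ β₂ ha hρ]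
    congr 1
    rw [← lintegral_indicator measurableSet_Ioo]
    have hmeas : MeasurableSet {θ : ℝ | θ ∈ Ioo (-Real.pi) Real.pi ∧ a < ρ * Real.cos θ ∧ -β₂ ≤ θ ∧ θ ≤ β₁} := by
      measurability
    rw [← lintegral_indicator_one hmeas]
    congr 1
    ext θ
    by_cases hθ : θ ∈ Ioo (-Real.pi) Real.pi
    · rw [indicator_of_mem hθ]
      simp only [indicator, mem_ofPred_eq, Pi.one_apply]
      congr 1
      rw [eq_iff_iff, hnorm, hre]
      simp only [hρt, hθ, true_and]
      refine and_congr_right fun h1 => ?_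
      rw [Complex.polarCoord_symm_apply]
      have hcos : 0 < Real.cos θ := by
        have : 0 < ρ * Real.cos θ := ha.trans h1
        exact (pos_iff_pos_of_mul_pos this).1 hρ
      have hθ2 : -(Real.pi/2) < θ ∧ θ < Real.pi / 2 := by
        constructor
        · by_contra hh
          push Not at hh
          have := Real.cos_nonpos_of_pi_div_two_le_of_le (x := -θ) (by linarith) (by linarith [hθ.1, Real.pi_pos])
          rw [Real.cos_neg] at this; linarith
        · by_contra hh
          push Not at hh
          have := Real.cos_nonpos_of_pi_div_two_le_of_le (x := θ) (by linarith) (by linarith [hθ.2, Real.pi_pos])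
          linarith
      simpa using h ρ θ hρ hθ2.1 hθ2.2
    · rw [indicator_of_notMem hθ, indicator_of_notMem]
      exact fun h => hθ h.1
  · rw [indicator_of_notMem (show ρ ∉ Ioc 0 t from fun h => hρt h.2)]
    have : ∀ θ : ℝ, Complex.polarCoord.symm (ρ, θ) ∉ {w : ℂ | ‖w‖ ≤ t ∧ a < w.re ∧ w ∈ Q} := by
      intro θ hh
      exact hρt ((hnorm θ) ▸ hh.1)
    simp only [indicator_of_notMem (this _), lintegral_zero, mul_zero]

open ComplexConjugate in
/-- signed double area of a triangle -/
noncomputable def csCr (a b c : ℂ) : ℝ := (conj (b - a) * (c - a)).im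

open ComplexConjugate in
noncomputable def csP (a b c : ℂ) : ℝ := ((c - a) * conj (c - b)).re

noncomputable def csG (a b c : ℂ) : ℝ :=
  if 0 < csCr a b c then Real.arctan (csP a b c / csCr a b c) else Real.pi / 2

noncomputable def csB {N : ℕ} (x : Fin N → ℂ) (i j : Fin N) : ℝ :=
  Finset.univ.inf' ⟨i, Finset.mem_univ i⟩ (fun k => csG (x i) (x j) (x k))

noncomputable def csM {N : ℕ} (x : Fin N → ℂ) (i j : Fin N) (u : ℝ) : ℝ :=
  min (Real.arccos (dist (x i) (x j) / 2 / u)) (csB x i j)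

noncomputable def csPhi {N : ℕ} (x : Fin N → ℂ) (i j : Fin N) (u : ℝ) : ℝ :=
  max 0 (csM x i j u + csM x j i u)

noncomputable def csEll {N : ℕ} (x : Fin N → ℂ) (u : ℝ) : ℝ :=
  u * (2 * Real.pi * N - ∑ i, ∑ j ∈ Finset.univ.filter (· ≠ i), csPhi x i j u)

def csCell {N : ℕ} (x : Fin N → ℂ) (i : Fin N) (t : ℝ) : Set ℂ :=
  {y | dist y (x i) ≤ t ∧ ∀ j, dist y (x i) ≤ dist y (x j)}

def csA {N : ℕ} (x : Fin N → ℂ) (t : ℝ) : Set ℂ := ⋃ i, closedBall (x i) t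

structure CsGP {N : ℕ} (x : Fin N → ℂ) : Prop where
  inj : Function.Injective x
  nc : ∀ i j k, i ≠ j → i ≠ k → j ≠ k → csCr (x i) (x j) (x k) ≠ 0
  ncyc : ∀ i j k l, i ≠ j → i ≠ k → i ≠ l → j ≠ k → j ≠ l → k ≠ l → ∀ c,
    ¬ (dist c (x i) = dist c (x j) ∧ dist c (x i) = dist c (x k) ∧ dist c (x i) = dist c (x l))

lemma csCr_eq (a b c : ℂ) :
    csCr a b c = (b - a).re * (c - a).im - (b - a).im * (c - a).re := by
  simp [csCr]; ring

lemma csP_eq (a b c : ℂ) :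
    csP a b c = (c - a).re * (c - b).re + (c - a).im * (c - b).im := by
  simp [csP]; ring

lemma csCr_swap (a b c : ℂ) : csCr b a c = - csCr a b c := by
  simp only [csCr_eq, Complex.sub_re, Complex.sub_im]; ring

lemma csP_swap (a b c : ℂ) : csP b a c = csP a b c := by
  simp only [csP_eq, Complex.sub_re, Complex.sub_im]; ring

lemma csCr_left (a b : ℂ) : csCr a b a = 0 := by simp [csCr]
lemma csCr_right (a b : ℂ) : csCr a b b = 0 := by simp [csCr_eq]; ring
lemma csP_left (a b : ℂ) : csP a b a = 0 := by simp [csP]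
lemma csP_right (a b : ℂ) : csP a b b = 0 := by simp [csP]

lemma csA_eq {N : ℕ} (x : Fin N → ℂ) (t : ℝ) : csA x t = ⋃ i, csCell x i t := by
  ext y
  simp only [csA, mem_iUnion, mem_closedBall]
  constructor
  · rintro ⟨i, hi⟩
    have : Nonempty (Fin N) := ⟨i⟩
    obtain ⟨j, hj⟩ := Finite.exists_min (fun j => dist y (x j))
    exact ⟨j, (hj i).trans hi, hj⟩
  · rintro ⟨i, hi⟩
    exact ⟨i, hi.1⟩

lemma csCell_isClosed {N : ℕ} (x : Fin N → ℂ) (i : Fin N) (t : ℝ) : IsClosed (csCell x i t) := by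
  have : csCell x i t = {y | dist y (x i) ≤ t} ∩ ⋂ j, {y | dist y (x i) ≤ dist y (x j)} := by
    ext y; simp [csCell]
  rw [this]
  refine IsClosed.inter (isClosed_le (by fun_prop) (by fun_prop)) (isClosed_iInter fun j =>
    isClosed_le (by fun_prop) (by fun_prop))

lemma cs_line_null (w : ℂ) (hw : w ≠ 0) (c : ℝ) : volume {y : ℂ | (y * w).re = c} = 0 := by
  rcases {y : ℂ | (y * w).re = c}.eq_empty_or_nonempty with h | ⟨y0, hy0⟩
  · rw [h]; exact measure_empty
  let f : ℂ →ₗ[ℝ] ℝ := Complex.reLm ∘ₗ (LinearMap.mulRight ℝ w)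
  have hk : LinearMap.ker f ≠ ⊤ := by
    intro h
    rw [LinearMap.ker_eq_top] at h
    have := LinearMap.congr_fun h w⁻¹
    simp [f, hw] at this
  have h0 := Measure.addHaar_submodule volume (LinearMap.ker f) hk
  have : {y : ℂ | (y * w).re = c} = (fun y => y - y0) ⁻¹' (LinearMap.ker f : Set ℂ) := by
    ext y
    simp only [mem_ofPred_eq] at hy0
    rw [mem_preimage, SetLike.mem_coe, LinearMap.mem_ker]
    simp only [mem_ofPred_eq, f, LinearMap.comp_apply, LinearMap.mulRight_apply, Complex.reLm_coe,
      sub_mul, Complex.sub_re, hy0, sub_eq_zero]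
  simp only [sub_eq_add_neg] at this
  rw [this, measure_preimage_add_right, h0]

lemma cs_sq_le_iff (y a b : ℂ) :
    dist y a ≤ dist y b ↔ 2 * ((y - a).re * (b - a).re + (y - a).im * (b - a).im) ≤
      Complex.normSq (b - a) := by
  rw [dist_eq_norm, dist_eq_norm, ← sq_le_sq₀ (norm_nonneg _) (norm_nonneg _),
    ← Complex.normSq_eq_norm_sq, ← Complex.normSq_eq_norm_sq]
  simp only [Complex.normSq_apply, Complex.sub_re, Complex.sub_im]
  constructor <;> intro h <;> nlinarith

lemma cs_eq_iff (y a b : ℂ) :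
    dist y a = dist y b ↔ 2 * ((y - a).re * (b - a).re + (y - a).im * (b - a).im) =
      Complex.normSq (b - a) := by
  rw [dist_eq_norm, dist_eq_norm, ← sq_eq_sq₀ (norm_nonneg _) (norm_nonneg _),
    ← Complex.normSq_eq_norm_sq, ← Complex.normSq_eq_norm_sq]
  simp only [Complex.normSq_apply, Complex.sub_re, Complex.sub_im]
  constructor <;> intro h <;> nlinarith

open ComplexConjugate in
lemma cs_bisector_null (a b : ℂ) (h : a ≠ b) : volume {y : ℂ | dist y a = dist y b} = 0 := by
  refine measure_mono_null ?_ (cs_line_null (conj (b - a)) ?_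
    (Complex.normSq (b - a) / 2 + (a * conj (b - a)).re))
  · intro y hy
    have := (cs_eq_iff y a b).1 hy
    simp only [mem_ofPred_eq, Complex.mul_re, Complex.conj_re, Complex.conj_im]
    simp only [Complex.sub_re, Complex.sub_im] at this ⊢
    linarith
  · rw [map_ne_zero, sub_ne_zero]; exact h.symm

noncomputable def csLam (a b y : ℂ) : ℝ :=
  2 * ((y - a).re * (b - a).re + (y - a).im * (b - a).im) / Complex.normSq (b - a)

def csS {N : ℕ} (x : Fin N → ℂ) (i j : Fin N) (t : ℝ) : Set ℂ :=
  {y | dist y (x i) ≤ t ∧ 1 < csLam (x i) (x j) y ∧ ∀ k, csLam (x i) (x k) y ≤ csLam (x i) (x j) y}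

lemma csLam_cont (a b : ℂ) : Continuous (csLam a b) := by
  unfold csLam; fun_prop

lemma csS_meas {N : ℕ} (x : Fin N → ℂ) (i j : Fin N) (t : ℝ) : MeasurableSet (csS x i j t) := by
  have : csS x i j t = {y | dist y (x i) ≤ t} ∩ ({y | 1 < csLam (x i) (x j) y} ∩ ⋂ k,
      {y | csLam (x i) (x k) y ≤ csLam (x i) (x j) y}) := by
    ext y; simp [csS]
  rw [this]
  refine (isClosed_le (by fun_prop) (by fun_prop)).measurableSet.inter
    ((isOpen_lt continuous_const (csLam_cont _ _)).measurableSet.inter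
    (MeasurableSet.iInter fun k => (isClosed_le (csLam_cont _ _) (csLam_cont _ _)).measurableSet))

lemma cs_ball_decomp {N : ℕ} (x : Fin N → ℂ) (hx : Function.Injective x) (i : Fin N) (t : ℝ) :
    closedBall (x i) t = csCell x i t ∪ ⋃ j ∈ Finset.univ.filter (· ≠ i), csS x i j t := by
  have hns : ∀ j, j ≠ i → 0 < Complex.normSq (x j - x i) := by
    intro j hj; rw [Complex.normSq_pos, sub_ne_zero]; exact fun h => hj (hx h)
  have hle : ∀ y, ∀ j, j ≠ i → (dist y (x i) ≤ dist y (x j) ↔ csLam (x i) (x j) y ≤ 1) := by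
    intro y j hj
    rw [cs_sq_le_iff, csLam, div_le_one (hns j hj)]
  ext y
  simp only [mem_closedBall, mem_union, mem_iUnion, Finset.mem_filter, Finset.mem_univ, true_and,
    exists_prop]
  constructor
  · intro hy
    by_cases h : y ∈ csCell x i t
    · exact Or.inl h
    · right
      have : Nonempty (Fin N) := ⟨i⟩
      obtain ⟨j, hj⟩ := Finite.exists_max (fun k => csLam (x i) (x k) y)
      have hex : ∃ k, k ≠ i ∧ 1 < csLam (x i) (x k) y := by
        by_contra hcon
        push Not at hcon
        refine h ⟨hy, fun k => ?_⟩
        by_cases hk : k = i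
        · rw [hk]
        · exact (hle y k hk).2 (hcon k hk)
      obtain ⟨k, hk, hk1⟩ := hex
      have h1 : 1 < csLam (x i) (x j) y := hk1.trans_le (hj k)
      refine ⟨j, ?_, hy, h1, hj⟩
      rintro rfl
      simp [csLam] at h1
      linarith
  · rintro (h | ⟨j, -, h⟩)
    · exact h.1
    · exact h.1

lemma cs_cell_area {N : ℕ} (x : Fin N → ℂ) (hx : Function.Injective x) (i : Fin N) (t : ℝ) :
    volume (closedBall (x i) t) =
      volume (csCell x i t) + ∑ j ∈ Finset.univ.filter (· ≠ i), volume (csS x i j t) := by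
  have hns : ∀ j, j ≠ i → 0 < Complex.normSq (x j - x i) := by
    intro j hj; rw [Complex.normSq_pos, sub_ne_zero]; exact fun h => hj (hx h)
  rw [cs_ball_decomp x hx i t, measure_union, measure_biUnion_finset₀]
  · intro j hj k hk hjk
    simp only [Finset.coe_filter, Finset.mem_univ, true_and, mem_ofPred_eq] at hj hk
    have hw : (1 / Complex.normSq (x j - x i) : ℂ) * (starRingEnd ℂ) (x j - x i) -
        (1 / Complex.normSq (x k - x i) : ℂ) * (starRingEnd ℂ) (x k - x i) ≠ 0 := by
      intro h
      have e : ∀ l, (1 / Complex.normSq (x l - x i) : ℂ) * (starRingEnd ℂ) (x l - x i) =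
          (x l - x i)⁻¹ := by
        intro l; rw [Complex.inv_def]; push_cast; rw [one_div]; ring
      rw [e, e, sub_eq_zero, inv_inj, sub_left_inj] at h
      exact hjk (hx h)
    refine measure_mono_null ?_ (cs_line_null _ hw ((x i * ((1 / Complex.normSq (x j - x i) : ℂ) * (starRingEnd ℂ) (x j - x i) -
        (1 / Complex.normSq (x k - x i) : ℂ) * (starRingEnd ℂ) (x k - x i))).re))
    rintro y ⟨h1, h2⟩
    have h3 : csLam (x i) (x j) y = csLam (x i) (x k) y := le_antisymm (h2.2.2 j) (h1.2.2 k)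
    rw [mem_ofPred_eq, ← sub_eq_zero, ← Complex.sub_re, ← sub_mul]
    have e : ∀ l, ((y - x i) * ((1 / Complex.normSq (x l - x i) : ℂ) * (starRingEnd ℂ) (x l - x i))).re
        = csLam (x i) (x l) y / 2 := by
      intro l
      have : (1 / Complex.normSq (x l - x i) : ℂ) = ((1 / Complex.normSq (x l - x i) : ℝ) : ℂ) := by
        push_cast; rfl
      rw [this, ← mul_assoc, mul_comm (y - x i), mul_assoc, Complex.re_ofReal_mul]
      simp only [csLam, Complex.mul_re, Complex.conj_re, Complex.conj_im]
      ring
    rw [mul_sub, Complex.sub_re, e, e, h3, sub_self]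
  · intro j _; exact (csS_meas x i j t).nullMeasurableSet
  · rw [Set.disjoint_left]
    intro y hy hy2
    simp only [mem_iUnion, Finset.mem_filter, Finset.mem_univ, true_and, exists_prop] at hy2
    obtain ⟨j, hj, hjs⟩ := hy2
    have := (cs_sq_le_iff _ _ _).1 (hy.2 j)
    have h2 := hjs.2.1
    rw [csLam, lt_div_iff₀ (hns j hj)] at h2
    linarith
  · exact Finset.measurableSet_biUnion _ fun j _ => csS_meas x i j t

lemma cs_A_area {N : ℕ} (x : Fin N → ℂ) (hx : Function.Injective x) (t : ℝ) :
    volume (csA x t) = ∑ i, volume (csCell x i t) := by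
  rw [csA_eq, measure_iUnion₀, tsum_fintype]
  · intro i j hij
    refine measure_mono_null ?_ (cs_bisector_null (x i) (x j) (fun h => hij (hx h)))
    rintro y ⟨h1, h2⟩
    exact le_antisymm (h1.2 j) (h2.2 i)
  · intro i; exact (csCell_isClosed x i t).measurableSet.nullMeasurableSet

lemma csB_le_iff {N : ℕ} (x : Fin N → ℂ) (i j : Fin N) (θ : ℝ) :
    θ ≤ csB x i j ↔ ∀ k, θ ≤ csG (x i) (x j) (x k) := by
  unfold csB
  refine (Finset.le_inf'_iff _ _).trans ?_
  exact ⟨fun h k => h k (Finset.mem_univ k), fun h k _ => h k⟩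

/-- angular form of the constraint from a third point -/
lemma cs_angle_iff {a b c : ℂ} {θ : ℝ} (h1 : -(Real.pi / 2) < θ) (h2 : θ < Real.pi / 2)
    (hcr : csCr a b c ≠ 0 ∨ csP a b c = 0) :
    csCr a b c * Real.sin θ ≤ csP a b c * Real.cos θ ↔
      θ ≤ csG a b c ∧ -θ ≤ csG b a c := by
  have hcos : 0 < Real.cos θ := Real.cos_pos_of_mem_Ioo ⟨h1, h2⟩
  have key : csCr a b c * Real.sin θ ≤ csP a b c * Real.cos θ ↔
      csCr a b c * Real.tan θ ≤ csP a b c := by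
    rw [Real.tan_eq_sin_div_cos, ← mul_div_assoc, div_le_iff₀ hcos]
  rw [key]
  unfold csG
  rw [csCr_swap a b c, csP_swap a b c]
  rcases lt_trichotomy (csCr a b c) 0 with h | h | h
  · rw [if_neg (by linarith), if_pos (by linarith)]
    have e : csP a b c / -csCr a b c = -(csP a b c / csCr a b c) := by rw [div_neg]
    rw [e, Real.arctan_neg, neg_le_neg_iff]
    have : csCr a b c * Real.tan θ ≤ csP a b c ↔ csP a b c / csCr a b c ≤ Real.tan θ := by
      rw [div_le_iff_of_neg h, mul_comm]
    rw [this, ← Real.arctan_le_arctan_iff, Real.arctan_tan h1 h2]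
    simp [h2.le]
  · have hp := hcr.resolve_left (by simpa using h)
    rw [h, hp]; simp [h2.le]; linarith
  · rw [if_pos h, if_neg (by linarith)]
    rw [mul_comm, ← le_div_iff₀ h, ← Real.arctan_le_arctan_iff, Real.arctan_tan h1 h2]
    simp; intro; linarith

lemma CsGP.cr_or {N : ℕ} {x : Fin N → ℂ} (hx : CsGP x) {i j : Fin N} (hij : i ≠ j) (k : Fin N) :
    csCr (x i) (x j) (x k) ≠ 0 ∨ csP (x i) (x j) (x k) = 0 := by
  by_cases h1 : i = k
  · right; rw [h1, csP_left]
  by_cases h2 : j = k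
  · right; rw [h2, csP_right]
  exact Or.inl (hx.nc i j k hij h1 h2)

lemma cs_angle_all {N : ℕ} {x : Fin N → ℂ} (hx : CsGP x) {i j : Fin N} (hij : i ≠ j) {θ : ℝ}
    (h1 : -(Real.pi / 2) < θ) (h2 : θ < Real.pi / 2) :
    (∀ k, csCr (x i) (x j) (x k) * Real.sin θ ≤ csP (x i) (x j) (x k) * Real.cos θ) ↔
      -csB x j i ≤ θ ∧ θ ≤ csB x i j := by
  rw [neg_le, csB_le_iff, csB_le_iff, ← forall_and]
  refine forall_congr' fun k => ?_
  rw [cs_angle_iff h1 h2 (hx.cr_or hij k), and_comm]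

/-- coordinates adapted to the pair `a,b` -/
lemma cs_lam_coord {a b : ℂ} (hab : a ≠ b) (w : ℂ) :
    csLam a b (a + (b - a) / ‖b - a‖ * w) = w.re / (dist a b / 2) := by
  have hn : ‖b - a‖ ≠ 0 := by rw [norm_ne_zero_iff, sub_ne_zero]; exact hab.symm
  rw [csLam, dist_comm, dist_eq_norm, Complex.normSq_eq_norm_sq, add_sub_cancel_left]
  have e : (b - a) / (‖b - a‖ : ℂ) * w = ((‖b - a‖⁻¹ : ℝ) : ℂ) * ((b - a) * w) := by
    push_cast; field_simp
  rw [e, Complex.re_ofReal_mul, Complex.im_ofReal_mul, Complex.mul_re, Complex.mul_im]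
  have hsq : (b - a).re * (b - a).re + (b-a).im * (b-a).im = ‖b - a‖ ^ 2 := by
    rw [← Complex.normSq_eq_norm_sq, Complex.normSq_apply]
  rw [div_eq_div_iff (by positivity) (by positivity)]
  field_simp
  linear_combination (w.re) * hsq

lemma cs_lam_coord2 {a b c : ℂ} (hab : a ≠ b) (w : ℂ) (hpos : 0 < w.re) (hcr : csCr a b c ≠ 0 ∨ csP a b c = 0) :
    csLam a c (a + (b - a) / ‖b - a‖ * w) ≤ csLam a b (a + (b - a) / ‖b - a‖ * w) ↔
      csCr a b c * w.im ≤ csP a b c * w.re := by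
  have hn : 0 < ‖b - a‖ := by rw [norm_pos_iff, sub_ne_zero]; exact hab.symm
  rw [cs_lam_coord hab]
  by_cases hca : c = a
  · subst hca
    rw [csCr_left, csP_left]; simp [csLam]; positivity
  have hc : 0 < Complex.normSq (c - a) := by rw [Complex.normSq_pos, sub_ne_zero]; exact hca
  rw [csLam, dist_comm, dist_eq_norm, add_sub_cancel_left]
  have e : (b - a) / (‖b - a‖ : ℂ) * w = ((‖b - a‖⁻¹ : ℝ) : ℂ) * ((b - a) * w) := by
    push_cast; field_simp
  rw [e, Complex.re_ofReal_mul, Complex.im_ofReal_mul, Complex.mul_re, Complex.mul_im]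
  rw [div_le_div_iff₀ hc (by positivity), csCr_eq, csP_eq]
  have h1 : 2 * (‖b - a‖⁻¹ * ((b - a).re * w.re - (b - a).im * w.im) * (c - a).re +
            ‖b - a‖⁻¹ * ((b - a).re * w.im + (b - a).im * w.re) * (c - a).im) * (‖b - a‖ / 2) =
     ((b - a).re * w.re - (b - a).im * w.im) * (c - a).re + ((b - a).re * w.im + (b - a).im * w.re) * (c - a).im := by
    field_simp
  rw [h1]
  rw [Complex.normSq_apply]
  simp only [Complex.sub_re, Complex.sub_im]
  constructor <;> intro h <;> nlinarith

lemma cs_S_area {N : ℕ} {x : Fin N → ℂ} (hx : CsGP x) {i j : Fin N} (hij : i ≠ j) (t : ℝ) :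
    volume (csS x i j t) = ∫⁻ ρ in Ioc 0 t, ENNReal.ofReal (ρ * csPhi x i j ρ) := by
  have hab : x i ≠ x j := fun h => hij (hx.inj h)
  have hn : 0 < ‖x j - x i‖ := by rw [norm_pos_iff, sub_ne_zero]; exact hab.symm
  have ha : 0 < dist (x i) (x j) / 2 := by have := dist_pos.2 hab; positivity
  let Q : Set ℂ := ⋂ k, {w : ℂ | csCr (x i) (x j) (x k) * w.im ≤ csP (x i) (x j) (x k) * w.re}
  have hQ : MeasurableSet Q := MeasurableSet.iInter fun k =>
    (isClosed_le (by fun_prop) (by fun_prop)).measurableSet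
  have hu : ‖(x j - x i) / (‖x j - x i‖ : ℂ)‖ = 1 := by
    rw [norm_div, Complex.norm_real, Real.norm_of_nonneg (norm_nonneg _), div_self hn.ne']
  let u : Circle := ⟨(x j - x i) / ‖x j - x i‖, mem_sphere_zero_iff_norm.2 hu⟩
  have hT : MeasurePreserving (fun w : ℂ => x i + (x j - x i) / ‖x j - x i‖ * w) volume volume := by
    exact (measurePreserving_add_left volume (x i)).comp (rotation u).measurePreserving
  rw [← hT.measure_preimage (csS_meas x i j t).nullMeasurableSet]
  have hset : (fun w : ℂ => x i + (x j - x i) / ‖x j - x i‖ * w) ⁻¹' csS x i j t =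
      {w : ℂ | ‖w‖ ≤ t ∧ dist (x i) (x j) / 2 < w.re ∧ w ∈ Q} := by
    ext w
    simp only [csS, mem_preimage, mem_ofPred_eq, Q, mem_iInter]
    rw [dist_eq_norm, add_sub_cancel_left, norm_mul, hu, one_mul, cs_lam_coord hab w,
      one_lt_div ha]
    refine and_congr_right fun _ => and_congr_right fun h => forall_congr' fun k => ?_
    rw [← cs_lam_coord2 hab w (ha.trans h) (hx.cr_or hij k), cs_lam_coord hab w]
  rw [hset, cs_sector_area _ (csB x i j) (csB x j i) t ha Q hQ]
  · simp only [csPhi, csM, dist_comm (x j) (x i)]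
  · intro ρ θ hρ h1 h2
    rw [← cs_angle_all hx hij h1 h2]
    simp only [Q, mem_iInter, mem_ofPred_eq]
    refine forall_congr' fun k => ?_
    simp only [Complex.re_ofReal_mul, Complex.im_ofReal_mul]
    have e1 : (Real.cos θ + Real.sin θ * Complex.I : ℂ).re = Real.cos θ := by simp [-Complex.ofReal_cos, -Complex.ofReal_sin]
    have e2 : (Real.cos θ + Real.sin θ * Complex.I : ℂ).im = Real.sin θ := by simp [-Complex.ofReal_cos, -Complex.ofReal_sin]
    rw [e1, e2, mul_left_comm, mul_left_comm (csP _ _ _), mul_le_mul_iff_right₀ hρ]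

lemma csM_cont {N : ℕ} (x : Fin N → ℂ) (i j : Fin N) : ContinuousOn (csM x i j) (Ioi 0) := by
  unfold csM
  refine ContinuousOn.inf ?_ continuousOn_const
  refine Real.continuous_arccos.comp_continuousOn ?_
  exact continuousOn_const.div continuousOn_id (fun u hu => ne_of_gt hu)

lemma csPhi_cont {N : ℕ} (x : Fin N → ℂ) (i j : Fin N) : ContinuousOn (csPhi x i j) (Ioi 0) := by
  unfold csPhi
  exact continuousOn_const.sup ((csM_cont x i j).add (csM_cont x j i))

lemma csEll_cont {N : ℕ} (x : Fin N → ℂ) : ContinuousOn (csEll x) (Ioi 0) := by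
  unfold csEll
  refine continuousOn_id.mul (continuousOn_const.sub ?_)
  exact continuousOn_finsetSum _ fun i _ => continuousOn_finsetSum _ fun j _ => csPhi_cont x i j

lemma csPhi_bound {N : ℕ} (x : Fin N → ℂ) (i j : Fin N) (u : ℝ) :
    0 ≤ csPhi x i j u ∧ csPhi x i j u ≤ 2 * Real.pi := by
  unfold csPhi csM
  refine ⟨le_max_left _ _, max_le (by positivity) ?_⟩
  have h1 := min_le_left (Real.arccos (dist (x i) (x j) / 2 / u)) (csB x i j)
  have h2 := min_le_left (Real.arccos (dist (x j) (x i) / 2 / u)) (csB x j i)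
  have h3 := Real.arccos_le_pi (dist (x i) (x j) / 2 / u)
  have h4 := Real.arccos_le_pi (dist (x j) (x i) / 2 / u)
  linarith

lemma csPhi_int {N : ℕ} (x : Fin N → ℂ) (i j : Fin N) (t : ℝ) :
    IntegrableOn (fun u => u * csPhi x i j u) (Ioc 0 t) := by
  refine Integrable.of_bound (C := t * (2 * Real.pi)) ?_ ?_
  · have : ContinuousOn (fun u => u * csPhi x i j u) (Ioc 0 t) :=
      (continuousOn_id.mul (csPhi_cont x i j)).mono (fun u hu => hu.1)
    exact this.aestronglyMeasurable measurableSet_Ioc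
  · filter_upwards [ae_restrict_mem measurableSet_Ioc] with u hu
    obtain ⟨h1, h2⟩ := csPhi_bound x i j u
    rw [Real.norm_of_nonneg (mul_nonneg hu.1.le h1)]
    exact mul_le_mul hu.2 h2 h1 (hu.1.le.trans hu.2)

/-- Area of a union of discs. -/
lemma cs_W_eq {N : ℕ} {x : Fin N → ℂ} (hx : CsGP x) {t : ℝ} (ht : 0 ≤ t) :
    (volume (csA x t)).toReal = ∫ u in (0:ℝ)..t, csEll x u := by
  have hS : ∀ i j, i ≠ j → (volume (csS x i j t)).toReal = ∫ u in (0:ℝ)..t, u * csPhi x i j u := by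
    intro i j hij
    rw [cs_S_area hx hij, intervalIntegral.integral_of_le ht,
      integral_eq_lintegral_of_nonneg_ae ?_ (csPhi_int x i j t).aestronglyMeasurable]
    filter_upwards [ae_restrict_mem measurableSet_Ioc] with u hu
    exact mul_nonneg hu.1.le (csPhi_bound x i j u).1
  have hfin : ∀ i, volume (csCell x i t) ≠ ⊤ := by
    intro i
    refine ne_top_of_le_ne_top ?_ (measure_mono (show csCell x i t ⊆ closedBall (x i) t from
      fun y hy => hy.1))
    exact measure_closedBall_lt_top.ne
  have hfinS : ∀ i j, volume (csS x i j t) ≠ ⊤ := by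
    intro i j
    refine ne_top_of_le_ne_top ?_ (measure_mono (show csS x i j t ⊆ closedBall (x i) t from
      fun y hy => hy.1))
    exact measure_closedBall_lt_top.ne
  have hC : ∀ i, (volume (csCell x i t)).toReal = ∫ u in (0:ℝ)..t,
      (u * (2 * Real.pi) - ∑ j ∈ Finset.univ.filter (· ≠ i), u * csPhi x i j u) := by
    intro i
    have h1 := congrArg ENNReal.toReal (cs_cell_area x hx.inj i t)
    rw [ENNReal.toReal_add (hfin i) (by simp [ENNReal.sum_eq_top, hfinS]),
      ENNReal.toReal_sum (fun j _ => hfinS i j), Complex.volume_closedBall] at h1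
    rw [intervalIntegral.integral_sub, intervalIntegral.integral_finsetSum,
      intervalIntegral.integral_mul_const, integral_id]
    · rw [Finset.sum_congr rfl (fun j hj => hS i j (by simpa using (Finset.mem_filter.1 hj).2.symm))] at h1
      have e : (ENNReal.ofReal t ^ 2 * ((NNReal.pi : NNReal) : ℝ≥0∞)).toReal = t ^ 2 * Real.pi := by
        rw [ENNReal.toReal_mul, ENNReal.toReal_pow, ENNReal.toReal_ofReal ht]; simp
      rw [e] at h1
      linarith
    · intro j _
      rw [intervalIntegrable_iff_integrableOn_Ioc_of_le ht]; exact csPhi_int x i j t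
    · exact (continuous_id.mul continuous_const).intervalIntegrable _ _
    · rw [intervalIntegrable_iff_integrableOn_Ioc_of_le ht]
      exact integrable_finsetSum _ fun j _ => csPhi_int x i j t
  rw [cs_A_area x hx.inj, ENNReal.toReal_sum (fun i _ => hfin i), Finset.sum_congr rfl (fun i _ => hC i),
    ← intervalIntegral.integral_finsetSum]
  · congr 1
    ext u
    simp only [csEll, Finset.sum_sub_distrib, mul_sub, Finset.mul_sum]
    simp; ring
  · intro i _
    rw [intervalIntegrable_iff_integrableOn_Ioc_of_le ht]
    refine Integrable.sub ?_ (integrable_finsetSum _ fun j _ => csPhi_int x i j t)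
    exact ((continuous_id.mul continuous_const).integrableOn_Ioc)

lemma cs_W_sub {N : ℕ} {x : Fin N → ℂ} (hx : CsGP x) {s t : ℝ} (hs : 0 < s) (hst : s ≤ t) :
    (volume (csA x t)).toReal - (volume (csA x s)).toReal = ∫ u in s..t, csEll x u := by
  have hintg : ∀ t, 0 ≤ t → IntervalIntegrable (csEll x) volume 0 t := by
    intro t ht
    rw [intervalIntegrable_iff_integrableOn_Ioc_of_le ht]
    have : csEll x = fun u => u * (2 * Real.pi * N) - ∑ i, ∑ j ∈ Finset.univ.filter (· ≠ i), u * csPhi x i j u := by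
      ext u; simp only [csEll, mul_sub, Finset.mul_sum]
    rw [this]
    refine Integrable.sub ?_ (integrable_finsetSum _ fun i _ => integrable_finsetSum _ fun j _ => csPhi_int x i j t)
    exact ((continuous_id.mul continuous_const).integrableOn_Ioc)
  rw [cs_W_eq hx (hs.le.trans hst), cs_W_eq hx hs.le,
    intervalIntegral.integral_interval_sub_left (hintg t (hs.le.trans hst)) (hintg s hs.le)]

noncomputable def csPt (a b : ℂ) (τ : ℝ) : ℂ := (a + b) / 2 + (τ / 2 : ℝ) * (Complex.I * (b - a))

lemma csPt_sub (a b c : ℂ) (τ : ℝ) :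
    Complex.normSq (csPt a b τ - c) - Complex.normSq (csPt a b τ - a) = csP a b c - τ * csCr a b c := by
  have h2r : ((a + b) / 2).re = (a.re + b.re) / 2 := by simp
  have h2i : ((a + b) / 2).im = (a.im + b.im) / 2 := by simp
  rw [csP_eq, csCr_eq, Complex.normSq_apply, Complex.normSq_apply]
  simp only [csPt, Complex.sub_re, Complex.sub_im, Complex.add_re, Complex.add_im, h2r, h2i,
    Complex.re_ofReal_mul, Complex.im_ofReal_mul, Complex.I_mul_re, Complex.I_mul_im]
  ring

lemma csPt_normSq (a b : ℂ) (τ : ℝ) :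
    Complex.normSq (csPt a b τ - a) = (1 + τ ^ 2) * (dist a b / 2) ^ 2 := by
  have h2r : ((a + b) / 2).re = (a.re + b.re) / 2 := by simp
  have h2i : ((a + b) / 2).im = (a.im + b.im) / 2 := by simp
  rw [div_pow, dist_comm, dist_eq_norm, ← Complex.normSq_eq_norm_sq, Complex.normSq_apply,
    Complex.normSq_apply]
  simp only [csPt, Complex.sub_re, Complex.sub_im, Complex.add_re, Complex.add_im, h2r, h2i,
    Complex.re_ofReal_mul, Complex.im_ofReal_mul, Complex.I_mul_re, Complex.I_mul_im]
  ring

lemma cs_dist_le_iff (y a b : ℂ) :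
    dist y a ≤ dist y b ↔ Complex.normSq (y - a) ≤ Complex.normSq (y - b) := by
  rw [dist_eq_norm, dist_eq_norm, Complex.normSq_eq_norm_sq, Complex.normSq_eq_norm_sq,
    sq_le_sq₀ (norm_nonneg _) (norm_nonneg _)]

lemma cs_dist_eq_iff (y a b : ℂ) :
    dist y a = dist y b ↔ Complex.normSq (y - a) = Complex.normSq (y - b) := by
  rw [le_antisymm_iff, le_antisymm_iff, cs_dist_le_iff, cs_dist_le_iff]

lemma csPt_dist_le_iff (a b c : ℂ) (τ : ℝ) :
    dist (csPt a b τ) a ≤ dist (csPt a b τ) c ↔ csCr a b c * τ ≤ csP a b c := by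
  rw [cs_dist_le_iff]
  have := csPt_sub a b c τ
  constructor <;> intro h <;> nlinarith

lemma csPt_dist_eq_iff (a b c : ℂ) (τ : ℝ) :
    dist (csPt a b τ) a = dist (csPt a b τ) c ↔ csCr a b c * τ = csP a b c := by
  rw [cs_dist_eq_iff]
  have := csPt_sub a b c τ
  constructor <;> intro h <;> nlinarith

lemma csPt_dist_right (a b : ℂ) (τ : ℝ) : dist (csPt a b τ) a = dist (csPt a b τ) b := by
  rw [csPt_dist_eq_iff, csCr_right, csP_right]; simp

lemma csPt_exists {a b y : ℂ} (hab : a ≠ b) (h : dist y a = dist y b) : ∃ τ, y = csPt a b τ := by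
  rw [cs_dist_eq_iff, Complex.normSq_apply, Complex.normSq_apply] at h
  have hn : 0 < Complex.normSq (b - a) := by rw [Complex.normSq_pos, sub_ne_zero]; exact hab.symm
  have h2r : ((a + b) / 2).re = (a.re + b.re) / 2 := by simp
  have h2i : ((a + b) / 2).im = (a.im + b.im) / 2 := by simp
  have hD := hn.ne'
  obtain ⟨τ, hτ⟩ : ∃ τ : ℝ, τ * Complex.normSq (b - a) = 2 * csCr a b y :=
    ⟨2 * csCr a b y / Complex.normSq (b - a), by field_simp⟩
  refine ⟨τ, ?_⟩
  rw [csCr_eq, Complex.normSq_apply] at hτ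
  rw [Complex.normSq_apply] at hD
  simp only [Complex.sub_re, Complex.sub_im] at h hτ hD
  apply Complex.ext
  all_goals
    apply mul_left_cancel₀ hD
    simp only [csPt, Complex.sub_re, Complex.sub_im, Complex.add_re, Complex.add_im, h2r, h2i,
      Complex.re_ofReal_mul, Complex.im_ofReal_mul, Complex.I_mul_re, Complex.I_mul_im]
  · linear_combination ((b.re - a.re) / 2) * h + (b.im - a.im) / 2 * hτ
  · linear_combination ((b.im - a.im) / 2) * h - (b.re - a.re) / 2 * hτ

lemma csG_le (a b c : ℂ) : csG a b c ≤ Real.pi / 2 := by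
  unfold csG; split_ifs
  · exact (Real.arctan_lt_pi_div_two _).le
  · exact le_rfl

lemma csG_gt (a b c : ℂ) : -(Real.pi / 2) < csG a b c := by
  unfold csG; split_ifs
  · exact Real.neg_pi_div_two_lt_arctan _
  · linarith [Real.pi_pos]

lemma csB_exists {N : ℕ} (x : Fin N → ℂ) (i j : Fin N) : ∃ k, csB x i j = csG (x i) (x j) (x k) := by
  obtain ⟨k, -, hk⟩ := Finset.exists_mem_eq_inf' (s := Finset.univ) ⟨i, Finset.mem_univ i⟩
    (fun k => csG (x i) (x j) (x k))
  exact ⟨k, hk⟩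

lemma csM_lt {N : ℕ} {x : Fin N → ℂ} {i j : Fin N} (hd : 0 < dist (x i) (x j)) {t : ℝ} (ht : 0 < t) :
    csM x i j t < Real.pi / 2 := by
  refine (min_le_left _ _).trans_lt ?_
  rw [Real.arccos_lt_pi_div_two]; positivity

lemma csM_gt {N : ℕ} (x : Fin N → ℂ) (i j : Fin N) (t : ℝ) :
    -(Real.pi / 2) < csM x i j t := by
  refine lt_min (lt_of_lt_of_le (by linarith [Real.pi_pos]) (Real.arccos_nonneg _)) ?_
  obtain ⟨k, hk⟩ := csB_exists x i j
  rw [hk]; exact csG_gt _ _ _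

lemma cs_mem_pair {N : ℕ} {x : Fin N → ℂ} (hx : CsGP x) {i j : Fin N} (hij : i ≠ j) {t θ : ℝ}
    (ht : 0 < t) (hat : dist (x i) (x j) / 2 ≤ t)
    (h1 : -(Real.pi / 2) < θ) (h2 : θ < Real.pi / 2) :
    csPt (x i) (x j) (Real.tan θ) ∈ csCell x i t ↔ -csM x j i t ≤ θ ∧ θ ≤ csM x i j t := by
  have hcos : 0 < Real.cos θ := Real.cos_pos_of_mem_Ioo ⟨h1, h2⟩
  have ha : 0 ≤ dist (x i) (x j) / 2 := by positivity
  have e1 : dist (csPt (x i) (x j) (Real.tan θ)) (x i) ≤ t ↔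
      -Real.arccos (dist (x i) (x j) / 2 / t) ≤ θ ∧ θ ≤ Real.arccos (dist (x i) (x j) / 2 / t) := by
    rw [← abs_le, dist_eq_norm]
    have hsq : ‖csPt (x i) (x j) (Real.tan θ) - x i‖ = dist (x i) (x j) / 2 / Real.cos θ := by
      rw [← sq_eq_sq₀ (norm_nonneg _) (by positivity), ← Complex.normSq_eq_norm_sq, csPt_normSq,
        Real.tan_eq_sin_div_cos]
      field_simp
      rw [Real.cos_sq_add_sin_sq]; ring
    rw [hsq, div_le_iff₀ hcos, mul_comm, ← div_le_iff₀ ht, ← Real.cos_abs]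
    have hth : |θ| ∈ Icc 0 Real.pi := ⟨abs_nonneg _, by rw [abs_le]; constructor <;> linarith [Real.pi_pos]⟩
    conv_rhs => rw [← Real.arccos_cos hth.1 hth.2]
    rw [Real.strictAntiOn_arccos.le_iff_ge]
    · exact ⟨Real.neg_one_le_cos _, Real.cos_le_one _⟩
    · exact ⟨le_trans (by norm_num) (show (0:ℝ) ≤ _ by positivity), (div_le_one ht).2 hat⟩
  have e2 : (∀ k, dist (csPt (x i) (x j) (Real.tan θ)) (x i) ≤ dist (csPt (x i) (x j) (Real.tan θ)) (x k)) ↔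
      -csB x j i ≤ θ ∧ θ ≤ csB x i j := by
    rw [← cs_angle_all hx hij h1 h2]
    refine forall_congr' fun k => ?_
    rw [csPt_dist_le_iff, Real.tan_eq_sin_div_cos, ← mul_div_assoc, div_le_iff₀ hcos]
  simp only [csCell, mem_ofPred_eq]
  rw [e1, e2, csM, csM, dist_comm (x j) (x i), neg_le (b := θ), neg_le (b := θ), neg_le (b := θ),
    le_min_iff, le_min_iff]
  tauto

lemma cs_cell_of_eq {N : ℕ} {x : Fin N → ℂ} {i j : Fin N} {t : ℝ} {y : ℂ} (h : y ∈ csCell x i t)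
    (he : dist y (x i) = dist y (x j)) : y ∈ csCell x j t :=
  ⟨he ▸ h.1, fun k => he ▸ h.2 k⟩

lemma cs_dist_of_inter {N : ℕ} {x : Fin N → ℂ} {i j : Fin N} {t : ℝ} {y : ℂ} (h : y ∈ csCell x i t)
    (h' : y ∈ csCell x j t) : dist y (x i) = dist y (x j) := le_antisymm (h.2 j) (h'.2 i)

lemma cs_inter_iff {N : ℕ} {x : Fin N → ℂ} (hx : CsGP x) {i j : Fin N} (hij : i ≠ j) {t : ℝ}
    (ht : 0 < t) : (csCell x i t ∩ csCell x j t).Nonempty ↔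
      dist (x i) (x j) / 2 ≤ t ∧ 0 ≤ csM x i j t + csM x j i t := by
  have hab : x i ≠ x j := fun h => hij (hx.inj h)
  constructor
  · rintro ⟨y, hy, hy'⟩
    have hat : dist (x i) (x j) / 2 ≤ t := by
      have := dist_triangle_left (x i) (x j) y
      linarith [hy.1, hy'.1]
    refine ⟨hat, ?_⟩
    obtain ⟨τ, rfl⟩ := csPt_exists hab (cs_dist_of_inter hy hy')
    rw [← Real.tan_arctan τ, cs_mem_pair hx hij ht hat (Real.neg_pi_div_two_lt_arctan _)
      (Real.arctan_lt_pi_div_two _)] at hy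
    linarith
  · rintro ⟨hat, hs⟩
    have := (cs_mem_pair hx hij ht hat (csM_gt x i j t) (csM_lt (dist_pos.2 hab) ht)).2
      ⟨by linarith, le_rfl⟩
    exact ⟨_, this, cs_cell_of_eq this (csPt_dist_right _ _ _)⟩

lemma cs_triple_of_lt {N : ℕ} {x : Fin N → ℂ} (hx : CsGP x) {i j : Fin N} (hij : i ≠ j) {t : ℝ}
    (ht : 0 < t) (hat : dist (x i) (x j) / 2 ≤ t) (hs : 0 ≤ csM x i j t + csM x j i t)
    (hB : csB x i j < Real.arccos (dist (x i) (x j) / 2 / t)) :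
    ∃ k, i ≠ k ∧ j ≠ k ∧ csB x i j = csG (x i) (x j) (x k) ∧
      (csCell x i t ∩ csCell x j t ∩ csCell x k t).Nonempty := by
  have hab : x i ≠ x j := fun h => hij (hx.inj h)
  obtain ⟨k, hk⟩ := csB_exists x i j
  have hM : csM x i j t = csB x i j := min_eq_right hB.le
  have hlt := csM_lt (dist_pos.2 hab) ht
  have hmem := (cs_mem_pair hx hij ht hat (csM_gt x i j t) hlt).2 ⟨by linarith, le_rfl⟩
  have hcr : 0 < csCr (x i) (x j) (x k) := by
    by_contra hcon
    rw [hM, hk, csG, if_neg hcon] at hlt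
    exact lt_irrefl _ hlt
  refine ⟨k, ?_, ?_, hk, _, ⟨hmem, cs_cell_of_eq hmem (csPt_dist_right _ _ _)⟩, cs_cell_of_eq hmem ?_⟩
  · rintro rfl; rw [csCr_left] at hcr; exact lt_irrefl _ hcr
  · rintro rfl; rw [csCr_right] at hcr; exact lt_irrefl _ hcr
  · rw [csPt_dist_eq_iff, hM, hk, csG, if_pos hcr, Real.tan_arctan]
    field_simp

lemma csB_sum_ne {N : ℕ} {x : Fin N → ℂ} (hx : CsGP x) {i j : Fin N} (hij : i ≠ j) :
    csB x i j + csB x j i ≠ 0 := by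
  intro h0
  obtain ⟨k, hk⟩ := csB_exists x i j
  obtain ⟨l, hl⟩ := csB_exists x j i
  have h1 : 0 < csCr (x i) (x j) (x k) := by
    by_contra hcon
    rw [csG, if_neg hcon] at hk
    have := csG_gt (x j) (x i) (x l)
    linarith
  have h2 : 0 < csCr (x j) (x i) (x l) := by
    by_contra hcon
    rw [csG, if_neg hcon] at hl
    have := csG_gt (x i) (x j) (x k)
    linarith
  rw [csG, if_pos h1] at hk
  rw [csG, if_pos h2] at hl
  have e : csP (x i) (x j) (x k) / csCr (x i) (x j) (x k) = csP (x i) (x j) (x l) / csCr (x i) (x j) (x l) := by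
    apply Real.arctan_injective
    have : csP (x i) (x j) (x l) / csCr (x i) (x j) (x l) = - (csP (x j) (x i) (x l) / csCr (x j) (x i) (x l)) := by
      rw [csCr_swap, csP_swap, div_neg]
    rw [this, Real.arctan_neg, ← hk, ← hl]; linarith
  rw [csCr_swap] at h2
  have n1 : i ≠ k := by rintro rfl; rw [csCr_left] at h1; exact lt_irrefl _ h1
  have n2 : j ≠ k := by rintro rfl; rw [csCr_right] at h1; exact lt_irrefl _ h1
  have n3 : i ≠ l := by rintro rfl; rw [csCr_left] at h2; linarith
  have n4 : j ≠ l := by rintro rfl; rw [csCr_right] at h2; linarith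
  have n5 : k ≠ l := by rintro rfl; linarith
  refine hx.ncyc i j k l hij n1 n3 n2 n4 n5
    (csPt (x i) (x j) (csP (x i) (x j) (x k) / csCr (x i) (x j) (x k))) ⟨csPt_dist_right _ _ _, ?_, ?_⟩
  · rw [csPt_dist_eq_iff]; field_simp
  · rw [csPt_dist_eq_iff, e]; field_simp [show csCr (x i) (x j) (x l) ≠ 0 by linarith]

lemma cs_arctan_three' {p q s c : ℝ} (hc : 0 < c) (h : p * q + q * s + s * p = c ^ 2)
    (h1 : 0 < p + q) (hs : 0 < s) :
    Real.arctan (p / c) + Real.arctan (q / c) + Real.arctan (s / c) = Real.pi / 2 := by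
  have h4 : p * q < c ^ 2 := by nlinarith [mul_pos h1 hs]
  have h5 : p / c * (q / c) < 1 := by
    rw [div_mul_div_comm, div_lt_one (by positivity)]; nlinarith
  rw [Real.arctan_add h5]
  have e : (p / c + q / c) / (1 - p / c * (q / c)) = (s / c)⁻¹ := by
    have : c ^ 2 - p * q ≠ 0 := by linarith
    have e2 : 1 - p / c * (q / c) = (p + q) * s / c ^ 2 := by
      field_simp; linarith
    rw [e2]; field_simp
  rw [e, Real.arctan_inv_of_pos (by positivity)]; ring

/-- triangle angles -/
lemma cs_arctan_three {p q s c : ℝ} (hc : 0 < c) (h : p * q + q * s + s * p = c ^ 2)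
    (h1 : 0 < p + q) (h2 : 0 < q + s) (h3 : 0 < s + p) :
    Real.arctan (p / c) + Real.arctan (q / c) + Real.arctan (s / c) = Real.pi / 2 := by
  by_cases hs : 0 < s
  · exact cs_arctan_three' hc h h1 hs
  · have := cs_arctan_three' hc (p := s) (q := p) (s := q) (by linarith) h3 (by linarith)
    linarith

lemma cs_tri_pos {a b c : ℂ} (h : 0 < csCr a b c) : csG a b c + csG b c a + csG c a b = Real.pi / 2 := by
  have e1 : csCr b c a = csCr a b c := by simp only [csCr_eq, Complex.sub_re, Complex.sub_im]; ring
  have e2 : csCr c a b = csCr a b c := by simp only [csCr_eq, Complex.sub_re, Complex.sub_im]; ring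
  have hp : ∀ a b : ℂ, a ≠ b → 0 < Complex.normSq (a - b) := fun a b hab => by
    rw [Complex.normSq_pos, sub_ne_zero]; exact hab
  have n1 : a ≠ b := by rintro rfl; simp [csCr] at h
  have n2 : a ≠ c := by rintro rfl; simp [csCr] at h
  have n3 : b ≠ c := by rintro rfl; rw [csCr_right] at h; exact lt_irrefl _ h
  unfold csG
  rw [e1, e2, if_pos h, if_pos h, if_pos h]
  have hp1 := hp _ _ n1
  have hp2 := hp _ _ n2
  have hp3 := hp _ _ n3
  rw [Complex.normSq_apply] at hp1 hp2 hp3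
  apply cs_arctan_three h
  all_goals
    simp only [csP_eq, csCr_eq, Complex.sub_re, Complex.sub_im] at *
  · ring
  · nlinarith
  · nlinarith
  · nlinarith

lemma csG_neg {a b c : ℂ} (h : csCr a b c < 0) : csG a b c = Real.pi / 2 := by
  rw [csG, if_neg (by linarith)]

/-- the six ordered angles -/
lemma cs_tri_six {a b c : ℂ} (h : csCr a b c ≠ 0) :
    csG a b c + csG b c a + csG c a b + csG b a c + csG a c b + csG c b a = 2 * Real.pi := by
  have e1 : csCr b c a = csCr a b c := by simp only [csCr_eq, Complex.sub_re, Complex.sub_im]; ring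
  have e2 : csCr c a b = csCr a b c := by simp only [csCr_eq, Complex.sub_re, Complex.sub_im]; ring
  have e3 := csCr_swap a b c
  have e4 := csCr_swap b c a
  have e5 := csCr_swap c a b
  rcases lt_or_gt_of_ne h with h | h
  · rw [csG_neg h, csG_neg (a := b) (b := c) (c := a) (by linarith), csG_neg (a := c) (b := a) (c := b) (by linarith)]
    have := cs_tri_pos (a := b) (b := a) (c := c) (by linarith)
    linarith
  · have := cs_tri_pos h
    rw [csG_neg (a := b) (b := a) (c := c) (by linarith), csG_neg (a := a) (b := c) (c := b) (by linarith),
      csG_neg (a := c) (b := b) (c := a) (by linarith)]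
    linarith

/-- event radii -/
noncomputable def csEv {N : ℕ} (x : Fin N → ℂ) : Set ℝ :=
  range (fun p : Fin N × Fin N => dist (x p.1) (x p.2) / 2) ∪
  range (fun p : Fin N × Fin N × Fin N => dist (x p.1) (x p.2.1) / 2 /
    Real.cos (csG (x p.1) (x p.2.1) (x p.2.2)))

lemma csEv_finite {N : ℕ} (x : Fin N → ℂ) : (csEv x).Finite :=
  (finite_range _).union (finite_range _)

lemma csEv_arccos {N : ℕ} {x : Fin N → ℂ} (hx : CsGP x) {i j : Fin N} (hij : i ≠ j) {t : ℝ} (ht : 0 < t)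
    (hat : dist (x i) (x j) / 2 < t) (hev : t ∉ csEv x) :
    Real.arccos (dist (x i) (x j) / 2 / t) ≠ csB x i j ∧
    Real.arccos (dist (x i) (x j) / 2 / t) ≠ - csB x i j := by
  have hab : 0 < dist (x i) (x j) := dist_pos.2 (fun h => hij (hx.inj h))
  obtain ⟨k, hk⟩ := csB_exists x i j
  have key : Real.cos (csB x i j) = dist (x i) (x j) / 2 / t → False := by
    intro h
    apply hev
    right
    refine ⟨(i, j, k), ?_⟩
    simp only
    rw [← hk, h]; field_simp
  have hc : Real.cos (Real.arccos (dist (x i) (x j) / 2 / t)) = dist (x i) (x j) / 2 / t :=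
    Real.cos_arccos (le_trans (by norm_num) (show (0:ℝ) ≤ _ by positivity)) ((div_le_one ht).2 hat.le)
  constructor
  · intro h; rw [h] at hc; exact key hc
  · intro h; rw [h, Real.cos_neg] at hc; exact key hc

lemma cs_arccos_deriv {a t : ℝ} (ha : 0 < a) (hat : a < t) :
    ∃ d, Real.pi / 2 ≤ d ∧ HasDerivAt (fun u => u * Real.arccos (a / u)) d t := by
  have ht : 0 < t := ha.trans hat
  have hz0 : 0 < a / t := by positivity
  have hz1 : a / t < 1 := (div_lt_one ht).2 hat
  have h1 : HasDerivAt (fun u => a / u) (-a / t ^ 2) t := by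
    have := (hasDerivAt_inv ht.ne').const_mul a
    simpa [div_eq_mul_inv] using this
  have h2 : HasDerivAt (fun u => Real.arccos (a / u)) _ t :=
    (Real.hasDerivAt_arccos (by linarith) hz1.ne).comp t h1
  have h3 := (hasDerivAt_id t).mul h2
  refine ⟨_, ?_, h3⟩
  simp only [id]
  have hs : 0 < √(1 - (a / t) ^ 2) := Real.sqrt_pos.2 (by nlinarith)
  have e : t * (-(1 / √(1 - (a / t) ^ 2)) * (-a / t ^ 2)) = (a / t) / √(1 - (a / t) ^ 2) := by
    field_simp
  rw [e]
  set α := Real.arccos (a / t) with hα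
  have hα0 : 0 < α := Real.arccos_pos.2 hz1
  have hα1 : α < Real.pi / 2 := Real.arccos_lt_pi_div_two.2 hz0
  have : (a / t) / √(1 - (a / t) ^ 2) = Real.tan (Real.pi / 2 - α) := by
    rw [Real.tan_eq_sin_div_cos, Real.sin_pi_div_two_sub, Real.cos_pi_div_two_sub, hα,
      Real.cos_arccos (by linarith) hz1.le, Real.sin_arccos]
  rw [this]
  have := Real.lt_tan (x := Real.pi / 2 - α) (by linarith) (by linarith)
  linarith

lemma csM_deriv {N : ℕ} {x : Fin N → ℂ} (hx : CsGP x) {i j : Fin N} (hij : i ≠ j) {t : ℝ}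
    (hat : dist (x i) (x j) / 2 < t) (hev : t ∉ csEv x) :
    ∃ d, HasDerivAt (fun u => u * csM x i j u) d t ∧
      (Real.pi / 2 ≤ d ∨ (csB x i j < Real.arccos (dist (x i) (x j) / 2 / t) ∧ d = csB x i j)) := by
  have hab : 0 < dist (x i) (x j) := dist_pos.2 (fun h => hij (hx.inj h))
  have ht : 0 < t := by linarith
  have hcont : ContinuousAt (fun u => Real.arccos (dist (x i) (x j) / 2 / u)) t := by
    refine Real.continuous_arccos.continuousAt.comp ?_
    exact continuousAt_const.div continuousAt_id ht.ne'
  rcases lt_or_gt_of_ne (csEv_arccos hx hij ht hat hev).1 with h | h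
  · obtain ⟨d, hd, hd2⟩ := cs_arccos_deriv (a := dist (x i) (x j) / 2) (by positivity) hat
    refine ⟨d, hd2.congr_of_eventuallyEq ?_, Or.inl hd⟩
    filter_upwards [hcont.eventually_lt continuousAt_const h] with u hu
    rw [csM, min_eq_left hu.le]
  · refine ⟨csB x i j, ?_, Or.inr ⟨h, rfl⟩⟩
    have : HasDerivAt (fun u => u * csB x i j) (csB x i j) t := by
      simpa using (hasDerivAt_id t).mul_const (csB x i j)
    refine this.congr_of_eventuallyEq ?_
    filter_upwards [continuousAt_const.eventually_lt hcont h] with u hu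
    rw [csM, min_eq_right hu.le]

open Classical in
noncomputable def csE {N : ℕ} (x : Fin N → ℂ) (t : ℝ) (i j : Fin N) : ℝ :=
  if i ≠ j ∧ (csCell x i t ∩ csCell x j t).Nonempty then 1 else 0

open Classical in
noncomputable def csF {N : ℕ} (x : Fin N → ℂ) (t : ℝ) (i j k : Fin N) : ℝ :=
  if (i ≠ j ∧ i ≠ k ∧ j ≠ k) ∧ (csCell x i t ∩ csCell x j t ∩ csCell x k t).Nonempty then 1 else 0

lemma csF_nonneg {N : ℕ} (x : Fin N → ℂ) (t : ℝ) (i j k : Fin N) : 0 ≤ csF x t i j k := by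
  unfold csF; split_ifs <;> norm_num

lemma csF_swap {N : ℕ} (x : Fin N → ℂ) (t : ℝ) (i j k : Fin N) : csF x t j i k = csF x t i j k := by
  unfold csF; rw [inter_comm (csCell x j t)]; congr 1; simp only [ne_comm, eq_iff_iff]; tauto

lemma csF_swap2 {N : ℕ} (x : Fin N → ℂ) (t : ℝ) (i j k : Fin N) : csF x t i k j = csF x t i j k := by
  unfold csF; rw [inter_right_comm]; congr 1; simp only [ne_comm, eq_iff_iff]; tauto

lemma csM_deriv_bound {N : ℕ} {x : Fin N → ℂ} (hx : CsGP x) {i j : Fin N} (hij : i ≠ j) {t : ℝ}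
    (hat : dist (x i) (x j) / 2 < t) (hev : t ∉ csEv x) (hs : 0 ≤ csM x i j t + csM x j i t) :
    ∃ d, HasDerivAt (fun u => u * csM x i j u) d t ∧
      Real.pi / 2 - ∑ k, csF x t i j k * (Real.pi / 2 - csG (x i) (x j) (x k)) ≤ d := by
  have hnn : ∀ k, 0 ≤ csF x t i j k * (Real.pi / 2 - csG (x i) (x j) (x k)) := fun k =>
    mul_nonneg (csF_nonneg _ _ _ _ _) (by linarith [csG_le (x i) (x j) (x k)])
  have ht : 0 < t := lt_of_le_of_lt (by positivity) hat
  obtain ⟨d, hd, h | ⟨h1, h2⟩⟩ := csM_deriv hx hij hat hev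
  · exact ⟨d, hd, by linarith [Finset.sum_nonneg (s := Finset.univ) fun k _ => hnn k]⟩
  · refine ⟨d, hd, ?_⟩
    obtain ⟨k, hik, hjk, hk, hne⟩ := cs_triple_of_lt hx hij ht hat.le hs h1
    have := Finset.single_le_sum (f := fun k => csF x t i j k * (Real.pi / 2 - csG (x i) (x j) (x k)))
      (fun k _ => hnn k) (Finset.mem_univ k)
    have hF : csF x t i j k = 1 := if_pos ⟨⟨hij, hik, hjk⟩, hne⟩
    simp only [hF, one_mul] at this
    rw [h2, hk]; linarith

lemma csPhi_deriv {N : ℕ} {x : Fin N → ℂ} (hx : CsGP x) {i j : Fin N} (hij : i ≠ j) {t : ℝ}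
    (ht : 0 < t) (hev : t ∉ csEv x) :
    ∃ d, HasDerivAt (fun u => u * csPhi x i j u) d t ∧
      Real.pi * csE x t i j - ∑ k, csF x t i j k *
        ((Real.pi / 2 - csG (x i) (x j) (x k)) + (Real.pi / 2 - csG (x j) (x i) (x k))) ≤ d := by
  have hnn : ∀ k, 0 ≤ csF x t i j k *
        ((Real.pi / 2 - csG (x i) (x j) (x k)) + (Real.pi / 2 - csG (x j) (x i) (x k))) := fun k =>
    mul_nonneg (csF_nonneg _ _ _ _ _) (by linarith [csG_le (x i) (x j) (x k), csG_le (x j) (x i) (x k)])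
  have hsum := Finset.sum_nonneg (s := Finset.univ) fun k _ => hnn k
  have hcM : ∀ i j, ContinuousAt (csM x i j) t := fun i j =>
    (csM_cont x i j).continuousAt (Ioi_mem_nhds ht)
  have hzero : (∀ᶠ u in nhds t, csPhi x i j u = 0) → csE x t i j = 0 →
    ∃ d, HasDerivAt (fun u => u * csPhi x i j u) d t ∧
      Real.pi * csE x t i j - ∑ k, csF x t i j k *
        ((Real.pi / 2 - csG (x i) (x j) (x k)) + (Real.pi / 2 - csG (x j) (x i) (x k))) ≤ d := by
    intro h h'
    refine ⟨0, (hasDerivAt_const t (0:ℝ)).congr_of_eventuallyEq ?_, by rw [h']; linarith⟩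
    filter_upwards [h] with u hu
    rw [hu, mul_zero]
  rcases lt_trichotomy t (dist (x i) (x j) / 2) with h | h | h
  · apply hzero
    · filter_upwards [Iio_mem_nhds h, Ioi_mem_nhds ht] with u hu hu0
      have e : Real.arccos (dist (x i) (x j) / 2 / u) = 0 :=
        Real.arccos_eq_zero.2 ((one_le_div hu0).2 (le_of_lt hu))
      rw [csPhi, csM, csM, dist_comm (x j), e]
      apply max_eq_left
      linarith [min_le_left 0 (csB x i j), min_le_left 0 (csB x j i)]
    · rw [csE, if_neg]
      rintro ⟨-, h'⟩
      rw [cs_inter_iff hx hij ht] at h'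
      linarith
  · exact absurd (Or.inl ⟨(i, j), h.symm⟩) hev
  · have h' : dist (x j) (x i) / 2 < t := by rwa [dist_comm]
    have hs0 : csM x i j t + csM x j i t ≠ 0 := by
      have h1 := csEv_arccos hx hij ht h hev
      have h2 := csEv_arccos hx hij.symm ht h' hev
      have h3 := csB_sum_ne hx hij
      have hpos : 0 < Real.arccos (dist (x i) (x j) / 2 / t) := Real.arccos_pos.2 ((div_lt_one ht).2 h)
      unfold csM
      rw [dist_comm (x j)] at h2 ⊢
      rcases min_cases (Real.arccos (dist (x i) (x j) / 2 / t)) (csB x i j) with ⟨e1, -⟩ | ⟨e1, -⟩ <;>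
      rcases min_cases (Real.arccos (dist (x i) (x j) / 2 / t)) (csB x j i) with ⟨e2, -⟩ | ⟨e2, -⟩ <;>
      rw [e1, e2]
      · linarith
      · intro h; exact h2.2 (by linarith)
      · intro h; exact h1.2 (by linarith)
      · exact h3
    rcases lt_or_gt_of_ne hs0 with hs | hs
    · apply hzero
      · filter_upwards [((hcM i j).add (hcM j i)).eventually_lt continuousAt_const hs] with u hu
        exact max_eq_left hu.le
      · rw [csE, if_neg]
        rintro ⟨-, h'⟩
        rw [cs_inter_iff hx hij ht] at h'
        linarith
    · obtain ⟨d1, hd1, hb1⟩ := csM_deriv_bound hx hij h hev hs.le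
      obtain ⟨d2, hd2, hb2⟩ := csM_deriv_bound hx hij.symm h' hev (by linarith)
      refine ⟨d1 + d2, (hd1.add hd2).congr_of_eventuallyEq ?_, ?_⟩
      · filter_upwards [continuousAt_const.eventually_lt ((hcM i j).add (hcM j i)) hs] with u hu
        simp only [Pi.add_apply] at hu ⊢
        rw [csPhi, max_eq_right hu.le]; ring
      · have hE : csE x t i j = 1 := if_pos ⟨hij, (cs_inter_iff hx hij ht).2 ⟨h.le, hs.le⟩⟩
        simp only [csF_swap] at hb2
        simp only [mul_add, Finset.sum_add_distrib]
        rw [hE]; linarith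

lemma csF_sum {N : ℕ} {x : Fin N → ℂ} (hx : CsGP x) (t : ℝ) :
    ∑ i, ∑ j, ∑ k, csF x t i j k * ((Real.pi / 2 - csG (x i) (x j) (x k)) + (Real.pi / 2 - csG (x j) (x i) (x k)))
     = Real.pi / 3 * ∑ i, ∑ j, ∑ k, csF x t i j k := by
  set f : Fin N → Fin N → Fin N → ℝ := fun i j k => csF x t i j k * (Real.pi / 2 - csG (x i) (x j) (x k)) with hf
  have p1 : ∀ g : Fin N → Fin N → Fin N → ℝ, ∑ i, ∑ j, ∑ k, g j i k = ∑ i, ∑ j, ∑ k, g i j k :=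
    fun g => Finset.sum_comm
  have p2 : ∀ g : Fin N → Fin N → Fin N → ℝ, ∑ i, ∑ j, ∑ k, g i k j = ∑ i, ∑ j, ∑ k, g i j k :=
    fun g => Finset.sum_congr rfl fun i _ => Finset.sum_comm
  have six : ∀ i j k, f i j k + f j k i + f k i j + f j i k + f i k j + f k j i = Real.pi * csF x t i j k := by
    intro i j k
    have a1 : csF x t j k i = csF x t i j k := by rw [csF_swap2, csF_swap]
    have a2 : csF x t k i j = csF x t i j k := by rw [csF_swap, csF_swap2]
    have a3 : csF x t k j i = csF x t i j k := by rw [csF_swap, a1]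
    simp only [hf, a1, a2, a3, csF_swap x t i j k, csF_swap2 x t i j k]
    by_cases hd : i ≠ j ∧ i ≠ k ∧ j ≠ k
    · have := cs_tri_six (hx.nc i j k hd.1 hd.2.1 hd.2.2)
      linear_combination (-csF x t i j k) * this
    · have : csF x t i j k = 0 := if_neg fun h => hd h.1
      rw [this]; ring
  have tot : ∑ i, ∑ j, ∑ k, (f i j k + f j k i + f k i j + f j i k + f i k j + f k j i) =
      Real.pi * ∑ i, ∑ j, ∑ k, csF x t i j k := by
    simp only [six, Finset.mul_sum]
  simp only [Finset.sum_add_distrib] at tot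
  have q1 := p1 f
  have q2 := p2 f
  have q3 := p2 (fun i j k => f j i k)
  have q4 := p1 (fun i j k => f i k j)
  have q5 := p2 (fun i j k => f j k i)
  have e : ∀ i j k, csF x t i j k * ((Real.pi / 2 - csG (x i) (x j) (x k)) + (Real.pi / 2 - csG (x j) (x i) (x k)))
      = f i j k + f j i k := by
    intro i j k; simp only [hf, csF_swap x t i j k]; ring
  simp only [e, Finset.sum_add_distrib]
  linarith

lemma csEll_deriv {N : ℕ} {x : Fin N → ℂ} (hx : CsGP x) {t : ℝ} (ht : 0 < t) (hev : t ∉ csEv x) :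
    ∃ d, HasDerivAt (csEll x) d t ∧
      d ≤ 2 * Real.pi * N - Real.pi * ∑ i, ∑ j, csE x t i j + Real.pi / 3 * ∑ i, ∑ j, ∑ k, csF x t i j k := by
  have : ∀ i j : Fin N, ∃ d, i ≠ j → (HasDerivAt (fun u => u * csPhi x i j u) d t ∧
      Real.pi * csE x t i j - ∑ k, csF x t i j k *
        ((Real.pi / 2 - csG (x i) (x j) (x k)) + (Real.pi / 2 - csG (x j) (x i) (x k))) ≤ d) := by
    intro i j
    by_cases hij : i = j
    · exact ⟨0, fun h => absurd hij h⟩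
    · obtain ⟨d, hd⟩ := csPhi_deriv hx hij ht hev
      exact ⟨d, fun _ => hd⟩
  choose d hd using this
  have hfun : csEll x = fun u => u * (2 * Real.pi * N) - ∑ i, ∑ j ∈ Finset.univ.filter (· ≠ i), u * csPhi x i j u := by
    ext u; simp only [csEll, mul_sub, Finset.mul_sum]
  refine ⟨2 * Real.pi * N - ∑ i, ∑ j ∈ Finset.univ.filter (· ≠ i), d i j, ?_, ?_⟩
  · rw [hfun]
    refine HasDerivAt.sub ?_ ?_
    · simpa using (hasDerivAt_id t).mul_const (2 * Real.pi * N)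
    · refine HasDerivAt.fun_sum fun i _ => HasDerivAt.fun_sum fun j hj => (hd i j ?_).1
      simpa using (Finset.mem_filter.1 hj).2.symm
  · rw [← csF_sum hx t]
    have key : ∑ i, ∑ j, (Real.pi * csE x t i j - ∑ k, csF x t i j k *
        ((Real.pi / 2 - csG (x i) (x j) (x k)) + (Real.pi / 2 - csG (x j) (x i) (x k)))) ≤
        ∑ i, ∑ j ∈ Finset.univ.filter (· ≠ i), d i j := by
      refine Finset.sum_le_sum fun i _ => ?_
      rw [Finset.sum_filter]
      refine Finset.sum_le_sum fun j _ => ?_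
      split_ifs with h
      · exact (hd i j (Ne.symm h)).2
      · push Not at h; subst h
        simp [csE, csF]
    simp only [Finset.sum_sub_distrib, ← Finset.mul_sum] at key
    linarith

lemma cs_mvt_finite (S : Finset ℝ) (f : ℝ → ℝ) (c : ℝ) : ∀ a b : ℝ, a ≤ b → ContinuousOn f (Icc a b) →
    (∀ t ∈ Ioo a b, t ∉ S → ∃ d ≤ c, HasDerivAt f d t) → f b - f a ≤ c * (b - a) := by
  induction S using Finset.induction_on with
  | empty =>
    intro a b hab hf hd
    choose! d hd using fun t ht => hd t ht (by simp)
    have hd0 : DifferentiableOn ℝ f (interior (Icc a b)) := by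
      rw [interior_Icc]
      exact fun t ht => (hd t ht).2.differentiableAt.differentiableWithinAt
    refine (convex_Icc a b).image_sub_le_mul_sub_of_deriv_le hf hd0 ?_ a (left_mem_Icc.2 hab) b (right_mem_Icc.2 hab) hab
    rw [interior_Icc]
    intro t ht
    rw [(hd t ht).2.deriv]; exact (hd t ht).1
  | insert s S hs ih =>
    intro a b hab hf hd
    by_cases h : s ∈ Ioo a b
    · have h1 := ih a s h.1.le (hf.mono (Icc_subset_Icc le_rfl h.2.le)) (fun t ht hS =>
        hd t ⟨ht.1, ht.2.trans h.2⟩ (by simp [hS, ht.2.ne]))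
      have h2 := ih s b h.2.le (hf.mono (Icc_subset_Icc h.1.le le_rfl)) (fun t ht hS =>
        hd t ⟨h.1.trans ht.1, ht.2⟩ (by simp [hS, ht.1.ne']))
      linarith
    · refine ih a b hab hf (fun t ht hS => hd t ht ?_)
      rw [Finset.mem_insert, not_or]
      exact ⟨fun e => h (e ▸ ht), hS⟩

lemma csEll_growth {N : ℕ} {x : Fin N → ℂ} (hx : CsGP x) {t1 t2 c : ℝ} (h1 : 0 < t1) (h12 : t1 ≤ t2)
    (hc : ∀ t ∈ Ioo t1 t2, 2 * Real.pi * N - Real.pi * ∑ i, ∑ j, csE x t i j +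
      Real.pi / 3 * ∑ i, ∑ j, ∑ k, csF x t i j k ≤ c) :
    csEll x t2 - csEll x t1 ≤ c * (t2 - t1) := by
  refine cs_mvt_finite (csEv_finite x).toFinset (csEll x) c t1 t2 h12
    ((csEll_cont x).mono fun t ht => h1.trans_le ht.1) (fun t ht hS => ?_)
  obtain ⟨d, hd, hd'⟩ := csEll_deriv hx (h1.trans ht.1) (by simpa using hS)
  exact ⟨d, hd'.trans (hc t ht), hd⟩

lemma cs_halfplane_convex (a b : ℂ) : Convex ℝ {y : ℂ | dist y a ≤ dist y b} := by
  have e : {y : ℂ | dist y a ≤ dist y b} = {y : ℂ | 2 * ((b.re - a.re) * y.re + (b.im - a.im) * y.im) ≤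
      b.re ^ 2 + b.im ^ 2 - a.re ^ 2 - a.im ^ 2} := by
    ext y
    simp only [mem_ofPred_eq]
    rw [cs_dist_le_iff, Complex.normSq_apply, Complex.normSq_apply]
    simp only [Complex.sub_re, Complex.sub_im]
    constructor <;> intro h <;> nlinarith
  rw [e]
  intro y hy z hz α β hα hβ hαβ
  simp only [mem_ofPred_eq, Complex.add_re, Complex.add_im, Complex.real_smul, Complex.re_ofReal_mul,
    Complex.im_ofReal_mul] at *
  have h1 := mul_le_mul_of_nonneg_left hy hα
  have h2 := mul_le_mul_of_nonneg_left hz hβ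
  have h3 : α = 1 - β := by linarith
  subst h3
  nlinarith

lemma csCell_convex {N : ℕ} (x : Fin N → ℂ) (i : Fin N) (t : ℝ) : Convex ℝ (csCell x i t) := by
  have e : csCell x i t = closedBall (x i) t ∩ ⋂ j, {y : ℂ | dist y (x i) ≤ dist y (x j)} := by
    ext y; simp [csCell]
  rw [e]
  exact (convex_closedBall _ _).inter (convex_iInter fun j => cs_halfplane_convex _ _)

lemma cs_convex_log {C : Set ℂ} (hC : Convex ℝ C) (hcl : IsClosed C) {y : ℂ} (hy : y ∉ C) :
    ∃ L : ℂ → ℂ, ContinuousOn L C ∧ ∀ z ∈ C, Complex.exp (L z) = z - y := by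
  obtain ⟨f, u, h1, h2⟩ := RCLike.geometric_hahn_banach_point_closed (𝕜 := ℂ) hC hcl hy
  rcases C.eq_empty_or_nonempty with rfl | ⟨w, hw⟩
  · exact ⟨0, continuousOn_empty _, by simp⟩
  have hf : ∀ z, f z = f 1 * z := by
    intro z
    have := f.map_smul z 1
    simp only [smul_eq_mul, mul_one] at this
    rw [this, mul_comm]
  have hpos : ∀ z ∈ C, 0 < (f 1 * (z - y)).re := by
    intro z hz
    rw [mul_sub, ← hf, ← hf, Complex.sub_re]
    have := h2 z hz
    simp only [RCLike.re_eq_complex_re] at this h1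
    linarith
  have hc : f 1 ≠ 0 := by
    intro h
    have := hpos w hw
    simp [h] at this
  refine ⟨fun z => Complex.log (f 1 * (z - y)) - Complex.log (f 1), ?_, ?_⟩
  · refine ContinuousOn.sub (ContinuousOn.clog (by fun_prop) ?_) continuousOn_const
    intro z hz
    exact Or.inl (hpos z hz)
  · intro z hz
    have h0 : f 1 * (z - y) ≠ 0 := by
      intro h
      have := hpos z hz
      simp [h] at this
    rw [Complex.exp_sub, Complex.exp_log h0, Complex.exp_log hc]
    field_simp

abbrev CsEdge {N : ℕ} (C : Fin N → Set ℂ) : Type := {p : Fin N × Fin N // p.1 < p.2 ∧ (C p.1 ∩ C p.2).Nonempty}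
abbrev CsFace {N : ℕ} (C : Fin N → Set ℂ) : Type :=
  {p : Fin N × Fin N × Fin N // p.1 < p.2.1 ∧ p.2.1 < p.2.2 ∧ (C p.1 ∩ C p.2.1 ∩ C p.2.2).Nonempty}

def CsFace.e1 {N : ℕ} {C : Fin N → Set ℂ} (T : CsFace C) : CsEdge C :=
  ⟨(T.1.2.1, T.1.2.2), T.2.2.1, T.2.2.2.mono fun _ h => ⟨h.1.2, h.2⟩⟩
def CsFace.e2 {N : ℕ} {C : Fin N → Set ℂ} (T : CsFace C) : CsEdge C :=
  ⟨(T.1.1, T.1.2.2), T.2.1.trans T.2.2.1, T.2.2.2.mono fun _ h => ⟨h.1.1, h.2⟩⟩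
def CsFace.e3 {N : ℕ} {C : Fin N → Set ℂ} (T : CsFace C) : CsEdge C :=
  ⟨(T.1.1, T.1.2.1), T.2.1, T.2.2.2.mono fun _ h => h.1⟩

def csD0 {N : ℕ} (C : Fin N → Set ℂ) : (Fin N → ℚ) →ₗ[ℚ] (CsEdge C → ℚ) where
  toFun g e := g e.1.2 - g e.1.1
  map_add' f g := by ext e; simp; ring
  map_smul' c g := by ext e; simp; ring

def csD1 {N : ℕ} (C : Fin N → Set ℂ) : (CsEdge C → ℚ) →ₗ[ℚ] (CsFace C → ℚ) where
  toFun w T := w T.e1 - w T.e2 + w T.e3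
  map_add' f g := by ext e; simp; ring
  map_smul' c g := by ext e; simp; ring

lemma cs_D1_D0 {N : ℕ} (C : Fin N → Set ℂ) (g : Fin N → ℚ) : csD1 C (csD0 C g) = 0 := by
  ext T; simp [csD1, csD0, CsFace.e1, CsFace.e2, CsFace.e3]

/-- potentials glue -/
lemma cs_glue {N : ℕ} {C : Fin N → Set ℂ} (hcl : ∀ i, IsClosed (C i)) (Φ : Fin N → ℂ → ℂ)
    (hΦ : ∀ i, ContinuousOn (Φ i) (C i)) (hag : ∀ i j, i < j → ∀ z ∈ C i ∩ C j, Φ i z = Φ j z) :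
    ∃ φ : ℂ → ℂ, ContinuousOn φ (⋃ i, C i) ∧ ∀ i, ∀ z ∈ C i, φ z = Φ i z := by
  classical
  have hag' : ∀ i j, ∀ z, z ∈ C i → z ∈ C j → Φ i z = Φ j z := by
    intro i j z hi hj
    rcases lt_trichotomy i j with h | h | h
    · exact hag i j h z ⟨hi, hj⟩
    · rw [h]
    · exact (hag j i h z ⟨hj, hi⟩).symm
  let φ : ℂ → ℂ := fun z => if h : ∃ i, z ∈ C i then Φ h.choose z else 0
  have hφ : ∀ i, ∀ z ∈ C i, φ z = Φ i z := by
    intro i z hz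
    have h : ∃ i, z ∈ C i := ⟨i, hz⟩
    simp only [φ, dif_pos h]
    exact hag' _ _ _ h.choose_spec hz
  refine ⟨φ, ?_, hφ⟩
  refine (locallyFinite_of_finite C).continuousOn_iUnion hcl fun i => ?_
  exact (hΦ i).congr (hφ i)

lemma cs_const_of_edges {N : ℕ} {C : Fin N → Set ℂ} (hcl : ∀ i, IsClosed (C i)) (hne : ∀ i, (C i).Nonempty)
    (hA : IsPreconnected (⋃ i, C i)) (g : Fin N → ℚ)
    (hg : ∀ i j, i < j → (C i ∩ C j).Nonempty → g i = g j) (i j : Fin N) : g i = g j := by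
  have hg' : ∀ i j, (C i ∩ C j).Nonempty → g i = g j := by
    intro i j h
    rcases lt_trichotomy i j with h' | h' | h'
    · exact hg i j h' h
    · rw [h']
    · exact (hg j i h' (by rwa [inter_comm])).symm
  by_contra hcon
  rw [isPreconnected_closed_iff] at hA
  obtain ⟨a, ha⟩ := hne i
  obtain ⟨b, hb⟩ := hne j
  obtain ⟨z, -, h1, h2⟩ := hA (⋃ k ∈ {k | g k = g i}, C k) (⋃ k ∈ {k | g k ≠ g i}, C k)
    ((Set.toFinite _).isClosed_biUnion fun k _ => hcl k)
    ((Set.toFinite _).isClosed_biUnion fun k _ => hcl k)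
    (by
      intro z hz
      obtain ⟨k, hk⟩ := mem_iUnion.1 hz
      by_cases h : g k = g i
      · exact Or.inl (mem_biUnion (show k ∈ {k | g k = g i} from h) hk)
      · exact Or.inr (mem_biUnion (show k ∈ {k | g k ≠ g i} from h) hk))
    ⟨a, mem_iUnion.2 ⟨i, ha⟩, mem_biUnion (show i ∈ {k | g k = g i} from rfl) ha⟩
    ⟨b, mem_iUnion.2 ⟨j, hb⟩, mem_biUnion (show j ∈ {k | g k ≠ g i} from Ne.symm hcon) hb⟩
  obtain ⟨k, hk, hzk⟩ := mem_iUnion₂.1 h1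
  obtain ⟨l, hl, hzl⟩ := mem_iUnion₂.1 h2
  exact hl ((hg' l k ⟨z, hzl, hzk⟩).trans hk)

/-- integer winding cocycle -/
lemma cs_cocycle {N : ℕ} {C : Fin N → Set ℂ} (hcl : ∀ i, IsClosed (C i)) (hcv : ∀ i, Convex ℝ (C i))
    {y : ℂ} (hy : ∀ i, y ∉ C i) :
    ∃ (L : Fin N → ℂ → ℂ) (w : CsEdge C → ℤ), (∀ i, ContinuousOn (L i) (C i)) ∧
      (∀ i, ∀ z ∈ C i, Complex.exp (L i z) = z - y) ∧
      (∀ e : CsEdge C, ∀ z ∈ C e.1.1 ∩ C e.1.2, L e.1.2 z - L e.1.1 z = 2 * Real.pi * Complex.I * (w e)) := by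
  choose L hL hL' using fun i => cs_convex_log (hcv i) (hcl i) (hy i)
  have : ∀ e : CsEdge C, ∃ n : ℤ, ∀ z ∈ C e.1.1 ∩ C e.1.2, L e.1.2 z - L e.1.1 z = 2 * Real.pi * Complex.I * n := by
    intro e
    obtain ⟨z0, hz0⟩ := e.2.2
    have hex : ∀ z ∈ C e.1.1 ∩ C e.1.2, Complex.exp (L e.1.2 z - L e.1.1 z) = 1 := by
      intro z hz
      rw [Complex.exp_sub, hL' _ z hz.1, hL' _ z hz.2, div_self]
      rw [sub_ne_zero]; rintro rfl; exact hy _ hz.1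
    obtain ⟨n, hn⟩ := Complex.exp_eq_one_iff.1 (hex z0 hz0)
    refine ⟨n, fun z hz => ?_⟩
    have := cs_const_of_exp_on ((hcv _).inter (hcv _)).isPreconnected
      (fun z => L e.1.2 z - L e.1.1 z)
      (ContinuousOn.sub ((hL e.1.2).mono inter_subset_right) ((hL e.1.1).mono inter_subset_left))
      (fun a ha b hb => (hex a ha).trans (hex b hb).symm) hz hz0
    rw [this, hn]; ring
  choose w hw using this
  exact ⟨L, w, hL, hL', hw⟩

lemma cs_clear {ι : Type*} [Finite ι] (g : ι → ℚ) : ∃ D : ℤ, D ≠ 0 ∧ ∃ G : ι → ℤ, ∀ i, (G i : ℚ) = D * g i := by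
  obtain ⟨b, hb⟩ := IsLocalization.exist_integer_multiples_of_finite (nonZeroDivisors ℤ) g
  choose G hG using hb
  refine ⟨b, nonZeroDivisors.coe_ne_zero b, G, fun i => ?_⟩
  have := hG i
  simpa using this

lemma cs_euler {N b : ℕ} {C : Fin N → Set ℂ} (hN : 0 < N) (hcl : ∀ i, IsClosed (C i)) (hcv : ∀ i, Convex ℝ (C i))
    (hne : ∀ i, (C i).Nonempty) (hA : IsPreconnected (⋃ i, C i))
    (hsurj : Function.Surjective (csD1 C))
    (U : Fin b → Set ℂ) (y : Fin b → ℂ) (hU : ∀ a, IsOpen (U a)) (hUb : ∀ a, Bornology.IsBounded (U a))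
    (hUf : ∀ a, frontier (U a) ⊆ ⋃ i, C i) (hyU : ∀ a, y a ∈ U a) (hyA : ∀ a i, y a ∉ C i)
    (hyy : ∀ a a', a ≠ a' → y a' ∉ closure (U a)) :
    N + b + Nat.card (CsFace C) ≤ Nat.card (CsEdge C) + 1 := by
  classical
  choose L w hL hL' hw using fun a => cs_cocycle hcl hcv (hyA a)
  have hpi : (2 * Real.pi * Complex.I : ℂ) ≠ 0 := by simp [Real.pi_ne_zero]
  -- cocycle condition
  have hcoc : ∀ a, csD1 C (fun e => (w a e : ℚ)) = 0 := by
    intro a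
    ext T
    obtain ⟨z, ⟨h1, h2⟩, h3⟩ := T.2.2.2
    have q1 := hw a T.e1 z ⟨h2, h3⟩
    have q2 := hw a T.e2 z ⟨h1, h3⟩
    have q3 := hw a T.e3 z ⟨h1, h2⟩
    have : ((w a T.e1 : ℂ) - w a T.e2 + w a T.e3) = 0 := by
      apply mul_left_cancel₀ hpi
      simp only [CsFace.e1, CsFace.e2, CsFace.e3] at q1 q2 q3 ⊢
      linear_combination q2 - q1 - q3
    have h' : (w a T.e1 - w a T.e2 + w a T.e3 : ℤ) = 0 := by exact_mod_cast this
    have h'' : ((w a T.e1 - w a T.e2 + w a T.e3 : ℤ) : ℚ) = 0 := by exact_mod_cast h'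
    push_cast at h''
    exact h''
  let ψ : ((Fin N → ℚ) × (Fin b → ℚ)) →ₗ[ℚ] (CsEdge C → ℚ) :=
    LinearMap.coprod (csD0 C) (Fintype.linearCombination ℚ (fun a => fun e => (w a e : ℚ)))
  have hrange : LinearMap.range ψ ≤ LinearMap.ker (csD1 C) := by
    rintro _ ⟨⟨g, m⟩, rfl⟩
    rw [LinearMap.mem_ker]
    simp only [ψ, LinearMap.coprod_apply, map_add, cs_D1_D0, zero_add, Fintype.linearCombination_apply, map_sum, map_smul, hcoc]
    simp
  have hker : LinearMap.ker ψ ≤ Submodule.span ℚ {((fun _ => 1, 0) : (Fin N → ℚ) × (Fin b → ℚ))} := by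
    rintro ⟨g, m⟩ hgm
    rw [LinearMap.mem_ker] at hgm
    have hedge : ∀ e : CsEdge C, g e.1.2 - g e.1.1 + ∑ a, m a * w a e = 0 := by
      intro e
      have := congrFun hgm e
      simpa [ψ, csD0, Fintype.linearCombination_apply] using this
    have hm : m = 0 := by
      obtain ⟨D, hD, G, hG⟩ := cs_clear (Sum.elim g m)
      have hintg : ∀ e : CsEdge C, G (Sum.inl e.1.2) - G (Sum.inl e.1.1) + ∑ a, G (Sum.inr a) * w a e = 0 := by
        intro e
        have h1 : ((G (Sum.inl e.1.2) - G (Sum.inl e.1.1) + ∑ a, G (Sum.inr a) * w a e : ℤ) : ℚ) = 0 := by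
          push_cast
          simp only [hG, Sum.elim_inl, Sum.elim_inr]
          have := hedge e
          have h2 : ∑ a, (D : ℚ) * m a * w a e = D * ∑ a, m a * w a e := by
            rw [Finset.mul_sum]; simp only [mul_assoc]
          rw [h2]; linear_combination D * this
        exact_mod_cast h1
      obtain ⟨φ, hφ, hφ'⟩ := cs_glue hcl (fun i z => ∑ a, G (Sum.inr a) * L a i z + 2 * Real.pi * Complex.I * G (Sum.inl i))
        (fun i => (continuousOn_finsetSum _ fun a _ => continuousOn_const.mul (hL a i)).add continuousOn_const)
        (by
          intro i j hij z hz
          have h1 : ∀ a, L a j z = L a i z + 2 * Real.pi * Complex.I * w a ⟨(i, j), hij, ⟨z, hz⟩⟩ := by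
            intro a
            have := hw a ⟨(i, j), hij, ⟨z, hz⟩⟩ z hz
            simp only at this
            rw [← this]; ring
          have h2 := hintg ⟨(i, j), hij, ⟨z, hz⟩⟩
          have h3 : ((G (Sum.inl j) - G (Sum.inl i) + ∑ a, G (Sum.inr a) * w a ⟨(i, j), hij, ⟨z, hz⟩⟩ : ℤ) : ℂ) = 0 := by
            exact_mod_cast h2
          push_cast at h3
          simp only [h1, mul_add, Finset.sum_add_distrib]
          have h4 : ∑ a, (G (Sum.inr a) : ℂ) * (2 * Real.pi * Complex.I * w a ⟨(i, j), hij, ⟨z, hz⟩⟩) =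
              2 * Real.pi * Complex.I * ∑ a, (G (Sum.inr a) : ℂ) * w a ⟨(i, j), hij, ⟨z, hz⟩⟩ := by
            rw [Finset.mul_sum]; refine Finset.sum_congr rfl fun a _ => ?_; ring
          rw [h4]
          linear_combination (-2 * Real.pi * Complex.I) * h3)
      have hexp : ∀ z ∈ ⋃ i, C i, Complex.exp (φ z) = ∏ a, (z - y a) ^ G (Sum.inr a) := by
        intro z hz
        obtain ⟨i, hi⟩ := mem_iUnion.1 hz
        rw [hφ' i z hi, Complex.exp_add, Complex.exp_sum]
        have : Complex.exp (2 * Real.pi * Complex.I * G (Sum.inl i)) = 1 := by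
          rw [Complex.exp_eq_one_iff]; exact ⟨G (Sum.inl i), by ring⟩
        rw [this, mul_one]
        refine Finset.prod_congr rfl fun a _ => ?_
        rw [Complex.exp_int_mul, hL' a i z hi]
      have hA : IsClosed (⋃ i, C i) := isClosed_iUnion_of_finite hcl
      ext a
      have h0 := cs_eilenberg hA (hU a) (hUb a) (hUf a) (hyU a) (G (Sum.inr a))
        (fun z => ∏ c ∈ Finset.univ.erase a, (z - y c) ^ (- G (Sum.inr c)))
        (by
          refine continuousOn_finsetProd _ fun c hc => ?_
          intro z hz
          refine (ContinuousAt.zpow₀ (by fun_prop) _ (Or.inl ?_)).continuousWithinAt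
          rw [sub_ne_zero]; rintro rfl
          exact hyy a c (Finset.ne_of_mem_erase hc).symm hz)
        (by
          intro z hz
          refine Finset.prod_ne_zero_iff.2 fun c hc => zpow_ne_zero _ ?_
          rw [sub_ne_zero]; rintro rfl
          exact hyy a c (Finset.ne_of_mem_erase hc).symm hz) φ hφ
        (by
          intro z hz
          rw [hexp z (hUf a hz), ← Finset.mul_prod_erase Finset.univ _ (Finset.mem_univ a), mul_left_comm,
            ← Finset.prod_mul_distrib, Finset.prod_eq_one, mul_one]
          intro c hc
          rw [zpow_neg, inv_mul_cancel₀]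
          refine zpow_ne_zero _ ?_
          rw [sub_ne_zero]; rintro rfl
          obtain ⟨i, hi⟩ := mem_iUnion.1 (hUf a hz)
          exact hyA c i hi)
      have := hG (Sum.inr a)
      rw [h0] at this
      simp only [Int.cast_zero, Sum.elim_inr] at this
      have hD' : (D : ℚ) ≠ 0 := by exact_mod_cast hD
      exact (mul_eq_zero.1 this.symm).resolve_left hD'
    subst hm
    rw [Submodule.mem_span_singleton]
    refine ⟨g ⟨0, hN⟩, ?_⟩
    have hconst := cs_const_of_edges hcl hne hA g (by
      intro i j hij h
      have := hedge ⟨(i, j), hij, h⟩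
      simp at this
      linarith)
    ext i
    · simp [hconst i ⟨0, hN⟩]
    · simp
  have k1 := LinearMap.finrank_range_add_finrank_ker ψ
  have k2 := LinearMap.finrank_range_add_finrank_ker (csD1 C)
  have k3 := Submodule.finrank_mono hrange
  have k4 := (Submodule.finrank_mono hker).trans (finrank_span_le_card _)
  rw [LinearMap.range_eq_top.2 hsurj, finrank_top] at k2
  simp only [Module.finrank_prod, Module.finrank_fintype_fun_eq_card, Fintype.card_fin] at k1 k2
  simp only [Set.toFinset_singleton, Finset.card_singleton] at k4
  rw [Nat.card_eq_fintype_card, Nat.card_eq_fintype_card]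
  omega

lemma cs_side {N : ℕ} {x : Fin N → ℂ} (hx : CsGP x) {t : ℝ} {i j k l : Fin N} (hij : i ≠ j) (hik : i ≠ k)
    (hjk : j ≠ k) (hil : i ≠ l) (hjl : j ≠ l) (hkl : k ≠ l) {c c' : ℂ}
    (h1 : c ∈ csCell x i t) (h2 : c ∈ csCell x j t) (h3 : c ∈ csCell x k t)
    (h1' : c' ∈ csCell x i t) (h2' : c' ∈ csCell x j t) (h3' : c' ∈ csCell x l t)
    (hs : csCr (x i) (x j) (x k) * (x j - x i).re < 0) : c.im < c'.im := by
  have hab : x i ≠ x j := fun h => hij (hx.inj h)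
  obtain ⟨τ, rfl⟩ := csPt_exists hab (cs_dist_of_inter h1 h2)
  obtain ⟨τ', rfl⟩ := csPt_exists hab (cs_dist_of_inter h1' h2')
  have e1 := (csPt_dist_eq_iff _ _ _ _).1 (cs_dist_of_inter h1 h3)
  have e2 := (csPt_dist_le_iff _ _ _ _).1 (h1'.2 k)
  have hne : τ ≠ τ' := by
    rintro rfl
    exact hx.ncyc i j k l hij hik hil hjk hjl hkl _ ⟨cs_dist_of_inter h1 h2, cs_dist_of_inter h1 h3, cs_dist_of_inter h1 h3'⟩
  set q := csCr (x i) (x j) (x k) with hq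
  have hq0 : q ≠ 0 := hx.nc i j k hij hik hjk
  have h5 : q * (τ' - τ) < 0 := by
    refine lt_of_le_of_ne (by linarith) ?_
    exact mul_ne_zero hq0 (sub_ne_zero.2 hne.symm)
  have h6 : 0 < (τ' - τ) * (x j - x i).re := by
    have h7 : 0 < q * (τ' - τ) * (q * (x j - x i).re) := mul_pos_of_neg_of_neg h5 hs
    have h8 : q * (τ' - τ) * (q * (x j - x i).re) = q ^ 2 * ((τ' - τ) * (x j - x i).re) := by ring
    rw [h8] at h7
    exact (mul_pos_iff_of_pos_left (by positivity)).1 h7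
  simp only [csPt, Complex.add_im, Complex.im_ofReal_mul, Complex.I_mul_im]
  linarith

lemma cs_upside {a b c : ℂ} (h : csCr a b c ≠ 0) :
    csCr a b c * (b - a).re < 0 ∨ csCr b c a * (c - b).re < 0 ∨ csCr a c b * (c - a).re < 0 := by
  by_contra hcon
  push Not at hcon
  obtain ⟨h1, h2, h3⟩ := hcon
  have e1 : csCr b c a = csCr a b c := by simp only [csCr_eq, Complex.sub_re, Complex.sub_im]; ring
  have e2 : csCr a c b = - csCr a b c := by simp only [csCr_eq, Complex.sub_re, Complex.sub_im]; ring
  rw [e1] at h2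
  rw [e2] at h3
  have h4 : csCr a b c * (b - a).re + csCr a b c * (c - b).re = csCr a b c * (c - a).re := by
    simp only [Complex.sub_re]; ring
  have z1 : csCr a b c * (b - a).re = 0 := by linarith
  have z2 : csCr a b c * (c - a).re = 0 := by linarith
  have z1' := (mul_eq_zero.1 z1).resolve_left h
  have z2' := (mul_eq_zero.1 z2).resolve_left h
  apply h
  rw [csCr_eq, z1', z2']; ring

lemma cs_D1_surj {N : ℕ} {x : Fin N → ℂ} (hx : CsGP x) (t : ℝ) :
    Function.Surjective (csD1 (fun i => csCell x i t)) := by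
  classical
  set C := fun i => csCell x i t with hC
  rw [← LinearMap.range_eq_top]
  by_contra hcon
  obtain ⟨φ, hφ0, hφ⟩ := Submodule.exists_le_ker_of_lt_top _ (lt_top_iff_ne_top.2 hcon)
  have hφs : ∀ v : CsFace C → ℚ, φ v = ∑ T, v T * φ (Pi.single T 1) := by
    intro v
    rw [LinearMap.pi_apply_eq_sum_univ φ v]
    refine Finset.sum_congr rfl fun T _ => ?_
    rw [smul_eq_mul]; congr 2; ext S; simp [Pi.single_apply, eq_comm]
  let c : CsFace C → ℂ := fun T => T.2.2.2.some
  have hc : ∀ T : CsFace C, c T ∈ csCell x T.1.1 t ∧ c T ∈ csCell x T.1.2.1 t ∧ c T ∈ csCell x T.1.2.2 t := by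
    intro T
    have := T.2.2.2.some_mem
    exact ⟨this.1.1, this.1.2, this.2⟩
  let S : Finset (CsFace C) := Finset.univ.filter fun T => φ (Pi.single T 1) ≠ 0
  have hS : S.Nonempty := by
    by_contra h
    rw [Finset.not_nonempty_iff_eq_empty] at h
    apply hφ0
    ext T
    simp only [LinearMap.coe_comp, LinearMap.coe_single, Function.comp_apply, LinearMap.zero_comp, LinearMap.zero_apply]
    by_contra h'
    have : T ∈ S := by simp [S, h']
    simp [h] at this
  obtain ⟨T, hTS, hT⟩ := Finset.exists_max_image S (fun T => (c T).im) hS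
  have hTz : φ (Pi.single T 1) ≠ 0 := (Finset.mem_filter.1 hTS).2
  -- key: an edge that occurs only in T among S
  have key : ∀ e : CsEdge C, (csD1 C (Pi.single e 1) T ≠ 0) →
      (∀ T' : CsFace C, T' ≠ T → (e = T'.e1 ∨ e = T'.e2 ∨ e = T'.e3) → (c T).im < (c T').im) → False := by
    intro e h1 h2
    have h3 : φ (csD1 C (Pi.single e 1)) = 0 := hφ ⟨_, rfl⟩
    rw [hφs, Finset.sum_eq_single T] at h3
    · exact (mul_ne_zero h1 hTz) h3
    · intro T' _ hT'
      by_cases hz : φ (Pi.single T' 1) = 0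
      · rw [hz, mul_zero]
      · have hz0 : csD1 C (Pi.single e 1) T' = 0 := by
          have hle := hT T' (by simp [S, hz])
          have hn : ¬ (e = T'.e1 ∨ e = T'.e2 ∨ e = T'.e3) := fun h => absurd (h2 T' hT' h) (not_lt.2 hle)
          push Not at hn
          simp [csD1, Pi.single_apply, Ne.symm hn.1, Ne.symm hn.2.1, Ne.symm hn.2.2]
        rw [hz0, zero_mul]
    · intro h; exact absurd (Finset.mem_univ _) h
  obtain ⟨h1, h2, h3⟩ := hc T
  obtain ⟨⟨i, j, k⟩, hij, hjk, hne⟩ := T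
  simp only at h1 h2 h3 hij hjk
  have hik := hij.trans hjk
  have fin : ∀ T' : CsFace C, T' ≠ ⟨(i, j, k), hij, hjk, hne⟩ →
     (T'.1.1 = i → T'.1.2.1 = j → k ≠ T'.1.2.2) ∧ (T'.1.1 = i → T'.1.2.2 = j → k ≠ T'.1.2.1) ∧ (T'.1.2.1 = i → T'.1.2.2 = j → k ≠ T'.1.1)
     ∧ (T'.1.1 = i → T'.1.2.1 = k → j ≠ T'.1.2.2) ∧ (T'.1.1 = i → T'.1.2.2 = k → j ≠ T'.1.2.1) ∧ (T'.1.2.1 = i → T'.1.2.2 = k → j ≠ T'.1.1)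
     ∧ (T'.1.1 = j → T'.1.2.1 = k → i ≠ T'.1.2.2) ∧ (T'.1.1 = j → T'.1.2.2 = k → i ≠ T'.1.2.1) ∧ (T'.1.2.1 = j → T'.1.2.2 = k → i ≠ T'.1.1) := by
    rintro ⟨⟨i', j', k'⟩, a1, a2, a3⟩ hT'
    have hT'' : ¬ (i' = i ∧ j' = j ∧ k' = k) := by
      rintro ⟨rfl, rfl, rfl⟩; exact hT' rfl
    simp only [ne_eq] at *
    refine ⟨?_, ?_, ?_, ?_, ?_, ?_, ?_, ?_, ?_⟩ <;> intro b1 b2 b3 <;> subst b1 b2 b3 <;>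
      first
      | exact hT'' ⟨rfl, rfl, rfl⟩
      | (exfalso; order)
  rcases cs_upside (hx.nc i j k hij.ne hik.ne hjk.ne) with hs | hs | hs
  · refine key ⟨(i, j), hij, hne.mono fun _ h => h.1⟩ ?_ ?_
    · simp [csD1, Pi.single_apply, CsFace.e1, CsFace.e2, CsFace.e3, hij.ne', hjk.ne]
    · intro T' hT' h
      obtain ⟨g1, g2, g3⟩ := hc T'
      obtain ⟨f1, f2, f3, -⟩ := fin T' hT'
      obtain ⟨l1, l2, -⟩ := T'.2
      have l3 := l1.trans l2
      rcases h with h | h | h <;> simp only [CsFace.e1, CsFace.e2, CsFace.e3, Subtype.mk.injEq, Prod.mk.injEq] at h <;>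
        obtain ⟨u1, u2⟩ := h
      · rw [← u1] at g2 l1; rw [← u2] at g3 l3
        exact cs_side hx hij.ne hik.ne hjk.ne l1.ne' l3.ne' (f3 u1.symm u2.symm) h1 h2 h3 g2 g3 g1 hs
      · rw [← u1] at g1 l1; rw [← u2] at g3 l2
        exact cs_side hx hij.ne hik.ne hjk.ne l1.ne l2.ne' (f2 u1.symm u2.symm) h1 h2 h3 g1 g3 g2 hs
      · rw [← u1] at g1 l3; rw [← u2] at g2 l2
        exact cs_side hx hij.ne hik.ne hjk.ne l3.ne l2.ne (f1 u1.symm u2.symm) h1 h2 h3 g1 g2 g3 hs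
  · refine key ⟨(j, k), hjk, hne.mono fun _ h => ⟨h.1.2, h.2⟩⟩ ?_ ?_
    · simp [csD1, Pi.single_apply, CsFace.e1, CsFace.e2, CsFace.e3, hij.ne, hjk.ne]
    · intro T' hT' h
      obtain ⟨g1, g2, g3⟩ := hc T'
      obtain ⟨-, -, -, -, -, -, f1, f2, f3⟩ := fin T' hT'
      obtain ⟨l1, l2, -⟩ := T'.2
      have l3 := l1.trans l2
      rcases h with h | h | h <;> simp only [CsFace.e1, CsFace.e2, CsFace.e3, Subtype.mk.injEq, Prod.mk.injEq] at h <;>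
        obtain ⟨u1, u2⟩ := h
      · rw [← u1] at g2 l1; rw [← u2] at g3 l3
        exact cs_side hx hjk.ne hij.ne' hik.ne' l1.ne' l3.ne' (f3 u1.symm u2.symm) h2 h3 h1 g2 g3 g1 hs
      · rw [← u1] at g1 l1; rw [← u2] at g3 l2
        exact cs_side hx hjk.ne hij.ne' hik.ne' l1.ne l2.ne' (f2 u1.symm u2.symm) h2 h3 h1 g1 g3 g2 hs
      · rw [← u1] at g1 l3; rw [← u2] at g2 l2
        exact cs_side hx hjk.ne hij.ne' hik.ne' l3.ne l2.ne (f1 u1.symm u2.symm) h2 h3 h1 g1 g2 g3 hs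
  · refine key ⟨(i, k), hik, hne.mono fun _ h => ⟨h.1.1, h.2⟩⟩ ?_ ?_
    · simp [csD1, Pi.single_apply, CsFace.e1, CsFace.e2, CsFace.e3, hij.ne', hjk.ne]
    · intro T' hT' h
      obtain ⟨g1, g2, g3⟩ := hc T'
      obtain ⟨-, -, -, f1, f2, f3, -⟩ := fin T' hT'
      obtain ⟨l1, l2, -⟩ := T'.2
      have l3 := l1.trans l2
      rcases h with h | h | h <;> simp only [CsFace.e1, CsFace.e2, CsFace.e3, Subtype.mk.injEq, Prod.mk.injEq] at h <;>
        obtain ⟨u1, u2⟩ := h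
      · rw [← u1] at g2 l1; rw [← u2] at g3 l3
        exact cs_side hx hik.ne hij.ne hjk.ne' l1.ne' l3.ne' (f3 u1.symm u2.symm) h1 h3 h2 g2 g3 g1 hs
      · rw [← u1] at g1 l1; rw [← u2] at g3 l2
        exact cs_side hx hik.ne hij.ne hjk.ne' l1.ne l2.ne' (f2 u1.symm u2.symm) h1 h3 h2 g1 g3 g2 hs
      · rw [← u1] at g1 l3; rw [← u2] at g2 l2
        exact cs_side hx hik.ne hij.ne hjk.ne' l3.ne l2.ne (f1 u1.symm u2.symm) h1 h3 h2 g1 g2 g3 hs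

lemma csE_swap {N : ℕ} (x : Fin N → ℂ) (t : ℝ) (i j : Fin N) : csE x t j i = csE x t i j := by
  unfold csE; rw [inter_comm (csCell x j t)]; congr 1; simp only [ne_eq, eq_comm (a := j)]

lemma csE_card {N : ℕ} (x : Fin N → ℂ) (t : ℝ) :
    ∑ i, ∑ j, csE x t i j = 2 * Nat.card (CsEdge (fun i => csCell x i t)) := by
  classical
  have h1 : ∀ i j, csE x t i j = (if i < j then csE x t i j else 0) + (if j < i then csE x t j i else 0) := by
    intro i j
    rcases lt_trichotomy i j with h | h | h
    · simp [h, h.not_gt]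
    · subst h; simp [csE]
    · simp [h, h.not_gt, csE_swap x t i j]
  have h2 : ∑ i, ∑ j, csE x t i j = 2 * ∑ i, ∑ j, (if i < j then csE x t i j else 0) := by
    rw [Finset.sum_congr rfl fun i _ => Finset.sum_congr rfl fun j _ => h1 i j]
    simp only [Finset.sum_add_distrib]
    rw [Finset.sum_comm (f := fun i j => if j < i then csE x t j i else 0)]
    ring
  rw [h2, Nat.card_eq_fintype_card, Fintype.card_subtype, ← Finset.sum_product', Finset.univ_product_univ,
    Finset.card_filter]
  push_cast
  congr 1
  refine Finset.sum_congr rfl fun p _ => ?_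
  by_cases h : p.1 < p.2
  · simp [h, csE, h.ne]
  · simp [h]

lemma csF_card {N : ℕ} (x : Fin N → ℂ) (t : ℝ) :
    ∑ i, ∑ j, ∑ k, csF x t i j k = 6 * Nat.card (CsFace (fun i => csCell x i t)) := by
  classical
  set f : Fin N → Fin N → Fin N → ℝ := fun i j k => if i < j ∧ j < k then csF x t i j k else 0 with hf
  have p1 : ∀ g : Fin N → Fin N → Fin N → ℝ, ∑ i, ∑ j, ∑ k, g j i k = ∑ i, ∑ j, ∑ k, g i j k :=
    fun g => Finset.sum_comm
  have p2 : ∀ g : Fin N → Fin N → Fin N → ℝ, ∑ i, ∑ j, ∑ k, g i k j = ∑ i, ∑ j, ∑ k, g i j k :=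
    fun g => Finset.sum_congr rfl fun i _ => Finset.sum_comm
  have six : ∀ i j k, f i j k + f j k i + f k i j + f j i k + f i k j + f k j i = csF x t i j k := by
    intro i j k
    have a1 : csF x t j k i = csF x t i j k := by rw [csF_swap2, csF_swap]
    have a2 : csF x t k i j = csF x t i j k := by rw [csF_swap, csF_swap2]
    have a3 : csF x t k j i = csF x t i j k := by rw [csF_swap, a1]
    simp only [hf, a1, a2, a3, csF_swap x t i j k, csF_swap2 x t i j k]
    by_cases hd : i ≠ j ∧ i ≠ k ∧ j ≠ k
    · obtain ⟨h1, h2, h3⟩ := hd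
      rcases lt_or_gt_of_ne h1 with h1 | h1 <;> rcases lt_or_gt_of_ne h2 with h2 | h2 <;>
        rcases lt_or_gt_of_ne h3 with h3 | h3 <;>
        first
        | (exfalso; order)
        | simp [h1, h2, h3, h1.not_gt, h2.not_gt, h3.not_gt]
    · have : csF x t i j k = 0 := if_neg fun h => hd h.1
      rw [this]; simp
  have tot : ∑ i, ∑ j, ∑ k, (f i j k + f j k i + f k i j + f j i k + f i k j + f k j i) =
      ∑ i, ∑ j, ∑ k, csF x t i j k := by
    simp only [six]
  simp only [Finset.sum_add_distrib] at tot
  have q1 := p1 f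
  have q2 := p2 f
  have q3 := p2 (fun i j k => f j i k)
  have q4 := p1 (fun i j k => f i k j)
  have q5 := p2 (fun i j k => f j k i)
  have hsum : ∑ i, ∑ j, ∑ k, f i j k = Nat.card (CsFace (fun i => csCell x i t)) := by
    rw [Nat.card_eq_fintype_card, Fintype.card_subtype, Finset.card_filter]
    simp only [← Finset.sum_product', Finset.univ_product_univ]
    push_cast
    refine Finset.sum_congr rfl fun p _ => ?_
    by_cases h : p.1 < p.2.1 ∧ p.2.1 < p.2.2
    · have h13 : p.1 ≠ p.2.2 := (h.1.trans h.2).ne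
      have h12 : p.1 ≠ p.2.1 := h.1.ne
      have h23 : p.2.1 ≠ p.2.2 := h.2.ne
      simp [hf, h.1, h.2, csF, h12, h13, h23]
    · have h' : ¬ (p.1 < p.2.1 ∧ p.2.1 < p.2.2 ∧ (csCell x p.1 t ∩ csCell x p.2.1 t ∩ csCell x p.2.2 t).Nonempty) := by
        tauto
      simp only [hf, if_neg h, if_neg h']
  rw [← hsum]
  linarith

/-- Euler characteristic bound for unions of discs -/
lemma cs_chi {N b : ℕ} {x : Fin N → ℂ} (hx : CsGP x) (hN : 0 < N) {t : ℝ} (ht : 0 ≤ t)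
    (hA : IsPreconnected (csA x t))
    (U : Fin b → Set ℂ) (y : Fin b → ℂ) (hU : ∀ a, IsOpen (U a)) (hUb : ∀ a, Bornology.IsBounded (U a))
    (hUf : ∀ a, frontier (U a) ⊆ csA x t) (hyU : ∀ a, y a ∈ U a) (hyA : ∀ a, y a ∉ csA x t)
    (hyy : ∀ a a', a ≠ a' → y a' ∉ closure (U a)) :
    2 * Real.pi * N - Real.pi * ∑ i, ∑ j, csE x t i j + Real.pi / 3 * ∑ i, ∑ j, ∑ k, csF x t i j k
      ≤ 2 * Real.pi * (1 - b) := by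
  rw [csA_eq] at hA hyA
  rw [csA_eq] at hUf
  have := cs_euler hN (fun i => csCell_isClosed x i t) (fun i => csCell_convex x i t)
    (fun i => ⟨x i, by simp [csCell, ht]⟩) hA (cs_D1_surj hx t) U y hU hUb hUf hyU
    (fun a i h => hyA a (mem_iUnion.2 ⟨i, h⟩)) hyy
  rw [csE_card, csF_card]
  have h2 : ((N + b + Nat.card (CsFace (fun i => csCell x i t)) : ℕ) : ℝ) ≤ ((Nat.card (CsEdge (fun i => csCell x i t)) + 1 : ℕ) : ℝ) := by
    exact_mod_cast this
  push_cast at h2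
  nlinarith [Real.pi_pos]

/-- Lemma GH -/
lemma cs_growth {N b : ℕ} {x : Fin N → ℂ} (hx : CsGP x) (hN : 0 < N) {t1 t2 : ℝ} (h1 : 0 < t1) (h12 : t1 ≤ t2)
    (hA : ∀ t ∈ Ioo t1 t2, IsPreconnected (csA x t))
    (hU : ∀ t ∈ Ioo t1 t2, ∃ (U : Fin b → Set ℂ) (y : Fin b → ℂ), (∀ a, IsOpen (U a)) ∧ (∀ a, Bornology.IsBounded (U a)) ∧
    (∀ a, frontier (U a) ⊆ csA x t) ∧ (∀ a, y a ∈ U a) ∧ (∀ a, y a ∉ csA x t) ∧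
    (∀ a a', a ≠ a' → y a' ∉ closure (U a))) :
    csEll x t2 - csEll x t1 ≤ 2 * Real.pi * (1 - b) * (t2 - t1) := by
  refine csEll_growth hx h1 h12 fun t ht => ?_
  obtain ⟨U, y, a1, a2, a3, a4, a5, a6⟩ := hU t ht
  exact cs_chi hx hN (h1.trans ht.1).le (hA t ht) U y a1 a2 a3 a4 a5 a6

/-! ## Nets in general position -/

def CsGPf (S : Finset ℂ) : Prop :=
  (∀ T ⊆ S, T.card = 3 → ¬ ∃ w : ℂ, w ≠ 0 ∧ ∃ c : ℝ, ∀ z ∈ T, (z * w).re = c) ∧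
  (∀ T ⊆ S, T.card = 4 → ¬ ∃ (c : ℂ) (ρ : ℝ), ∀ z ∈ T, dist c z = ρ)

lemma cs_on_line {a b q w : ℂ} {c : ℝ} (hw : w ≠ 0) (h1 : (a * w).re = c) (h2 : (b * w).re = c) (h3 : (q * w).re = c) :
    csCr a b q = 0 := by
  rw [csCr_eq]
  simp only [Complex.mul_re, Complex.sub_re, Complex.sub_im] at *
  have hw' : w.re ≠ 0 ∨ w.im ≠ 0 := by
    by_contra h; push Not at h
    exact hw (Complex.ext h.1 h.2)
  rcases hw' with h | h
  · apply mul_left_cancel₀ h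
    linear_combination (q.im - a.im) * (h2 - h1) - (b.im - a.im) * (h3 - h1)
  · apply mul_left_cancel₀ h
    linear_combination (q.re - a.re) * (h2 - h1) - (b.re - a.re) * (h3 - h1)

lemma cs_cr_line {a b q : ℂ} (h : csCr a b q = 0) :
    (q * (Complex.I * (starRingEnd ℂ) (b - a))).re = (a * (Complex.I * (starRingEnd ℂ) (b - a))).re := by
  rw [csCr_eq] at h
  simp only [Complex.mul_re, Complex.mul_im, Complex.I_re, Complex.I_im, Complex.conj_re, Complex.conj_im, Complex.sub_re, Complex.sub_im] at *
  linarith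

lemma CsGPf.insert_exists {S : Finset ℂ} (hS : CsGPf S) (p : ℂ) {ε : ℝ} (hε : 0 < ε) :
    ∃ q, dist q p < ε ∧ CsGPf (insert q S) := by
  classical
  set B1 : Set ℂ := ⋃ a ∈ S, ⋃ b ∈ S, {q | a ≠ b ∧ csCr a b q = 0}
  set B2 : Set ℂ := ⋃ T ∈ S.powersetCard 3, {q | ∃ (c : ℂ) (ρ : ℝ), (∀ z ∈ T, dist c z = ρ) ∧ dist c q = ρ}
  have n1 : volume B1 = 0 := by
    refine (measure_biUnion_null_iff S.countable_toSet).2 fun a _ => (measure_biUnion_null_iff S.countable_toSet).2 fun b _ => ?_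
    by_cases hab : a = b
    · simp [hab]
    · refine measure_mono_null (fun q hq => ?_) (cs_line_null (Complex.I * (starRingEnd ℂ) (b - a)) ?_ ((a * (Complex.I * (starRingEnd ℂ) (b - a))).re))
      · exact cs_cr_line hq.2
      · exact mul_ne_zero Complex.I_ne_zero ((map_ne_zero _).2 (sub_ne_zero.2 (Ne.symm hab)))
  have n2 : volume B2 = 0 := by
    refine (measure_biUnion_null_iff (Finset.countable_toSet _)).2 fun T hT => ?_
    have hT' := Finset.mem_powersetCard.1 (by simpa using hT : T ∈ S.powersetCard 3)
    by_cases he : ∃ (c : ℂ) (ρ : ℝ), ∀ z ∈ T, dist c z = ρ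
    · obtain ⟨c0, ρ0, h0⟩ := he
      refine measure_mono_null ?_ (Measure.addHaar_sphere volume c0 ρ0)
      rintro q ⟨c, ρ, h, hq⟩
      have hc : c = c0 := by
        by_contra hne
        obtain ⟨z1, hz1⟩ : T.Nonempty := Finset.card_pos.1 (by omega)
        refine hS.1 T hT'.1 hT'.2 ⟨(starRingEnd ℂ) (c - c0), (map_ne_zero _).2 (sub_ne_zero.2 hne),
          (z1 * (starRingEnd ℂ) (c - c0)).re, fun z hz => ?_⟩
        have e1 : dist c z ^ 2 = dist c z1 ^ 2 := by rw [h z hz, h z1 hz1]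
        have e2 : dist c0 z ^ 2 = dist c0 z1 ^ 2 := by rw [h0 z hz, h0 z1 hz1]
        simp only [Complex.dist_eq, ← Complex.normSq_eq_norm_sq, Complex.normSq_apply, Complex.sub_re, Complex.sub_im,
          Complex.mul_re, Complex.conj_re, Complex.conj_im] at *
        linarith
      subst hc
      obtain ⟨z1, hz1⟩ : T.Nonempty := Finset.card_pos.1 (by omega)
      rw [mem_sphere, dist_comm, hq, ← h z1 hz1, h0 z1 hz1]
    · refine measure_mono_null ?_ measure_empty
      rintro q ⟨c, ρ, h, -⟩
      exact he ⟨c, ρ, h⟩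
  have : ∃ q ∈ ball p ε, q ∉ B1 ∪ B2 := by
    by_contra h
    push Not at h
    have := measure_mono_null (show ball p ε ⊆ B1 ∪ B2 from h) (measure_union_null n1 n2)
    exact (measure_ball_pos volume p hε).ne' this
  obtain ⟨q, hq, hqB⟩ := this
  refine ⟨q, hq, ?_, ?_⟩
  · rintro T hT hc ⟨w, hw, c, h⟩
    by_cases hqT : q ∈ T
    · have hsub : T.erase q ⊆ S := by
        intro z hz; have := hT (Finset.mem_of_mem_erase hz)
        exact (Finset.mem_insert.1 this).resolve_left (Finset.ne_of_mem_erase hz)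
      have hcard : 1 < (T.erase q).card := by rw [Finset.card_erase_of_mem hqT]; omega
      obtain ⟨a, ha, b, hb, hab⟩ := Finset.one_lt_card.1 hcard
      refine hqB (Or.inl (mem_iUnion₂.2 ⟨a, hsub ha, mem_iUnion₂.2 ⟨b, hsub hb, hab, ?_⟩⟩))
      exact cs_on_line hw (h a (Finset.mem_of_mem_erase ha)) (h b (Finset.mem_of_mem_erase hb)) (h q hqT)
    · refine hS.1 T (fun z hz => (Finset.mem_insert.1 (hT hz)).resolve_left ?_) hc ⟨w, hw, c, h⟩
      rintro rfl; exact hqT hz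
  · rintro T hT hc ⟨c, ρ, h⟩
    by_cases hqT : q ∈ T
    · have hsub : T.erase q ⊆ S := by
        intro z hz; have := hT (Finset.mem_of_mem_erase hz)
        exact (Finset.mem_insert.1 this).resolve_left (Finset.ne_of_mem_erase hz)
      have hcard : (T.erase q).card = 3 := by rw [Finset.card_erase_of_mem hqT]; omega
      refine hqB (Or.inr (mem_iUnion₂.2 ⟨T.erase q, Finset.mem_powersetCard.2 ⟨hsub, hcard⟩, c, ρ, fun z hz => h z (Finset.mem_of_mem_erase hz), h q hqT⟩))
    · refine hS.2 T (fun z hz => (Finset.mem_insert.1 (hT hz)).resolve_left ?_) hc ⟨c, ρ, h⟩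
      rintro rfl; exact hqT hz

lemma CsGPf.mono {S T : Finset ℂ} (hS : CsGPf S) (h : T ⊆ S) : CsGPf T :=
  ⟨fun U hU => hS.1 U (hU.trans h), fun U hU => hS.2 U (hU.trans h)⟩

lemma cs_net (D : Set ℂ) (hD : IsCompact D) {κ : ℝ} (hκ : 0 < κ) :
    ∃ S : Finset ℂ, CsGPf S ∧ (∀ z ∈ S, ∃ d ∈ D, dist z d < κ) ∧ (∀ d ∈ D, ∃ z ∈ S, dist d z < κ) := by
  classical
  obtain ⟨t, ht, hf, hcov⟩ := hD.finite_cover_balls (half_pos hκ)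
  obtain ⟨F, rfl⟩ := hf.exists_finset_coe
  have key : ∀ F : Finset ℂ, ∃ S : Finset ℂ, CsGPf S ∧ (∀ z ∈ S, ∃ d ∈ F, dist z d < κ / 2) ∧ (∀ d ∈ F, ∃ z ∈ S, dist z d < κ / 2) := by
    intro F
    induction F using Finset.induction_on with
    | empty => exact ⟨∅, ⟨fun T hT hc => by simp [Finset.subset_empty.1 hT] at hc, fun T hT hc => by simp [Finset.subset_empty.1 hT] at hc⟩, by simp, by simp⟩
    | insert a F _ ih =>
      obtain ⟨S, h1, h2, h3⟩ := ih
      obtain ⟨q, hq, hq2⟩ := h1.insert_exists a (half_pos hκ)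
      refine ⟨insert q S, hq2, ?_, ?_⟩
      · intro z hz
        rcases Finset.mem_insert.1 hz with rfl | hz
        · exact ⟨a, by simp, hq⟩
        · obtain ⟨d, hd, h⟩ := h2 z hz; exact ⟨d, by simp [hd], h⟩
      · intro d hd
        rcases Finset.mem_insert.1 hd with rfl | hd
        · exact ⟨q, by simp, hq⟩
        · obtain ⟨z, hz, h⟩ := h3 d hd; exact ⟨z, by simp [hz], h⟩
  obtain ⟨S, h1, h2, h3⟩ := key F
  refine ⟨S, h1, fun z hz => ?_, fun d hd => ?_⟩
  · obtain ⟨d, hd, h⟩ := h2 z hz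
    exact ⟨d, ht hd, by linarith⟩
  · obtain ⟨y, hy, h⟩ := mem_iUnion₂.1 (hcov hd)
    obtain ⟨z, hz, h'⟩ := h3 y hy
    refine ⟨z, hz, ?_⟩
    have := dist_triangle d y z
    rw [mem_ball] at h
    rw [dist_comm y z] at this
    linarith

/-- enumeration of a finset -/
noncomputable def csEn (S : Finset ℂ) : Fin S.card → ℂ := fun i => (S.equivFin.symm i : ℂ)

lemma csEn_mem (S : Finset ℂ) (i : Fin S.card) : csEn S i ∈ S := (S.equivFin.symm i).2

lemma csEn_surj (S : Finset ℂ) {z : ℂ} (hz : z ∈ S) : ∃ i, csEn S i = z :=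
  ⟨S.equivFin ⟨z, hz⟩, by simp [csEn]⟩

lemma csEn_inj (S : Finset ℂ) : Function.Injective (csEn S) := by
  intro i j h
  exact S.equivFin.symm.injective (Subtype.ext h)

lemma CsGPf.gp {S : Finset ℂ} (hS : CsGPf S) : CsGP (csEn S) := by
  classical
  have hi := csEn_inj S
  refine ⟨hi, ?_, ?_⟩
  · intro i j k hij hik hjk h
    refine hS.1 {csEn S i, csEn S j, csEn S k} ?_ ?_ ⟨Complex.I * (starRingEnd ℂ) (csEn S j - csEn S i), ?_,
       (csEn S i * (Complex.I * (starRingEnd ℂ) (csEn S j - csEn S i))).re, ?_⟩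
    · intro z hz
      simp only [Finset.mem_insert, Finset.mem_singleton] at hz
      rcases hz with rfl | rfl | rfl <;> exact csEn_mem S _
    · exact Finset.card_eq_three.2 ⟨_, _, _, hi.ne hij, hi.ne hik, hi.ne hjk, rfl⟩
    · exact mul_ne_zero Complex.I_ne_zero ((map_ne_zero _).2 (sub_ne_zero.2 (hi.ne hij.symm)))
    · intro z hz
      simp only [Finset.mem_insert, Finset.mem_singleton] at hz
      rcases hz with rfl | rfl | rfl
      · rfl
      · exact cs_cr_line (csCr_right _ _)
      · exact cs_cr_line h
  · rintro i j k l hij hik hil hjk hjl hkl c ⟨h1, h2, h3⟩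
    refine hS.2 {csEn S i, csEn S j, csEn S k, csEn S l} ?_ ?_ ⟨c, dist c (csEn S i), ?_⟩
    · intro z hz
      simp only [Finset.mem_insert, Finset.mem_singleton] at hz
      rcases hz with rfl | rfl | rfl | rfl <;> exact csEn_mem S _
    · rw [Finset.card_insert_of_notMem, Finset.card_insert_of_notMem, Finset.card_insert_of_notMem, Finset.card_singleton]
      all_goals simp [hi.ne hij, hi.ne hik, hi.ne hil, hi.ne hjk, hi.ne hjl, hi.ne hkl]
    · intro z hz
      simp only [Finset.mem_insert, Finset.mem_singleton] at hz
      rcases hz with rfl | rfl | rfl | rfl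
      · rfl
      · exact h1.symm
      · exact h2.symm
      · exact h3.symm

/-- union of closed discs around a finset -/
def csU (S : Finset ℂ) (t : ℝ) : Set ℂ := ⋃ z ∈ S, closedBall z t

lemma csA_en (S : Finset ℂ) (t : ℝ) : csA (csEn S) t = csU S t := by
  ext y
  simp only [csA, csU, mem_iUnion]
  constructor
  · rintro ⟨i, h⟩; exact ⟨_, csEn_mem S i, h⟩
  · rintro ⟨z, hz, h⟩; obtain ⟨i, rfl⟩ := csEn_surj S hz; exact ⟨i, h⟩

lemma mem_csU {S : Finset ℂ} {t : ℝ} {y : ℂ} : y ∈ csU S t ↔ ∃ z ∈ S, dist y z ≤ t := by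
  simp [csU]

lemma csU_closed (S : Finset ℂ) (t : ℝ) : IsClosed (csU S t) :=
  S.finite_toSet.isClosed_biUnion fun _ _ => isClosed_closedBall

lemma csU_compact (S : Finset ℂ) (t : ℝ) : IsCompact (csU S t) :=
  S.finite_toSet.isCompact_biUnion fun z _ => isCompact_closedBall z t

lemma csU_fin (S : Finset ℂ) (t : ℝ) : volume (csU S t) ≠ ⊤ := (csU_compact S t).measure_lt_top.ne

lemma csU_mono (S : Finset ℂ) {s t : ℝ} (h : s ≤ t) : csU S s ⊆ csU S t :=
  iUnion₂_mono fun _ _ => closedBall_subset_closedBall h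

/-- summary of Parts III and IV -/
theorem cs_GH {S : Finset ℂ} (hS : CsGPf S) (hne : S.Nonempty) : ∃ l : ℝ → ℝ, ContinuousOn l (Ioi 0) ∧
    (∀ s t, 0 < s → s ≤ t → (volume (csU S t)).toReal - (volume (csU S s)).toReal = ∫ u in s..t, l u) ∧
    (∀ (b : ℕ) (t1 t2 : ℝ), 0 < t1 → t1 ≤ t2 → (∀ t ∈ Ioo t1 t2, IsPreconnected (csU S t)) →
      (∀ t ∈ Ioo t1 t2, ∃ (U : Fin b → Set ℂ) (y : Fin b → ℂ), (∀ a, IsOpen (U a)) ∧ (∀ a, Bornology.IsBounded (U a)) ∧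
        (∀ a, frontier (U a) ⊆ csU S t) ∧ (∀ a, y a ∈ U a) ∧ (∀ a, y a ∉ csU S t) ∧
        (∀ a a', a ≠ a' → y a' ∉ closure (U a))) →
      l t2 - l t1 ≤ 2 * Real.pi * (1 - b) * (t2 - t1)) := by
  refine ⟨csEll (csEn S), csEll_cont _, fun s t hs hst => ?_, fun b t1 t2 h1 h12 hA hU => ?_⟩
  · rw [← csA_en, ← csA_en]; exact cs_W_sub hS.gp hs hst
  · simp only [← csA_en] at hA hU
    exact cs_growth hS.gp (Finset.card_pos.2 hne) h1 h12 hA hU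

/-! ## Volume growth of parallel sets of connected compact sets -/

lemma cs_int_le {l : ℝ → ℝ} (hl : ContinuousOn l (Ioi 0)) {a b τ : ℝ} (ha : 0 < a) (hab : a ≤ b) (k : ℝ) (c : ℝ)
    (h : ∀ u ∈ Icc a b, l u ≤ c + k * (u - τ)) :
    ∫ u in a..b, l u ≤ c * (b - a) + k * ((b - τ) ^ 2 - (a - τ) ^ 2) / 2 := by
  have h1 : ∫ u in a..b, l u ≤ ∫ u in a..b, (c + k * (u - τ)) := by
    refine intervalIntegral.integral_mono_on hab ?_ ?_ h
    · refine ContinuousOn.intervalIntegrable (hl.mono fun u hu => ?_)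
      rw [uIcc_of_le hab] at hu; exact ha.trans_le hu.1
    · apply Continuous.intervalIntegrable; fun_prop
  refine h1.trans_eq ?_
  have : ∀ u ∈ uIcc a b, HasDerivAt (fun u => c * u + k * (u - τ) ^ 2 / 2) (c + k * (u - τ)) u := by
    intro u _
    have h2 := ((hasDerivAt_id u).const_mul c).add (((((hasDerivAt_id u).sub_const τ).pow 2).const_mul k).div_const 2)
    refine h2.congr_deriv ?_
    simp; ring
  rw [intervalIntegral.integral_eq_sub_of_hasDerivAt this (by apply Continuous.intervalIntegrable; fun_prop)]
  ring

lemma cs_le_int {l : ℝ → ℝ} (hl : ContinuousOn l (Ioi 0)) {a b τ : ℝ} (ha : 0 < a) (hab : a ≤ b) (k : ℝ) (c : ℝ)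
    (h : ∀ u ∈ Icc a b, c + k * (u - τ) ≤ l u) :
    c * (b - a) + k * ((b - τ) ^ 2 - (a - τ) ^ 2) / 2 ≤ ∫ u in a..b, l u := by
  have := cs_int_le (l := fun u => - l u) hl.neg ha hab (τ := τ) (-k) (-c) (fun u hu => by have := h u hu; linarith)
  rw [intervalIntegral.integral_neg] at this
  linarith

lemma cs_U_conn {Z : Set ℂ} (hZ : IsConnected Z) {S : Finset ℂ} {κ t : ℝ} (hκ : κ ≤ t)
    (h1 : ∀ z ∈ S, ∃ d ∈ Z, dist z d < κ) (h2 : ∀ d ∈ Z, ∃ z ∈ S, dist d z < κ) : IsPreconnected (csU S t) := by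
  have : csU S t = ⋃₀ ((fun z => Z ∪ closedBall z t) '' (S : Set ℂ)) := by
    ext y
    simp only [mem_csU, sUnion_image, mem_iUnion]
    constructor
    · rintro ⟨z, hz, h⟩; exact ⟨z, hz, Or.inr h⟩
    · rintro ⟨z, hz, h | h⟩
      · obtain ⟨w, hw, h'⟩ := h2 y h; exact ⟨w, hw, by linarith⟩
      · exact ⟨z, hz, h⟩
  rw [this]
  obtain ⟨p, hp⟩ := hZ.nonempty
  refine isPreconnected_sUnion p _ ?_ ?_
  · rintro _ ⟨z, _, rfl⟩; exact Or.inl hp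
  · rintro _ ⟨z, hz, rfl⟩
    obtain ⟨d, hd, h⟩ := h1 z hz
    exact IsPreconnected.union d hd (by rw [mem_closedBall, dist_comm]; linarith) hZ.isPreconnected
      (convex_closedBall z t).isPreconnected

lemma cs_cth_fin {Z : Set ℂ} (hZ : IsCompact Z) (t : ℝ) : volume (cthickening t Z) ≠ ⊤ :=
  hZ.isBounded.cthickening.measure_lt_top.ne

lemma cs_cth_mono {Z : Set ℂ} (hZ : IsCompact Z) {s t : ℝ} (h : s ≤ t) :
    (volume (cthickening s Z)).toReal ≤ (volume (cthickening t Z)).toReal :=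
  ENNReal.toReal_mono (cs_cth_fin hZ t) (measure_mono (cthickening_mono h Z))

lemma cs_S_pre {Z : Set ℂ} (hZc : IsCompact Z) (hZ : IsConnected Z) {τ σ κ : ℝ} (hσ : 0 < σ) (hκ : 0 < κ) (hκτ : κ < τ) :
    (τ - κ) * ((volume (cthickening (τ + σ) Z)).toReal - (volume (cthickening (τ + κ) Z)).toReal) ≤
      (σ + κ) * ((volume (cthickening (τ + κ) Z)).toReal - (volume Z).toReal + Real.pi * (τ - κ) ^ 2) +
        Real.pi * (σ + κ) ^ 2 * (τ - κ) := by
  obtain ⟨S, hS, h1, h2⟩ := cs_net Z hZc hκ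
  have hne : S.Nonempty := by
    obtain ⟨p, hp⟩ := hZ.nonempty
    obtain ⟨z, hz, -⟩ := h2 p hp; exact ⟨z, hz⟩
  obtain ⟨l, hl, hW, hg⟩ := cs_GH hS hne
  have hg0 : ∀ t1 t2, κ ≤ t1 → t1 ≤ t2 → l t2 - l t1 ≤ 2 * Real.pi * (t2 - t1) := by
    intro t1 t2 h h12
    have := hg 0 t1 t2 (hκ.trans_le h) h12 (fun t ht => cs_U_conn hZ (h.trans ht.1.le) h1 h2)
      (fun t ht => ⟨fun a => a.elim0, fun a => a.elim0, fun a => a.elim0, fun a => a.elim0, fun a => a.elim0, fun a => a.elim0, fun a => a.elim0, fun a => a.elim0⟩)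
    simpa using this
  have i1 := hW τ (τ + σ + κ) (by linarith) (by linarith)
  have i2 := hW κ τ hκ hκτ.le
  have j1 := cs_int_le hl (a := τ) (b := τ + σ + κ) (τ := τ) (by linarith) (by linarith) (2 * Real.pi) (l τ)
    (fun u hu => by have := hg0 τ u hκτ.le hu.1; linarith)
  have j2 := cs_le_int hl (a := κ) (b := τ) (τ := τ) hκ hκτ.le (2 * Real.pi) (l τ)
    (fun u hu => by have := hg0 u τ hu.1 hu.2; linarith)
  have m1 : (volume (cthickening (τ + σ) Z)).toReal ≤ (volume (csU S (τ + σ + κ))).toReal := by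
    refine ENNReal.toReal_mono (csU_fin _ _) (measure_mono fun y hy => ?_)
    rw [hZc.cthickening_eq_biUnion_closedBall (by linarith)] at hy
    obtain ⟨d, hd, hy⟩ := mem_iUnion₂.1 hy
    obtain ⟨z, hz, h⟩ := h2 d hd
    rw [mem_closedBall] at hy
    exact mem_csU.2 ⟨z, hz, by linarith [dist_triangle y d z]⟩
  have m2 : (volume (csU S τ)).toReal ≤ (volume (cthickening (τ + κ) Z)).toReal := by
    refine ENNReal.toReal_mono (cs_cth_fin hZc _) (measure_mono fun y hy => ?_)
    obtain ⟨z, hz, h⟩ := mem_csU.1 hy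
    obtain ⟨d, hd, h'⟩ := h1 z hz
    exact mem_cthickening_of_dist_le y d _ Z hd (by linarith [dist_triangle y z d])
  have m3 : (volume Z).toReal ≤ (volume (csU S κ)).toReal := by
    refine ENNReal.toReal_mono (csU_fin _ _) (measure_mono fun y hy => ?_)
    obtain ⟨z, hz, h⟩ := h2 y hy
    exact mem_csU.2 ⟨z, hz, h.le⟩
  set X1 := (volume (cthickening (τ + σ) Z)).toReal
  set X2 := (volume (cthickening (τ + κ) Z)).toReal
  set X3 := (volume Z).toReal
  set Y1 := (volume (csU S (τ + σ + κ))).toReal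
  set Y2 := (volume (csU S τ)).toReal
  set Y3 := (volume (csU S κ)).toReal
  have k1 : X1 - X2 ≤ l τ * (σ + κ) + Real.pi * (σ + κ) ^ 2 := by
    linear_combination j1 + m1 + m2 + i1
  have k2 : l τ * (τ - κ) ≤ X2 - X3 + Real.pi * (τ - κ) ^ 2 := by
    linear_combination j2 + m2 + m3 - i2
  have k3 := mul_le_mul_of_nonneg_left k1 (sub_nonneg.2 hκτ.le)
  have k4 := mul_le_mul_of_nonneg_left k2 (show 0 ≤ σ + κ by linarith)
  linear_combination k3 + k4

lemma cs_cth_tendsto {Z : Set ℂ} (hZ : IsCompact Z) {τ : ℝ} (hτ : 0 ≤ τ) :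
    Filter.Tendsto (fun κ => (volume (cthickening (τ + κ) Z)).toReal) (nhdsWithin 0 (Ioi 0))
      (nhds (volume (cthickening τ Z)).toReal) := by
  have hc : IsCompact (cthickening τ Z) := hZ.cthickening
  have h := (tendsto_measure_cthickening_of_isCompact (μ := volume) hc)
  have h2 := (ENNReal.tendsto_toReal (cs_cth_fin hZ τ)).comp (h.mono_left (nhdsWithin_le_nhds (s := Ioi 0)))
  refine h2.congr' ?_
  filter_upwards [self_mem_nhdsWithin] with κ hκ
  simp only [Function.comp]
  rw [cthickening_cthickening (le_of_lt hκ) hτ, add_comm]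

lemma cs_S_vol {Z : Set ℂ} (hZc : IsCompact Z) (hZ : IsConnected Z) {τ σ : ℝ} (hτ : 0 < τ) (hσ : 0 < σ) :
    τ * ((volume (cthickening (τ + σ) Z)).toReal - (volume (cthickening τ Z)).toReal) ≤
      σ * ((volume (cthickening τ Z)).toReal - (volume Z).toReal + Real.pi * τ ^ 2) + Real.pi * σ ^ 2 * τ := by
  have t0 : Filter.Tendsto (fun κ : ℝ => κ) (nhdsWithin 0 (Ioi 0)) (nhds 0) := nhdsWithin_le_nhds
  have t1 := cs_cth_tendsto hZc hτ.le
  have tl := (t0.const_sub τ).mul (t1.const_sub ((volume (cthickening (τ + σ) Z)).toReal))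
  have tr := ((t0.const_add σ).mul ((t1.sub_const (volume Z).toReal).add (((t0.const_sub τ).pow 2).const_mul Real.pi))).add
    ((((t0.const_add σ).pow 2).const_mul Real.pi).mul (t0.const_sub τ))
  have := le_of_tendsto_of_tendsto tl tr (by
    filter_upwards [Ioo_mem_nhdsGT hτ] with κ hκ
    exact cs_S_pre hZc hZ hσ hκ.1 hκ.2)
  simpa using this

lemma cs_level {Z : Set ℂ} (hZc : IsCompact Z) (hZ : IsConnected Z) {τ : ℝ} (hτ : 0 < τ) :
    volume (cthickening τ Z) = volume (thickening τ Z) := by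
  refine le_antisymm ?_ (measure_mono (thickening_subset_cthickening τ Z))
  have hfin : volume (thickening τ Z) ≠ ⊤ := hZc.isBounded.thickening.measure_lt_top.ne
  rw [← ENNReal.toReal_le_toReal (cs_cth_fin hZc τ) hfin]
  set V := (volume (cthickening τ Z)).toReal
  set v := (volume (thickening τ Z)).toReal
  have key : ∀ σ ∈ Ioo 0 τ, (τ - σ) * (V - v) ≤ σ * (V + Real.pi * τ ^ 2) + Real.pi * σ ^ 2 * τ := by
    intro σ hσ
    have h := cs_S_vol hZc hZ (sub_pos.2 hσ.2) hσ.1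
    rw [sub_add_cancel] at h
    have h1 : (volume (cthickening (τ - σ) Z)).toReal ≤ v :=
      ENNReal.toReal_mono hfin (measure_mono (cthickening_subset_thickening' hτ (by linarith [hσ.1]) Z))
    have h2 : (volume (cthickening (τ - σ) Z)).toReal ≤ V := cs_cth_mono hZc (by linarith [hσ.1])
    have h3 : 0 ≤ (volume Z).toReal := ENNReal.toReal_nonneg
    have hp := Real.pi_pos
    have hs := hσ.1
    have ht := hσ.2
    have e1 : (τ - σ) * (V - v) ≤ (τ - σ) * (V - (volume (cthickening (τ - σ) Z)).toReal) :=
      mul_le_mul_of_nonneg_left (by linarith) (by linarith)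
    have e2 : Real.pi * (τ - σ) ^ 2 ≤ Real.pi * τ ^ 2 := by gcongr <;> linarith
    have e3 : Real.pi * σ ^ 2 * (τ - σ) ≤ Real.pi * σ ^ 2 * τ := by gcongr; linarith
    have e4 : σ * ((volume (cthickening (τ - σ) Z)).toReal - (volume Z).toReal + Real.pi * (τ - σ) ^ 2) ≤ σ * (V + Real.pi * τ ^ 2) := by
      gcongr; linarith
    linarith
  have t0 : Filter.Tendsto (fun κ : ℝ => κ) (nhdsWithin 0 (Ioi 0)) (nhds 0) := nhdsWithin_le_nhds
  have := le_of_tendsto_of_tendsto ((t0.const_sub τ).mul_const (V - v))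
    ((t0.mul_const (V + Real.pi * τ ^ 2)).add (((t0.pow 2).const_mul Real.pi).mul_const τ)) (by
      filter_upwards [Ioo_mem_nhdsGT hτ] with κ hκ
      exact key κ hκ)
  simp at this
  nlinarith

/-- estimate (S) -/
lemma cs_S {Z : Set ℂ} (hZc : IsCompact Z) (hZ : IsConnected Z) {τ σ : ℝ} (hτ : 0 < τ) (hσ : 0 < σ) :
    (volume (thickening (τ + σ) Z)).toReal ≤ (volume (thickening τ Z)).toReal +
      ((volume (thickening τ Z)).toReal - (volume Z).toReal + Real.pi * τ ^ 2) / τ * σ + Real.pi * σ ^ 2 := by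
  have h := cs_S_vol hZc hZ hτ hσ
  have h1 : (volume (thickening (τ + σ) Z)).toReal ≤ (volume (cthickening (τ + σ) Z)).toReal :=
    ENNReal.toReal_mono (cs_cth_fin hZc _) (measure_mono (thickening_subset_cthickening _ _))
  rw [cs_level hZc hZ hτ] at h
  refine h1.trans ?_
  have : τ * (volume (cthickening (τ + σ) Z)).toReal ≤ τ * ((volume (thickening τ Z)).toReal +
      ((volume (thickening τ Z)).toReal - (volume Z).toReal + Real.pi * τ ^ 2) / τ * σ + Real.pi * σ ^ 2) := by
    have e : τ * ((volume (thickening τ Z)).toReal +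
      ((volume (thickening τ Z)).toReal - (volume Z).toReal + Real.pi * τ ^ 2) / τ * σ + Real.pi * σ ^ 2) =
      τ * (volume (thickening τ Z)).toReal +
      ((volume (thickening τ Z)).toReal - (volume Z).toReal + Real.pi * τ ^ 2) * σ + τ * (Real.pi * σ ^ 2) := by
      field_simp
    rw [e]; linarith
  exact le_of_mul_le_mul_left this hτ

/-! ## Approximation of sets of finite perimeter by complements of unions of discs -/

noncomputable def csL (S : Finset ℂ) : ℝ → ℝ := csEll (csEn S)

lemma csL_cont (S : Finset ℂ) : ContinuousOn (csL S) (Ioi 0) := csEll_cont _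

lemma csL_W {S : Finset ℂ} (hS : CsGPf S) {s t : ℝ} (hs : 0 < s) (hst : s ≤ t) :
    (volume (csU S t)).toReal - (volume (csU S s)).toReal = ∫ u in s..t, csL S u := by
  rw [← csA_en, ← csA_en]; exact cs_W_sub hS.gp hs hst

lemma csL_growth {S : Finset ℂ} (hS : CsGPf S) (hne : S.Nonempty) (b : ℕ) {t1 t2 : ℝ} (h1 : 0 < t1) (h12 : t1 ≤ t2)
    (hA : ∀ t ∈ Ioo t1 t2, IsPreconnected (csU S t))
    (hU : ∀ t ∈ Ioo t1 t2, ∃ (U : Fin b → Set ℂ) (y : Fin b → ℂ), (∀ a, IsOpen (U a)) ∧ (∀ a, Bornology.IsBounded (U a)) ∧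
        (∀ a, frontier (U a) ⊆ csU S t) ∧ (∀ a, y a ∈ U a) ∧ (∀ a, y a ∉ csU S t) ∧
        (∀ a a', a ≠ a' → y a' ∉ closure (U a))) :
    csL S t2 - csL S t1 ≤ 2 * Real.pi * (1 - b) * (t2 - t1) := by
  simp only [← csA_en] at hA hU
  exact cs_growth hS.gp (Finset.card_pos.2 hne) h1 h12 hA hU

lemma cs_ball_vol (a : ℂ) {ρ : ℝ} (hρ : 0 ≤ ρ) : (volume (ball a ρ)).toReal = Real.pi * ρ ^ 2 := by
  rw [Complex.volume_ball]
  simp [ENNReal.toReal_ofReal hρ, mul_comm]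

lemma cs_cball_vol (a : ℂ) {ρ : ℝ} (hρ : 0 ≤ ρ) : (volume (closedBall a ρ)).toReal = Real.pi * ρ ^ 2 := by
  rw [Complex.volume_closedBall]
  simp [ENNReal.toReal_ofReal hρ, mul_comm]

/-- choose a good net and a good radius -/
lemma cs_B1 {R t1 q ε : ℝ} (hR : 0 < R) (ht1 : 0 < t1) (hε : 0 < ε) {X : Set ℂ} (hX : IsOpen X) (hq : 0 ≤ q)
    (hXR : X ⊆ ball 0 R)
    (hlay : (volume {x | x ∈ X ∧ ∃ y ∉ X, dist x y ≤ t1}).toReal ≤ t1 * q) :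
    ∃ (κ t0 : ℝ) (S : Finset ℂ), 0 < κ ∧ κ < t0 ∧ t0 + κ < t1 ∧ κ < ε ∧ CsGPf S ∧
      (∀ z ∈ S, ∃ d ∈ Xᶜ ∩ closedBall 0 R, dist z d < κ) ∧ (∀ d ∈ Xᶜ ∩ closedBall 0 R, ∃ z ∈ S, dist d z < κ) ∧
      csL S t0 ≤ q + 2 * Real.pi * R + Real.pi * t1 + ε := by
  set Q := q + 2 * Real.pi * R + Real.pi * t1 with hQ
  have hpi := Real.pi_pos
  have hQ0 : 0 < Q := by positivity
  obtain ⟨κ, hκ0, hκ1, hκ2, hκ3⟩ : ∃ κ, 0 < κ ∧ κ < ε ∧ 4 * κ ≤ t1 ∧ 4 * κ * (Q + ε) ≤ t1 * ε := by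
    refine ⟨min (ε / 2) (min (t1 / 4) (t1 * ε / (4 * (Q + ε)))), by positivity, ?_, ?_, ?_⟩
    · exact (min_le_left _ _).trans_lt (by linarith)
    · have := (min_le_right (ε / 2) (min (t1 / 4) (t1 * ε / (4 * (Q + ε))))).trans (min_le_left _ _)
      linarith
    · have := (min_le_right (ε / 2) (min (t1 / 4) (t1 * ε / (4 * (Q + ε))))).trans (min_le_right _ _)
      rw [le_div_iff₀ (by positivity)] at this
      linarith
  have hD : IsCompact (Xᶜ ∩ closedBall (0:ℂ) R) := (isCompact_closedBall 0 R).inter_left hX.isClosed_compl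
  obtain ⟨S, hS, h1, h2⟩ := cs_net _ hD hκ0
  have hW := csL_W hS hκ0 (show κ ≤ t1 - κ by linarith)
  have hsub : csU S (t1 - κ) ⊆ (csU S κ ∪ {x | x ∈ X ∧ ∃ y ∉ X, dist x y ≤ t1}) ∪ (closedBall 0 (R + t1) \ closedBall 0 R) := by
    intro y hy
    obtain ⟨z, hz, hyz⟩ := mem_csU.1 hy
    obtain ⟨d, hd, hzd⟩ := h1 z hz
    have hyd : dist y d ≤ t1 := by linarith [dist_triangle y z d]
    by_cases hyR : y ∈ closedBall (0:ℂ) R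
    · left
      by_cases hyX : y ∈ X
      · right; exact ⟨hyX, d, hd.1, hyd⟩
      · left
        obtain ⟨w, hw, h⟩ := h2 y ⟨hyX, hyR⟩
        exact mem_csU.2 ⟨w, hw, h.le⟩
    · right
      refine ⟨?_, hyR⟩
      have := hd.2
      rw [mem_closedBall] at this ⊢
      linarith [dist_triangle y d 0]
  have hlfin : volume {x | x ∈ X ∧ ∃ y ∉ X, dist x y ≤ t1} ≠ ⊤ :=
    ((isBounded_ball.subset hXR).subset (fun x hx => hx.1)).measure_lt_top.ne
  have hrfin : volume (closedBall (0:ℂ) (R + t1) \ closedBall 0 R) ≠ ⊤ :=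
    (isBounded_closedBall.subset diff_subset).measure_lt_top.ne
  have hring : (volume (closedBall (0:ℂ) (R + t1) \ closedBall 0 R)).toReal = Real.pi * (R + t1) ^ 2 - Real.pi * R ^ 2 := by
    rw [measure_diff (closedBall_subset_closedBall (by linarith)) measurableSet_closedBall.nullMeasurableSet isBounded_closedBall.measure_lt_top.ne,
      ENNReal.toReal_sub_of_le (measure_mono (closedBall_subset_closedBall (by linarith))) isBounded_closedBall.measure_lt_top.ne,
      cs_cball_vol _ (by linarith), cs_cball_vol _ hR.le]
  have hWle : (volume (csU S (t1 - κ))).toReal ≤ (volume (csU S κ)).toReal + t1 * q + (Real.pi * (R + t1) ^ 2 - Real.pi * R ^ 2) := by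
    have a1 := ENNReal.toReal_mono (by finiteness [csU_fin S κ]) ((measure_mono hsub).trans ((measure_union_le _ _).trans (add_le_add_left (measure_union_le _ _) _)))
    rw [ENNReal.toReal_add (by finiteness [csU_fin S κ]) hrfin, ENNReal.toReal_add (csU_fin S κ) hlfin, hring] at a1
    linarith
  have hintg : ∫ u in κ..(t1 - κ), csL S u ≤ t1 * Q := by
    rw [← hW, hQ]; linear_combination hWle
  by_contra hcon
  push Not at hcon
  have hbig : ∀ u ∈ Ioo κ (t1 - κ), Q + ε < csL S u := fun u hu =>
    hcon κ u S hκ0 hu.1 (by linarith [hu.2]) hκ1 hS h1 h2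
  have hge : ∀ u ∈ Icc κ (t1 - κ), Q + ε ≤ csL S u := by
    have hc : ContinuousOn (csL S) (Icc κ (t1 - κ)) := (csL_cont S).mono fun u hu => hκ0.trans_le hu.1
    have hcl : closure (Ioo κ (t1 - κ)) = Icc κ (t1 - κ) := closure_Ioo (by linarith)
    intro u hu
    rw [← hcl] at hu hc
    exact le_on_closure (fun v hv => (hbig v hv).le) continuousOn_const hc hu
  have := cs_le_int (csL_cont S) hκ0 (show κ ≤ t1 - κ by linarith) (τ := 0) 0 (Q + ε) (fun u hu => by simpa using hge u hu)
  nlinarith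

lemma cs_ball_sub_comp {S : Finset ℂ} {t0 s : ℝ} {p z y : ℂ} (hz : z ∈ S) (hs : s ≤ t0) (hs0 : 0 ≤ s)
    (hy : y ∈ connectedComponentIn (csU S t0) p) (hyz : dist y z ≤ s) :
    z ∈ connectedComponentIn (csU S t0) p := by
  have h1 : closedBall z s ⊆ csU S t0 := fun w hw => mem_csU.2 ⟨z, hz, le_trans hw hs⟩
  have := (convex_closedBall z s).isPreconnected.subset_connectedComponentIn (x := y) hyz h1
  rw [connectedComponentIn_eq hy]
  exact this (mem_closedBall_self hs0)

open Classical in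
noncomputable def csComp (S : Finset ℂ) (t0 : ℝ) (p : ℂ) : Finset ℂ :=
  S.filter (fun z => z ∈ connectedComponentIn (csU S t0) p)

lemma mem_csComp {S : Finset ℂ} {t0 : ℝ} {p z : ℂ} :
    z ∈ csComp S t0 p ↔ z ∈ S ∧ z ∈ connectedComponentIn (csU S t0) p := by
  simp [csComp]

lemma csComp_U {S : Finset ℂ} {t0 : ℝ} {p : ℂ} (ht : 0 ≤ t0) :
    csU (csComp S t0 p) t0 = connectedComponentIn (csU S t0) p := by
  ext y
  rw [mem_csU]
  constructor
  · rintro ⟨z, hz, h⟩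
    obtain ⟨hz, hzc⟩ := mem_csComp.1 hz
    have h1 : closedBall z t0 ⊆ csU S t0 := fun w hw => mem_csU.2 ⟨z, hz, hw⟩
    have := (convex_closedBall z t0).isPreconnected.subset_connectedComponentIn (x := z) (mem_closedBall_self ht) h1
    rw [connectedComponentIn_eq hzc]
    exact this h
  · intro hy
    obtain ⟨z, hz, h⟩ := mem_csU.1 (connectedComponentIn_subset _ _ hy)
    exact ⟨z, mem_csComp.2 ⟨hz, cs_ball_sub_comp hz le_rfl ht hy h⟩, h⟩

lemma csComp_conn {S : Finset ℂ} {t0 t : ℝ} {p : ℂ} (ht : 0 ≤ t0) (hp : p ∈ csU S t0) (h : t0 < t) :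
    IsPreconnected (csU (csComp S t0 p) t) := by
  refine cs_U_conn (Z := connectedComponentIn (csU S t0) p)
    (isConnected_connectedComponentIn_iff.2 hp) le_rfl ?_ ?_
  · intro z hz
    exact ⟨z, (mem_csComp.1 hz).2, by simp; linarith⟩
  · intro d hd
    rw [← csComp_U ht] at hd
    obtain ⟨z, hz, h'⟩ := mem_csU.1 hd
    exact ⟨z, hz, by linarith⟩

lemma csComp_L {S : Finset ℂ} (hS : CsGPf S) {t0 : ℝ} (p : ℂ) (ht : 0 < t0) :
    csL (csComp S t0 p) t0 ≤ csL S t0 := by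
  classical
  set A := csComp S t0 p with hA
  have hAS : A ⊆ S := fun z hz => (mem_csComp.1 hz).1
  have hGA : CsGPf A := hS.mono hAS
  set B := S \ A with hB
  have hdis : Disjoint (csU A t0) (csU B t0) := by
    rw [Set.disjoint_left]
    intro y hy hyB
    rw [hA, csComp_U ht.le] at hy
    obtain ⟨z, hz, h⟩ := mem_csU.1 hyB
    rw [hB, Finset.mem_sdiff] at hz
    exact hz.2 (mem_csComp.2 ⟨hz.1, cs_ball_sub_comp hz.1 le_rfl ht.le hy h⟩)
  obtain ⟨δ, hδ, hdt⟩ := hdis.exists_thickenings (csU_compact A t0) (csU_closed B t0)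
  have hsub : ∀ T : Finset ℂ, ∀ t, t0 ≤ t → t < t0 + δ → csU T t ⊆ thickening δ (csU T t0) := by
    intro T t h0 h y hy
    obtain ⟨z, hz, hyz⟩ := mem_csU.1 hy
    rw [mem_thickening_iff]
    by_cases hc : dist y z ≤ t0
    · exact ⟨y, mem_csU.2 ⟨z, hz, hc⟩, by simpa using hδ⟩
    push Not at hc
    have hpos : 0 < dist y z := ht.trans hc
    refine ⟨z + (t0 / dist y z : ℝ) • (y - z), mem_csU.2 ⟨z, hz, ?_⟩, ?_⟩
    · rw [dist_eq_norm, add_sub_cancel_left, norm_smul, Real.norm_eq_abs, abs_of_pos (by positivity), ← dist_eq_norm]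
      rw [div_mul_cancel₀ _ hpos.ne']
    · have : y - (z + (t0 / dist y z : ℝ) • (y - z)) = (1 - t0 / dist y z : ℝ) • (y - z) := by
        rw [sub_smul, one_smul]; ring
      rw [dist_eq_norm, this, norm_smul, Real.norm_eq_abs, ← dist_eq_norm, abs_of_nonneg, sub_mul, div_mul_cancel₀ _ hpos.ne']
      · linarith
      · rw [sub_nonneg, div_le_one hpos]; exact hc.le
  have hUS : ∀ t, csU S t = csU A t ∪ csU B t := by
    intro t; ext y
    simp only [mem_union, mem_csU, hB, Finset.mem_sdiff]
    constructor
    · rintro ⟨z, hz, h⟩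
      by_cases hzA : z ∈ A
      · exact Or.inl ⟨z, hzA, h⟩
      · exact Or.inr ⟨z, ⟨hz, hzA⟩, h⟩
    · rintro (⟨z, hz, h⟩ | ⟨z, hz, h⟩)
      · exact ⟨z, hAS hz, h⟩
      · exact ⟨z, hz.1, h⟩
  have hWS : ∀ t, t0 ≤ t → t < t0 + δ → (volume (csU S t)).toReal = (volume (csU A t)).toReal + (volume (csU B t)).toReal := by
    intro t h0 h
    rw [hUS, measure_union (hdt.mono (hsub A t h0 h) (hsub B t h0 h)) (csU_closed B t).measurableSet,
      ENNReal.toReal_add (csU_fin _ _) (csU_fin _ _)]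
  have hintg : ∀ t, t0 ≤ t → t < t0 + δ → ∫ u in t0..t, csL A u ≤ ∫ u in t0..t, csL S u := by
    intro t h0 h
    rw [← csL_W hGA ht h0, ← csL_W hS ht h0, hWS t h0 h, hWS t0 le_rfl (by linarith)]
    have : (volume (csU B t0)).toReal ≤ (volume (csU B t)).toReal := ENNReal.toReal_mono (csU_fin _ _) (measure_mono (csU_mono _ h0))
    linarith
  by_contra hlt
  push Not at hlt
  have hcA : ContinuousAt (csL A) t0 := (csL_cont A).continuousAt (Ioi_mem_nhds ht)
  have hcS : ContinuousAt (csL S) t0 := (csL_cont S).continuousAt (Ioi_mem_nhds ht)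
  have hev : ∀ᶠ u in nhds t0, csL S u < csL A u := hcS.eventually_lt hcA hlt
  obtain ⟨η, hη, hball⟩ := Metric.eventually_nhds_iff.1 hev
  set t := t0 + min (δ / 2) (η / 2) with htd
  have hm : 0 < min (δ / 2) (η / 2) := by positivity
  have hm1 := min_le_left (δ / 2) (η / 2)
  have hm2 := min_le_right (δ / 2) (η / 2)
  have hlt2 : ∫ u in t0..t, csL S u < ∫ u in t0..t, csL A u := by
    refine intervalIntegral.integral_lt_integral_of_continuousOn_of_le_of_exists_lt (by linarith) ?_ ?_ ?_ ?_
    · exact (csL_cont S).mono fun u hu => ht.trans_le hu.1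
    · exact (csL_cont A).mono fun u hu => ht.trans_le hu.1
    · intro u hu
      exact (hball (by rw [Real.dist_eq, abs_of_pos (by linarith [hu.1])]; linarith [hu.2])).le
    · exact ⟨t0, ⟨le_rfl, by linarith⟩, hlt⟩
  exact absurd (hintg t (by linarith) (by linarith)) (not_le.2 hlt2)

structure CsAp (A : Finset ℂ) (R t0 κ : ℝ) : Prop where
  gp : CsGPf A
  R0 : 0 < R
  k0 : 0 < κ
  kt : κ < t0
  conn : ∀ t, t0 < t → IsPreconnected (csU A t)
  ring : ∀ t, t0 ≤ t → ∀ y : ℂ, R / 2 ≤ ‖y‖ → ‖y‖ ≤ R + t - κ → y ∈ csU A t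
  bdd : ∀ z ∈ A, ‖z‖ ≤ R + κ

def csHole (A : Finset ℂ) (R t : ℝ) : Set ℂ := ball 0 R \ csU A t

lemma csHole_open (A : Finset ℂ) (R t : ℝ) : IsOpen (csHole A R t) := isOpen_ball.sdiff (csU_closed A t)

lemma csHole_fin (A : Finset ℂ) (R t : ℝ) : volume (csHole A R t) ≠ ⊤ :=
  (isBounded_ball.subset diff_subset).measure_lt_top.ne

lemma CsAp.ne {A : Finset ℂ} {R t0 κ : ℝ} (h : CsAp A R t0 κ) : A.Nonempty := by
  have := h.ring t0 le_rfl (R : ℂ) (by simp; rw [abs_of_pos h.R0]; linarith [h.R0]) (by simp; rw [abs_of_pos h.R0]; linarith [h.kt])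
  obtain ⟨z, hz, -⟩ := mem_csU.1 this
  exact ⟨z, hz⟩

lemma CsAp.front {A : Finset ℂ} {R t0 κ t : ℝ} (h : CsAp A R t0 κ) (ht : t0 ≤ t) :
    frontier (csHole A R t) ⊆ csU A t := by
  intro y hy
  rw [(csHole_open A R t).frontier_eq] at hy
  by_contra hn
  have h1 : y ∈ closedBall (0:ℂ) R := closure_ball_subset_closedBall (closure_mono diff_subset hy.1)
  rw [mem_closedBall, dist_zero_right] at h1
  rcases h1.lt_or_eq with h2 | h2
  · exact hy.2 ⟨by simpa using h2, hn⟩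
  · exact hn (h.ring t ht y (by rw [h2]; linarith [h.R0]) (by rw [h2]; linarith [h.kt]))

lemma CsAp.area {A : Finset ℂ} {R t0 κ t P η m : ℝ} (h : CsAp A R t0 κ) (ht : t0 ≤ t) (hP : 0 ≤ P) (hη : 0 ≤ η)
    (hI : ∫ u in t0..t, csL A u ≤ (t - t0) * (P + 2 * Real.pi * R + η) - m) :
    (volume (csHole A R t0)).toReal - t * P + Real.pi * t ^ 2 + m -
      (t * η + Real.pi * t0 ^ 2 + 4 * Real.pi * R * κ + 2 * Real.pi * κ * (t + t0)) ≤ (volume (csHole A R t)).toReal := by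
  have hpi := Real.pi_pos
  have hR := h.R0; have hκ := h.k0; have hkt := h.kt
  rw [← csL_W h.gp (by linarith) ht] at hI
  have dec : ∀ s, t0 ≤ s → (volume (csU A s)).toReal = Real.pi * R ^ 2 - (volume (csHole A R s)).toReal + (volume (csU A s \ ball 0 R)).toReal := by
    intro s hs
    have e1 : (volume (csU A s)).toReal = (volume (csU A s ∩ ball 0 R)).toReal + (volume (csU A s \ ball 0 R)).toReal := by
      rw [← ENNReal.toReal_add (ne_top_of_le_ne_top (csU_fin A s) (measure_mono inter_subset_left)) (ne_top_of_le_ne_top (csU_fin A s) (measure_mono diff_subset)),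
        measure_inter_add_diff _ measurableSet_ball]
    have e2 : (volume (ball (0:ℂ) R)).toReal = (volume (csU A s ∩ ball 0 R)).toReal + (volume (csHole A R s)).toReal := by
      rw [← ENNReal.toReal_add (ne_top_of_le_ne_top (csU_fin A s) (measure_mono inter_subset_left)) (csHole_fin A R s), inter_comm,
        csHole, measure_inter_add_diff _ (csU_closed A s).measurableSet]
    rw [cs_ball_vol _ hR.le] at e2
    linarith
  have up : (volume (csU A t0 \ ball 0 R)).toReal ≤ Real.pi * (R + κ + t0) ^ 2 - Real.pi * R ^ 2 := by
    have hs : ball (0:ℂ) R ⊆ closedBall 0 (R + κ + t0) := fun y hy => by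
      rw [mem_ball] at hy; rw [mem_closedBall]; linarith
    rw [← cs_cball_vol 0 (show 0 ≤ R + κ + t0 by linarith), ← cs_ball_vol 0 hR.le,
      ← ENNReal.toReal_sub_of_le (measure_mono hs) isBounded_closedBall.measure_lt_top.ne,
      ← measure_diff hs measurableSet_ball.nullMeasurableSet isBounded_ball.measure_lt_top.ne]
    refine ENNReal.toReal_mono (isBounded_closedBall.subset diff_subset).measure_lt_top.ne (measure_mono fun y hy => ⟨?_, hy.2⟩)
    obtain ⟨z, hz, hyz⟩ := mem_csU.1 hy.1
    have := h.bdd z hz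
    rw [mem_closedBall]
    have h3 := dist_triangle y z 0
    rw [dist_zero_right z] at h3
    linarith
  have lo : Real.pi * (R + t - κ) ^ 2 - Real.pi * R ^ 2 ≤ (volume (csU A t \ ball 0 R)).toReal := by
    have hs : ball (0:ℂ) R ⊆ closedBall 0 (R + t - κ) := fun y hy => by
      rw [mem_ball] at hy; rw [mem_closedBall]; linarith
    rw [← cs_cball_vol 0 (show 0 ≤ R + t - κ by linarith), ← cs_ball_vol 0 hR.le,
      ← ENNReal.toReal_sub_of_le (measure_mono hs) isBounded_closedBall.measure_lt_top.ne,
      ← measure_diff hs measurableSet_ball.nullMeasurableSet isBounded_ball.measure_lt_top.ne]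
    refine ENNReal.toReal_mono (ne_top_of_le_ne_top (csU_fin A t) (measure_mono diff_subset)) (measure_mono fun y hy => ⟨?_, hy.2⟩)
    have h1 := hy.1; have h2 := hy.2
    rw [mem_closedBall, dist_zero_right] at h1
    rw [mem_ball, dist_zero_right, not_lt] at h2
    exact h.ring t ht y (by linarith) h1
  have d1 := dec t ht
  have d2 := dec t0 le_rfl
  have x1 : 0 ≤ t0 * P := mul_nonneg (by linarith) hP
  have x2 : 0 ≤ t0 * η := mul_nonneg (by linarith) hη
  nlinarith

lemma CsAp.hole1 {A : Finset ℂ} {R t0 κ t : ℝ} (h : CsAp A R t0 κ) (ht : t0 ≤ t) (hne : (csHole A R t).Nonempty) :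
    ∃ (U : Fin 1 → Set ℂ) (y : Fin 1 → ℂ), (∀ a, IsOpen (U a)) ∧ (∀ a, Bornology.IsBounded (U a)) ∧
        (∀ a, frontier (U a) ⊆ csU A t) ∧ (∀ a, y a ∈ U a) ∧ (∀ a, y a ∉ csU A t) ∧
        (∀ a a', a ≠ a' → y a' ∉ closure (U a)) := by
  obtain ⟨y, hy⟩ := hne
  exact ⟨fun _ => csHole A R t, fun _ => y, fun _ => csHole_open A R t, fun _ => isBounded_ball.subset diff_subset,
    fun _ => h.front ht, fun _ => hy, fun _ => hy.2, fun a a' haa => absurd (Subsingleton.elim a a') haa⟩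

lemma CsAp.hole2 {A : Finset ℂ} {R t0 κ t : ℝ} (h : CsAp A R t0 κ) (ht : t0 ≤ t) (hne : ¬ IsPreconnected (csHole A R t)) :
    ∃ (U : Fin 2 → Set ℂ) (y : Fin 2 → ℂ), (∀ a, IsOpen (U a)) ∧ (∀ a, Bornology.IsBounded (U a)) ∧
        (∀ a, frontier (U a) ⊆ csU A t) ∧ (∀ a, y a ∈ U a) ∧ (∀ a, y a ∉ csU A t) ∧
        (∀ a a', a ≠ a' → y a' ∉ closure (U a)) := by
  set F := csHole A R t with hF
  have hFo : IsOpen F := csHole_open A R t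
  unfold IsPreconnected at hne
  push Not at hne
  obtain ⟨u, v, hu, hv, huv, ⟨y0, h0⟩, ⟨y1, h1⟩, hemp⟩ := hne
  have hd : ∀ w, w ∈ F → w ∈ u → w ∉ v := fun w a b c => by
    have : w ∈ F ∩ (u ∩ v) := ⟨a, b, c⟩
    rw [hemp] at this; exact this
  have hb : Bornology.IsBounded F := isBounded_ball.subset diff_subset
  have cl : ∀ u v : Set ℂ, IsOpen u → IsOpen v → (∀ w, w ∈ F → w ∈ u → w ∉ v) → ∀ w ∈ F ∩ v, w ∉ closure (F ∩ u) := by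
    intro u v _ hv hd w hw hc
    obtain ⟨q, hq1, hq2⟩ := mem_closure_iff.1 hc (F ∩ v) (hFo.inter hv) hw
    exact hd q hq2.1 hq2.2 hq1.2
  have fr : ∀ u v : Set ℂ, IsOpen u → IsOpen v → F ⊆ u ∪ v → (∀ w, w ∈ F → w ∈ u → w ∉ v) → frontier (F ∩ u) ⊆ csU A t := by
    intro u v hu hv huv hd w hw
    rw [(hFo.inter hu).frontier_eq] at hw
    refine h.front ht ?_
    rw [← hF, hFo.frontier_eq]
    refine ⟨closure_mono inter_subset_left hw.1, fun hwF => ?_⟩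
    rcases huv hwF with hh | hh
    · exact hw.2 ⟨hwF, hh⟩
    · exact cl u v hu hv hd w ⟨hwF, hh⟩ hw.1
  have hd' : ∀ w, w ∈ F → w ∈ v → w ∉ u := fun w a b c => hd w a c b
  refine ⟨![F ∩ u, F ∩ v], ![y0, y1], ?_, ?_, ?_, ?_, ?_, ?_⟩
  · intro a; fin_cases a
    · exact hFo.inter hu
    · exact hFo.inter hv
  · intro a; fin_cases a
    · exact hb.subset inter_subset_left
    · exact hb.subset inter_subset_left
  · intro a; fin_cases a
    · exact fr u v hu hv huv hd
    · exact fr v u hv hu (by rwa [union_comm]) hd'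
  · intro a; fin_cases a
    · exact h0
    · exact h1
  · intro a; fin_cases a
    · exact h0.1.2
    · exact h1.1.2
  · intro a a' haa
    fin_cases a <;> fin_cases a'
    · exact absurd rfl haa
    · exact cl u v hu hv hd y1 h1
    · exact cl v u hv hu hd' y0 h0
    · exact absurd rfl haa

lemma csHole_anti (A : Finset ℂ) (R : ℝ) {s t : ℝ} (h : s ≤ t) : csHole A R t ⊆ csHole A R s :=
  diff_subset_diff_right (csU_mono A h)

/-- with one hole, the length does not increase -/
lemma CsAp.len1 {A : Finset ℂ} {R t0 κ s t : ℝ} (h : CsAp A R t0 κ) (hs : t0 ≤ s) (hst : s ≤ t)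
    (hne : ∀ u ∈ Ioo s t, (csHole A R u).Nonempty) : csL A t ≤ csL A s := by
  have := csL_growth h.gp h.ne 1 (show 0 < s by linarith [h.k0, h.kt]) hst (fun u hu => h.conn u (by linarith [hu.1]))
    (fun u hu => h.hole1 (by linarith [hu.1]) (hne u hu))
  simp at this
  linarith

lemma CsAp.len2 {A : Finset ℂ} {R t0 κ s t : ℝ} (h : CsAp A R t0 κ) (hs : t0 ≤ s) (hst : s ≤ t)
    (hne : ∀ u ∈ Ioo s t, ¬ IsPreconnected (csHole A R u)) : csL A t ≤ csL A s - 2 * Real.pi * (t - s) := by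
  have := csL_growth h.gp h.ne 2 (show 0 < s by linarith [h.k0, h.kt]) hst (fun u hu => h.conn u (by linarith [hu.1]))
    (fun u hu => h.hole2 (by linarith [hu.1]) (hne u hu))
  push_cast at this
  linarith

lemma CsAp.area1 {A : Finset ℂ} {R t0 κ t P η : ℝ} (h : CsAp A R t0 κ) (ht : t0 ≤ t) (hP : 0 ≤ P) (hη : 0 ≤ η)
    (hL : csL A t0 ≤ P + 2 * Real.pi * R + η) (hne : ∀ u ∈ Ioo t0 t, (csHole A R u).Nonempty) :
    (volume (csHole A R t0)).toReal - t * P + Real.pi * t ^ 2 -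
      (t * η + Real.pi * t0 ^ 2 + 4 * Real.pi * R * κ + 2 * Real.pi * κ * (t + t0)) ≤ (volume (csHole A R t)).toReal := by
  have := h.area ht hP hη (m := 0) (by
    have := cs_int_le (csL_cont A) (show 0 < t0 by linarith [h.k0, h.kt]) ht 0 (P + 2 * Real.pi * R + η) (τ := 0) (fun u hu => by
      have := h.len1 le_rfl hu.1 (fun v hv => hne v ⟨hv.1, hv.2.trans_le hu.2⟩)
      linarith)
    linarith)
  linarith

lemma CsAp.area2 {A : Finset ℂ} {R t0 κ t P η s1 s2 : ℝ} (h : CsAp A R t0 κ) (h1 : t0 ≤ s1) (h12 : s1 ≤ s2) (h2 : s2 ≤ t)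
    (hP : 0 ≤ P) (hη : 0 ≤ η)
    (hL : csL A t0 ≤ P + 2 * Real.pi * R + η) (hne : ∀ u ∈ Ioo t0 t, (csHole A R u).Nonempty)
    (hnc : ∀ u ∈ Ioo s1 s2, ¬ IsPreconnected (csHole A R u)) :
    (volume (csHole A R t0)).toReal - t * P + Real.pi * t ^ 2 + Real.pi * (s2 - s1) ^ 2 -
      (t * η + Real.pi * t0 ^ 2 + 4 * Real.pi * R * κ + 2 * Real.pi * κ * (t + t0)) ≤ (volume (csHole A R t)).toReal := by
  have ht0 : 0 < t0 := by linarith [h.k0, h.kt]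
  have hpi := Real.pi_pos
  refine h.area (by linarith) hP hη ?_
  set Q := P + 2 * Real.pi * R + η
  have l1 : ∀ u ∈ Icc t0 s1, csL A u ≤ Q + 0 * (u - 0) := fun u hu => by
    have := h.len1 le_rfl hu.1 (fun v hv => hne v ⟨hv.1, by linarith [hv.2, hu.2]⟩)
    linarith
  have l2 : ∀ u ∈ Icc s1 s2, csL A u ≤ Q + (-(2 * Real.pi)) * (u - s1) := fun u hu => by
    have := h.len2 h1 hu.1 (fun v hv => hnc v ⟨hv.1, by linarith [hv.2, hu.2]⟩)
    have := l1 s1 ⟨h1, le_rfl⟩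
    linarith
  have l3 : ∀ u ∈ Icc s2 t, csL A u ≤ Q + 0 * (u - 0) := fun u hu => by
    have := h.len1 (h1.trans h12) hu.1 (fun v hv => hne v ⟨by linarith [hv.1], by linarith [hv.2, hu.2]⟩)
    have := l2 s2 ⟨h12, le_rfl⟩
    have : 0 ≤ 2 * Real.pi * (s2 - s1) := by have := sub_nonneg.2 h12; positivity
    linarith
  have i1 := cs_int_le (csL_cont A) ht0 h1 _ _ l1
  have i2 := cs_int_le (csL_cont A) (ht0.trans_le h1) h12 _ _ l2
  have i3 := cs_int_le (csL_cont A) (ht0.trans_le (h1.trans h12)) h2 _ _ l3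
  have ii : ∀ a b, 0 < a → a ≤ b → IntervalIntegrable (csL A) volume a b := fun a b ha hab =>
    ContinuousOn.intervalIntegrable ((csL_cont A).mono fun u hu => by rw [uIcc_of_le hab] at hu; exact ha.trans_le hu.1)
  rw [← intervalIntegral.integral_add_adjacent_intervals (ii t0 s1 ht0 h1) (ii s1 t (by linarith) (by linarith)),
    ← intervalIntegral.integral_add_adjacent_intervals (ii s1 s2 (by linarith) h12) (ii s2 t (by linarith) h2)]
  nlinarith

/-- the holes persist as long as the area bound is positive -/
lemma CsAp.persist {A : Finset ℂ} {R t0 κ r P η : ℝ} (h : CsAp A R t0 κ) (hP : 0 ≤ P) (hη : 0 ≤ η)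
    (hL : csL A t0 ≤ P + 2 * Real.pi * R + η)
    (hpos : ∀ t ∈ Icc t0 r, 0 < (volume (csHole A R t0)).toReal - t * P + Real.pi * t ^ 2 -
      (t * η + Real.pi * t0 ^ 2 + 4 * Real.pi * R * κ + 2 * Real.pi * κ * (t + t0)))
    (h0 : 0 < (volume (csHole A R t0)).toReal) :
    ∀ u ∈ Ioo t0 r, (csHole A R u).Nonempty := by
  intro u hu
  obtain ⟨y, hy, hmax⟩ := (isCompact_closedBall (0:ℂ) R).exists_isMaxOn ⟨0, by simp [h.R0.le]⟩
    (Metric.continuous_infDist_pt (A : Set ℂ)).continuousOn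
  have hAne : (A : Set ℂ).Nonempty := h.ne
  have hAc : IsCompact (A : Set ℂ) := A.finite_toSet.isCompact
  have hU : ∀ z t, z ∈ csU A t ↔ infDist z A ≤ t := by
    intro z t
    rw [mem_csU]
    constructor
    · rintro ⟨w, hw, hz⟩; exact (infDist_le_dist_of_mem (by exact_mod_cast hw)).trans hz
    · intro hz
      obtain ⟨w, hw, he⟩ := hAc.exists_infDist_eq_dist hAne z
      exact ⟨w, by exact_mod_cast hw, by rw [← he]; exact hz⟩
  have hlow : ∀ s, t0 ≤ s → s < infDist y A → (csHole A R s).Nonempty := by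
    intro s hs hsy
    have hyU : y ∉ csU A s := by rw [hU]; exact not_le.2 hsy
    refine ⟨y, ?_, hyU⟩
    rw [mem_closedBall, dist_zero_right] at hy
    rw [mem_ball, dist_zero_right]
    by_contra hc
    push Not at hc
    exact hyU (h.ring s hs y (by linarith [h.R0]) (by linarith [h.kt]))
  by_contra hemp
  have hle : infDist y A ≤ u := by
    by_contra hc; push Not at hc
    exact hemp (hlow u hu.1.le hc)
  set T := max t0 (infDist y A) with hT
  have hTe : csHole A R T = ∅ := by
    rw [eq_empty_iff_forall_notMem]
    intro z hz
    have := hmax (ball_subset_closedBall hz.1)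
    exact hz.2 ((hU z T).2 (le_trans this (le_max_right _ _)))
  have := h.area1 (t := T) (le_max_left _ _) hP hη hL (fun v hv => by
    refine hlow v hv.1.le ?_
    rcases lt_max_iff.1 hv.2 with h' | h'
    · exact absurd hv.1 (not_lt.2 h'.le)
    · exact h')
  have hp := hpos T ⟨le_max_left _ _, max_le (hu.1.le.trans hu.2.le) (hle.trans hu.2.le)⟩
  rw [hTe] at this
  simp at this
  linarith

def CsApx (E : Set ℂ) (P : ℝ) : Prop := ∀ ε : ℝ, 0 < ε → ∃ (X : Set ℂ) (t1 : ℝ), IsOpen X ∧ 0 < t1 ∧ t1 < ε ∧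
  (volume (E \ X)).toReal ≤ ε ∧ X ⊆ thickening ε E ∧
  (volume {x | x ∈ X ∧ ∃ y ∉ X, dist x y ≤ t1}).toReal ≤ t1 * (P + ε)

set_option maxHeartbeats 1600000 in
lemma cs_B {E Ω : Set ℂ} {r R P : ℝ} (hr : 0 < r) (hrR : 2 * r ≤ R) (hEΩ : E ⊆ Ω) (hΩ : Ω ⊆ ball 0 (R / 2 - 1))
    (hP : P * r = (volume E).toReal) (hE : 0 < (volume E).toReal) (hap : CsApx E P) {ε : ℝ} (hε : 0 < ε) :
    ∃ (F : ℝ → Set ℂ) (t0 : ℝ), 0 < t0 ∧ t0 < ε ∧ t0 < r ∧ (∀ t, IsOpen (F t)) ∧ (∀ t, F t ⊆ ball 0 R) ∧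
      (∀ t ∈ Icc t0 r, ∀ z ∈ F t, ∀ w, dist w z < t - t0 → w ∈ F t0) ∧
      (volume (E \ F t0)).toReal ≤ ε ∧
      (∀ t ∈ Icc t0 r, (volume (F t0)).toReal - t * P + Real.pi * t ^ 2 - ε ≤ (volume (F t)).toReal) ∧
      (∀ s1 s2, t0 < s1 → s1 < s2 → s2 ≤ r → (∃ s ∈ Ioo s1 s2, IsConnected (F s)) ∨
        (volume (F t0)).toReal - r * P + Real.pi * r ^ 2 + Real.pi * (s2 - s1) ^ 2 - ε ≤ (volume (F r)).toReal) ∧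
      (∀ L : Set ℂ, L ⊆ closedBall 0 R → IsPreconnected L → (R : ℂ) ∈ L → Disjoint L (thickening ε Ω) →
        Disjoint L (F t0)) := by
  have hpi := Real.pi_pos
  have hP0 : 0 < P := pos_of_mul_pos_left (hP ▸ hE) hr.le
  have hR : 0 < R := by linarith
  have hEb : Bornology.IsBounded E := (isBounded_ball.subset hΩ).subset hEΩ
  have hEfin : volume E ≠ ⊤ := hEb.measure_lt_top.ne
  set c0 := min (P * r / 2) (Real.pi * r ^ 2 / 4) with hc0
  have hc0p : 0 < c0 := by positivity
  set e := min ε (c0 / 4) with he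
  have hep : 0 < e := by positivity
  have heε : e ≤ ε := min_le_left _ _
  have hec : e ≤ c0 / 4 := min_le_right _ _
  set C := r * (2 + Real.pi) + Real.pi * r + 4 * Real.pi * R + 4 * Real.pi * r with hC
  have hCp : 0 < C := by positivity
  obtain ⟨η, hη0, hη1, hηr, hηε, hηP, hηC⟩ : ∃ η, 0 < η ∧ η < 1 ∧ η < r ∧ η < ε ∧ η * (2 + P) ≤ e ∧ η * C ≤ e := by
    refine ⟨min (min (1/2) (r/2)) (min (ε/2) (min (e / (2 + P)) (e / C))), by positivity, ?_, ?_, ?_, ?_, ?_⟩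
    · exact ((min_le_left _ _).trans (min_le_left _ _)).trans_lt (by norm_num)
    · exact ((min_le_left _ _).trans (min_le_right _ _)).trans_lt (by linarith)
    · exact ((min_le_right _ _).trans (min_le_left _ _)).trans_lt (by linarith)
    · rw [← le_div_iff₀ (by positivity)]
      exact (min_le_right _ _).trans ((min_le_right _ _).trans (min_le_left _ _))
    · rw [← le_div_iff₀ (by positivity)]
      exact (min_le_right _ _).trans ((min_le_right _ _).trans (min_le_right _ _))
  obtain ⟨X, t1, hX, ht1, ht1η, hEX, hXE, hlay⟩ := hap η hη0
  have hXb : X ⊆ ball 0 (R / 2) := by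
    intro x hx
    obtain ⟨y, hy, hxy⟩ := mem_thickening_iff.1 (hXE hx)
    have := hΩ (hEΩ hy)
    rw [mem_ball] at this ⊢
    linarith [dist_triangle x y 0]
  obtain ⟨κ, t0, S, hκ, hκt, htκ, hκη, hS, n1, n2, hLS⟩ := cs_B1 hR ht1 hη0 hX (show 0 ≤ P + η by linarith)
    (hXb.trans (ball_subset_ball (by linarith))) hlay
  have ht0 : 0 < t0 := hκ.trans hκt
  have hDU : Xᶜ ∩ closedBall 0 R ⊆ csU S t0 := fun d hd => by
    obtain ⟨z, hz, h⟩ := n2 d hd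
    exact mem_csU.2 ⟨z, hz, by linarith⟩
  have hRn : ‖(R : ℂ)‖ = R := by simp [abs_of_pos hR]
  have hRD : (R : ℂ) ∈ Xᶜ ∩ closedBall (0:ℂ) R := by
    refine ⟨fun h => ?_, by rw [mem_closedBall, dist_zero_right, hRn]⟩
    have := hXb h
    rw [mem_ball, dist_zero_right, hRn] at this
    linarith
  have hpU := hDU hRD
  set A := csComp S t0 R with hA
  have hAS : ∀ z ∈ A, z ∈ S := fun z hz => (mem_csComp.1 hz).1
  have hAU : csU A t0 = connectedComponentIn (csU S t0) R := csComp_U ht0.le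
  have hring0 : ∀ y : ℂ, R / 2 ≤ ‖y‖ → ‖y‖ ≤ R → y ∈ connectedComponentIn (csU S t0) R := by
    have h1 : {z : ℂ | ‖z‖ ∈ Icc (R / 2) R} ⊆ csU S t0 := fun z hz => hDU ⟨fun h => by
      have := hXb h; rw [mem_ball, dist_zero_right] at this
      exact absurd hz.1 (not_le.2 this), by rw [mem_closedBall, dist_zero_right]; exact hz.2⟩
    have h2 := (cs_ring_preconnected (I := Icc (R / 2) R) (ordConnected_Icc.isPreconnected) (fun x hx => by linarith [hx.1])).subset_connectedComponentIn
      (x := (R : ℂ)) (by rw [mem_ofPred_eq, hRn]; exact ⟨by linarith, le_rfl⟩) h1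
    exact fun y h h' => h2 ⟨h, h'⟩
  have hAp : CsAp A R t0 κ := by
    refine ⟨hS.mono hAS, hR, hκ, hκt, fun t ht => csComp_conn ht0.le hpU ht, ?_, ?_⟩
    · intro t ht y hy1 hy2
      by_cases hyR : ‖y‖ ≤ R
      · have := hring0 y hy1 hyR
        rw [← hAU] at this
        exact csU_mono A ht this
      · push Not at hyR
        have hy0 : 0 < ‖y‖ := hR.trans hyR
        set y' : ℂ := ((R / ‖y‖ : ℝ) : ℂ) * y with hy'
        have hyn : ‖y'‖ = R := by
          rw [hy', norm_mul, Complex.norm_real, Real.norm_eq_abs, abs_of_pos (by positivity), div_mul_cancel₀ _ hy0.ne']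
        have hyy : dist y y' = ‖y‖ - R := by
          have : y - y' = ((1 - R / ‖y‖ : ℝ) : ℂ) * y := by rw [hy']; push_cast; ring
          rw [dist_eq_norm, this, norm_mul, Complex.norm_real, Real.norm_eq_abs, abs_of_nonneg (by
            rw [sub_nonneg, div_le_one hy0]; exact hyR.le), sub_mul, div_mul_cancel₀ _ hy0.ne', one_mul]
        have hyD : y' ∈ Xᶜ ∩ closedBall (0:ℂ) R := by
          refine ⟨fun h => ?_, by rw [mem_closedBall, dist_zero_right, hyn]⟩
          have := hXb h
          rw [mem_ball, dist_zero_right, hyn] at this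
          linarith
        obtain ⟨z, hz, h⟩ := n2 y' hyD
        refine mem_csU.2 ⟨z, mem_csComp.2 ⟨hz, ?_⟩, by linarith [dist_triangle y y' z]⟩
        exact cs_ball_sub_comp hz hκt.le hκ.le (hring0 y' (by rw [hyn]; linarith) hyn.le) h.le
    · intro z hz
      obtain ⟨d, hd, h⟩ := n1 z (hAS z hz)
      have h2 := hd.2
      rw [mem_closedBall, dist_zero_right] at h2
      have h3 := dist_triangle z d 0
      rw [dist_zero_right, dist_zero_right] at h3
      linarith
  have hL : csL A t0 ≤ P + 2 * Real.pi * R + (η + Real.pi * t1 + η) := by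
    have := csComp_L hS (R : ℂ) ht0
    linarith
  have hη' : 0 ≤ η + Real.pi * t1 + η := by positivity
  -- the error term
  have herr : ∀ t ∈ Icc t0 r, t * (η + Real.pi * t1 + η) + Real.pi * t0 ^ 2 + 4 * Real.pi * R * κ + 2 * Real.pi * κ * (t + t0) ≤ e := by
    intro t ht
    have htpos : 0 < t := ht0.trans_le ht.1
    refine le_trans ?_ hηC
    have a1 : t * (η + Real.pi * t1 + η) ≤ r * (2 + Real.pi) * η := by
      calc t * (η + Real.pi * t1 + η) ≤ r * (η + Real.pi * η + η) := by gcongr; exact ht.2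
        _ = _ := by ring
    have a2 : Real.pi * t0 ^ 2 ≤ Real.pi * r * η := by
      have : t0 * t0 ≤ r * η := mul_le_mul (by linarith) (by linarith) ht0.le hr.le
      nlinarith
    have a3 : 4 * Real.pi * R * κ ≤ 4 * Real.pi * R * η := by gcongr
    have a4 : 2 * Real.pi * κ * (t + t0) ≤ 2 * Real.pi * η * (r + r) := by
      gcongr
      · exact ht.2
      · linarith
    rw [hC]
    linarith
  have ht0r : t0 < r := by linarith
  have hP2 : (volume (E \ csHole A R t0)).toReal ≤ e := by
    have hsub : E \ csHole A R t0 ⊆ (E \ X) ∪ {x | x ∈ X ∧ ∃ y ∉ X, dist x y ≤ t1} := by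
      rintro x ⟨hxE, hx⟩
      by_cases hxX : x ∈ X
      · right
        refine ⟨hxX, ?_⟩
        have : x ∈ csU A t0 := by
          by_contra hc
          exact hx ⟨ball_subset_ball (by linarith) (hΩ (hEΩ hxE)), hc⟩
        obtain ⟨z, hz, h⟩ := mem_csU.1 this
        obtain ⟨d, hd, h'⟩ := n1 z (hAS z hz)
        exact ⟨d, hd.1, by linarith [dist_triangle x z d]⟩
      · exact Or.inl ⟨hxE, hxX⟩
    have f1 : volume (E \ X) ≠ ⊤ := ne_top_of_le_ne_top hEfin (measure_mono diff_subset)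
    have f2 : volume {x | x ∈ X ∧ ∃ y ∉ X, dist x y ≤ t1} ≠ ⊤ :=
      ((isBounded_ball.subset hXb).subset (fun x hx => hx.1)).measure_lt_top.ne
    have h1 := ENNReal.toReal_mono (by finiteness) ((measure_mono hsub).trans (measure_union_le (μ := volume) _ _))
    rw [ENNReal.toReal_add f1 f2] at h1
    have h2 : t1 * (P + η) ≤ η * (P + 1) := by gcongr
    linarith
  have hFE : P * r - e ≤ (volume (csHole A R t0)).toReal := by
    have h1 : volume E ≤ volume (csHole A R t0) + volume (E \ csHole A R t0) :=
      (measure_mono (show E ⊆ csHole A R t0 ∪ (E \ csHole A R t0) by rw [union_diff_self]; exact subset_union_right)).trans (measure_union_le _ _)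
    have f1 : volume (E \ csHole A R t0) ≠ ⊤ := ne_top_of_le_ne_top hEfin (measure_mono diff_subset)
    have h2 := ENNReal.toReal_mono (by finiteness [csHole_fin A R t0]) h1
    rw [ENNReal.toReal_add (csHole_fin A R t0) f1] at h2
    linarith
  have hlow : ∀ t ∈ Icc t0 r, c0 ≤ P * r - t * P + Real.pi * t ^ 2 := by
    intro t ht
    have htpos : 0 < t := ht0.trans_le ht.1
    by_cases h : t ≤ r / 2
    · refine (min_le_left _ _).trans ?_
      nlinarith [mul_pos hpi (pow_pos htpos 2)]
    · push Not at h
      refine (min_le_right _ _).trans ?_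
      have : r ^ 2 / 4 ≤ t ^ 2 := by nlinarith
      nlinarith [ht.2]
  have hne : ∀ u ∈ Ioo t0 r, (csHole A R u).Nonempty := by
    refine hAp.persist hP0.le hη' hL ?_ ?_
    · intro t ht
      linarith [hlow t ht, herr t ht]
    · have : c0 ≤ P * r / 2 := min_le_left _ _
      linarith
  refine ⟨fun t => csHole A R t, t0, ht0, by linarith, ht0r, csHole_open A R, fun t => diff_subset, ?_, hP2.trans heε, ?_, ?_, ?_⟩
  · intro t ht z hz w hwz
    refine ⟨?_, fun hw => ?_⟩
    · have hz1 : ‖z‖ < R / 2 := by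
        by_contra hc
        push Not at hc
        refine hz.2 (hAp.ring t ht.1 z hc ?_)
        have := hz.1
        rw [mem_ball, dist_zero_right] at this
        linarith [ht.1]
      rw [mem_ball]
      have := dist_triangle w z 0
      rw [dist_zero_right z] at this
      linarith [ht.2]
    · obtain ⟨x, hx, h⟩ := mem_csU.1 hw
      refine hz.2 (mem_csU.2 ⟨x, hx, ?_⟩)
      have := dist_triangle z w x
      rw [dist_comm z w] at this
      linarith
  · intro t ht
    have := hAp.area1 ht.1 hP0.le hη' hL (fun u hu => hne u ⟨hu.1, hu.2.trans_le ht.2⟩)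
    simp only
    linarith [herr t ht]
  · intro s1 s2 h1 h12 h2
    by_cases hc : ∃ s ∈ Ioo s1 s2, IsPreconnected (csHole A R s)
    · left
      obtain ⟨s, hs, h⟩ := hc
      exact ⟨s, hs, hne s ⟨h1.trans hs.1, hs.2.trans_le h2⟩, h⟩
    · right
      push Not at hc
      have := hAp.area2 h1.le h12.le h2 hP0.le hη' hL hne hc
      simp only
      linarith [herr r ⟨ht0r.le, le_rfl⟩]
  · intro L hLR hLc hRL hLd
    have h1 : L ⊆ csU S t0 := fun x hx => hDU ⟨fun hxX => by
      refine Set.disjoint_left.1 hLd hx ?_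
      exact thickening_mono hηε.le _ (thickening_subset_of_subset η hEΩ (hXE hxX)), hLR hx⟩
    have h2 := hLc.subset_connectedComponentIn hRL h1
    rw [← hAU] at h2
    exact Set.disjoint_left.2 fun x hx hxF => hxF.2 (h2 hx)

/-- Ultrafilter limits of connected sets. -/
lemma cs_ultra (U : Ultrafilter ℕ) {R : ℝ} {W : ℕ → Set ℂ} (hW : ∀ n, W n ⊆ closedBall 0 R)
    (hc : ∀ᶠ n in (U : Filter ℕ), IsConnected (W n)) :
    ∃ Z : Set ℂ, IsCompact Z ∧ IsConnected Z ∧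
      (∀ z ∈ Z, ∀ δ > 0, ∀ᶠ n in (U : Filter ℕ), ∃ w ∈ W n, dist w z < δ) ∧
      (∀ δ > 0, ∀ᶠ n in (U : Filter ℕ), W n ⊆ thickening δ Z) := by
  set Z : Set ℂ := {z | ∀ δ > 0, ∀ᶠ n in (U : Filter ℕ), ∃ w ∈ W n, dist w z < δ} with hZ
  have key : ∀ w : ℕ → ℂ, (∀ᶠ n in (U : Filter ℕ), w n ∈ W n) → ∃ z ∈ Z, Filter.Tendsto w U (nhds z) := by
    intro w hw
    obtain ⟨z, -, hz⟩ := (isCompact_closedBall (0:ℂ) R).ultrafilter_le_nhds (U.map w) (by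
      rw [Filter.le_principal_iff]
      exact hw.mono fun n h => hW n h)
    have hz' : Filter.Tendsto w U (nhds z) := hz
    refine ⟨z, fun δ hδ => ?_, hz'⟩
    filter_upwards [hw, Metric.tendsto_nhds.1 hz' δ hδ] with n h1 h2
    exact ⟨w n, h1, h2⟩
  have hout : ∀ G : Set ℂ, IsOpen G → Z ⊆ G → ∀ᶠ n in (U : Filter ℕ), W n ⊆ G := by
    intro G hG hZG
    by_contra h
    rw [← Ultrafilter.eventually_not] at h
    have h' : ∀ n, ∃ w, (¬ W n ⊆ G → w ∈ W n ∧ w ∉ G) := fun n => by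
      by_cases hn : W n ⊆ G
      · exact ⟨0, fun h => absurd hn h⟩
      · obtain ⟨w, h1, h2⟩ := not_subset.1 hn
        exact ⟨w, fun _ => ⟨h1, h2⟩⟩
    choose w hw using h'
    obtain ⟨z, hz, hzt⟩ := key w (h.mono fun n hn => (hw n hn).1)
    have h2 := hzt (hG.mem_nhds (hZG hz))
    obtain ⟨n, hn1, hn2⟩ := (h.and h2).exists
    exact (hw n hn1).2 hn2
  have hZc : IsClosed Z := by
    rw [← closure_subset_iff_isClosed]
    intro z hz δ hδ
    obtain ⟨y, hy, hzy⟩ := Metric.mem_closure_iff.1 hz (δ / 2) (by positivity)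
    filter_upwards [hy (δ / 2) (by positivity)] with n hn
    obtain ⟨w, hw, h⟩ := hn
    refine ⟨w, hw, ?_⟩
    rw [dist_comm] at hzy
    linarith [dist_triangle w y z]
  have hZb : Z ⊆ closedBall 0 R := by
    intro z hz
    rw [← (isClosed_closedBall (x := (0:ℂ)) (ε := R)).closure_eq]
    refine Metric.mem_closure_iff.2 fun δ hδ => ?_
    obtain ⟨n, w, hw, h⟩ := (hz δ hδ).exists
    exact ⟨w, hW n hw, by rwa [dist_comm]⟩
  have hZk : IsCompact Z := (isCompact_closedBall (0:ℂ) R).of_isClosed_subset hZc hZb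
  refine ⟨Z, hZk, ⟨?_, ?_⟩, fun z hz => hz, fun δ hδ => hout _ isOpen_thickening (self_subset_thickening hδ Z)⟩
  · have h' : ∀ n, ∃ w, (IsConnected (W n) → w ∈ W n) := fun n => by
      by_cases hn : IsConnected (W n)
      · obtain ⟨w, h⟩ := hn.1
        exact ⟨w, fun _ => h⟩
      · exact ⟨0, fun h => absurd h hn⟩
    choose w hw using h'
    obtain ⟨z, hz, -⟩ := key w (hc.mono fun n hn => hw n hn)
    exact ⟨z, hz⟩
  · intro A B hA hB hAB ⟨a, haZ, haA⟩ ⟨b, hbZ, hbB⟩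
    by_contra hne
    have h1 : IsCompact (Z \ B) := hZk.diff hB
    have h2 : IsCompact (Z \ A) := hZk.diff hA
    have hd : Disjoint (Z \ B) (Z \ A) := by
      rw [Set.disjoint_left]
      rintro x ⟨hx, hxB⟩ ⟨-, hxA⟩
      rcases hAB hx with h | h
      · exact hxA h
      · exact hxB h
    obtain ⟨U1, U2, o1, o2, s1, s2, d⟩ := SeparatedNhds.of_isCompact_isCompact h1 h2 hd
    have hZU : Z ⊆ U1 ∪ U2 := by
      intro x hx
      by_cases hxB : x ∈ B
      · right
        refine s2 ⟨hx, fun hxA => hne ⟨x, hx, hxA, hxB⟩⟩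
      · exact Or.inl (s1 ⟨hx, hxB⟩)
    have ha1 : a ∈ U1 := s1 ⟨haZ, fun h => hne ⟨a, haZ, haA, h⟩⟩
    have hb2 : b ∈ U2 := s2 ⟨hbZ, fun h => hne ⟨b, hbZ, h, hbB⟩⟩
    obtain ⟨δ1, hδ1, hb1⟩ := Metric.isOpen_iff.1 o1 a ha1
    obtain ⟨δ2, hδ2, hb2'⟩ := Metric.isOpen_iff.1 o2 b hb2
    obtain ⟨n, ⟨⟨⟨hn1, hn2⟩, ⟨x, hx, hxa⟩⟩, ⟨y, hy, hyb⟩⟩⟩ :=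
      (((hc.and (hout _ (o1.union o2) hZU)).and (haZ δ1 hδ1)).and (hbZ δ2 hδ2)).exists
    obtain ⟨z, hz, hz1, hz2⟩ := hn1.2 U1 U2 o1 o2 hn2 ⟨x, hx, hb1 hxa⟩ ⟨y, hy, hb2' hyb⟩
    exact Set.disjoint_left.1 d hz1 hz2

/-- Radial retraction trick: points outside `closure Ω` can be joined to `R` inside the closed ball. -/
lemma cs_escape {Ω : Set ℂ} {R : ℝ} (hR : 0 < R) (hΩ : Ω ⊆ ball 0 (R / 2 - 1))
    (hV : IsPreconnected (closure Ω)ᶜ) {v : ℂ} (hv : v ∉ closure Ω) (hvR : ‖v‖ ≤ R) :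
    ∃ L : Set ℂ, IsCompact L ∧ L ⊆ closedBall 0 R ∧ IsPreconnected L ∧ (R : ℂ) ∈ L ∧ v ∈ L ∧ L ⊆ (closure Ω)ᶜ := by
  have hcl : closure Ω ⊆ closedBall 0 (R / 2 - 1) := closure_minimal (hΩ.trans ball_subset_closedBall) isClosed_closedBall
  have hRn : ‖(R : ℂ)‖ = R := by simp [abs_of_pos hR]
  have hfar : ∀ y : ℂ, R ≤ ‖y‖ → y ∈ (closure Ω)ᶜ := fun y hy h => by
    have := hcl h
    rw [mem_closedBall, dist_zero_right] at this
    linarith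
  have hpc : IsPathConnected (closure Ω)ᶜ :=
    ((isClosed_closure.isOpen_compl).isConnected_iff_isPathConnected).1 ⟨⟨v, hv⟩, hV⟩
  obtain ⟨γ, hγ⟩ := hpc.joinedIn v hv R (hfar R hRn.ge)
  set ρ : ℂ → ℂ := fun z => ((R / max R ‖z‖ : ℝ) : ℂ) * z with hρ
  have hmax : ∀ z : ℂ, 0 < max R ‖z‖ := fun z => lt_max_of_lt_left hR
  have hρc : Continuous ρ := by
    refine (Complex.continuous_ofReal.comp ?_).mul continuous_id
    exact continuous_const.div (continuous_const.max continuous_norm) fun z => (hmax z).ne'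
  have hρ1 : ∀ z : ℂ, ‖z‖ ≤ R → ρ z = z := fun z hz => by
    simp only [hρ]
    rw [max_eq_left hz, div_self hR.ne']
    simp
  have hρn : ∀ z : ℂ, R ≤ ‖z‖ → ‖ρ z‖ = R := fun z hz => by
    simp only [hρ]
    rw [max_eq_right hz, norm_mul, Complex.norm_real, Real.norm_eq_abs, abs_of_nonneg (by positivity),
      div_mul_cancel₀ _ (hR.trans_le hz).ne']
  refine ⟨range (ρ ∘ γ), isCompact_range (hρc.comp γ.continuous), ?_, isPreconnected_range (hρc.comp γ.continuous),
    ⟨1, ?_⟩, ⟨0, ?_⟩, ?_⟩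
  · rintro _ ⟨t, rfl⟩
    rw [mem_closedBall, dist_zero_right, Function.comp]
    rcases le_total ‖γ t‖ R with h | h
    · rwa [hρ1 _ h]
    · exact (hρn _ h).le
  · simp only [Function.comp, γ.target]; exact hρ1 _ hRn.le
  · simp only [Function.comp, γ.source]; exact hρ1 _ hvR
  · rintro _ ⟨t, rfl⟩
    rw [Function.comp]
    rcases le_total ‖γ t‖ R with h | h
    · rw [hρ1 _ h]; exact hγ t
    · exact hfar _ (hρn _ h).ge

/-- The set of centers of `s`-balls that are contained in `E` up to a null set. -/
def csEs (E : Set ℂ) (s : ℝ) : Set ℂ := {z | volume (ball z s \ E) = 0}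

lemma csEs_of_approx {E : Set ℂ} {s : ℝ} {z : ℂ}
    (h : ∀ δ > 0, volume (ball z (s - δ) \ E) = 0) : z ∈ csEs E s := by
  have : ball z s \ E ⊆ ⋃ n : ℕ, (ball z (s - 1 / ((n:ℝ) + 1)) \ E) := by
    rintro x ⟨hx, hxE⟩
    rw [mem_ball] at hx
    obtain ⟨n, hn⟩ := exists_nat_one_div_lt (sub_pos.2 hx)
    exact mem_iUnion.2 ⟨n, by rw [mem_ball]; linarith, hxE⟩
  exact measure_mono_null this (measure_iUnion_null fun n => h _ (by positivity))

lemma csEs_closed (E : Set ℂ) (s : ℝ) : IsClosed (csEs E s) := by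
  rw [← closure_subset_iff_isClosed]
  intro z hz
  refine csEs_of_approx fun δ hδ => ?_
  obtain ⟨y, hy, hzy⟩ := Metric.mem_closure_iff.1 hz δ hδ
  exact measure_mono_null (sdiff_subset_sdiff_left (ball_subset_ball' (by linarith))) hy

lemma csEs_anti (E : Set ℂ) {s s' : ℝ} (h : s ≤ s') : csEs E s' ⊆ csEs E s := fun _ hz =>
  measure_mono_null (sdiff_subset_sdiff_left (ball_subset_ball h)) hz

lemma csEs_sub {E Ω : Set ℂ} (hE : E ⊆ Ω) (hi : interior (closure Ω) = Ω)
    {s : ℝ} {z : ℂ} (hz : z ∈ csEs E s) : ball z s ⊆ Ω := by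
  rw [← hi]
  refine interior_maximal ?_ isOpen_ball
  by_contra hc
  obtain ⟨v, hv, hvc⟩ := not_subset.1 hc
  have ho : IsOpen (ball z s ∩ (closure Ω)ᶜ) := isOpen_ball.inter isClosed_closure.isOpen_compl
  have := ho.measure_pos volume ⟨v, hv, hvc⟩
  refine this.ne' (measure_mono_null ?_ hz)
  rintro x ⟨h1, h2⟩
  exact ⟨h1, fun h => h2 (subset_closure (hE h))⟩

lemma csEs_thick {E Z : Set ℂ} {s : ℝ} (hZ : Z ⊆ csEs E s) : volume (thickening s Z \ E) = 0 := by
  rw [thickening_eq_biUnion_ball]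
  obtain ⟨T, hTZ, hTc, hT⟩ := TopologicalSpace.isOpen_biUnion_countable Z (fun z => ball z s) (fun _ _ => isOpen_ball)
  rw [← hT, iUnion_sdiff]
  simp_rw [iUnion_sdiff]
  exact (measure_biUnion_null_iff hTc).2 fun z hz => hZ (hTZ hz)

/-- Consequence of the perimeter lower bound on thickenings of connected sets. -/
lemma cs_per_lower {Ω Z : Set ℂ} {r s : ℝ} (hs : 0 < s)
    (hP2 : ∀ O : Set ℂ, IsOpen O → O ⊆ Ω → ∀ m c : ℝ, (∀ σ > 0, (volume (thickening σ O)).toReal ≤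
      (volume O).toReal + m * σ + c * σ ^ 2) → (volume O).toReal ≤ r * m)
    (hZc : IsCompact Z) (hZ : IsConnected Z) (hZΩ : ∀ z ∈ Z, ball z s ⊆ Ω) :
    s * (volume (thickening s Z)).toReal ≤
      r * ((volume (thickening s Z)).toReal - (volume Z).toReal + Real.pi * s ^ 2) := by
  have h := hP2 (thickening s Z) isOpen_thickening (by
    rw [thickening_eq_biUnion_ball]
    exact iUnion₂_subset hZΩ) (((volume (thickening s Z)).toReal - (volume Z).toReal + Real.pi * s ^ 2) / s) Real.pi
    (fun σ hσ => by
      refine le_trans ?_ (cs_S hZc hZ hs hσ)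
      refine ENNReal.toReal_mono hZc.isBounded.thickening.measure_lt_top.ne (measure_mono ?_)
      rw [add_comm]
      exact thickening_thickening_subset σ s Z)
  rw [← mul_div_assoc, le_div_iff₀ hs] at h
  linarith

/-- `limsup |F_n| ≤ |K|` if `limsup F_n ⊆ K`. -/
lemma cs_limsup {F : ℕ → Set ℂ} {K : Set ℂ} {R : ℝ} (ho : ∀ n, IsOpen (F n)) (hF : ∀ n, F n ⊆ ball 0 R)
    (hK : ∀ z, (∃ᶠ n in Filter.atTop, z ∈ F n) → z ∈ K) (hKf : volume K ≠ ⊤) {δ : ℝ} (hδ : 0 < δ) :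
    ∀ᶠ n in Filter.atTop, (volume (F n)).toReal ≤ (volume K).toReal + δ := by
  set G : ℕ → Set ℂ := fun N => ⋃ n ≥ N, F n with hG
  have hGb : ∀ N, G N ⊆ ball 0 R := fun N => iUnion₂_subset fun n _ => hF n
  have hGf : ∀ N, volume (G N) ≠ ⊤ := fun N => (isBounded_ball.subset (hGb N)).measure_lt_top.ne
  have hanti : Antitone G := fun a b hab => iUnion₂_subset fun n hn => subset_iUnion₂_of_subset n (hab.trans hn) subset_rfl
  have hlim := tendsto_measure_iInter_atTop (μ := volume) (s := G)
    (fun N => (isOpen_biUnion fun n _ => ho n).measurableSet.nullMeasurableSet) hanti ⟨0, hGf 0⟩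
  have hsub : ⋂ N, G N ⊆ K := by
    intro z hz
    refine hK z (Filter.frequently_atTop.2 fun N => ?_)
    obtain ⟨n, hn, h⟩ := mem_iUnion₂.1 (mem_iInter.1 hz N)
    exact ⟨n, hn, h⟩
  have hif : volume (⋂ N, G N) ≠ ⊤ := ne_top_of_le_ne_top (hGf 0) (measure_mono (iInter_subset _ 0))
  have h2 := (ENNReal.tendsto_toReal hif).comp hlim
  have h3 : (volume (⋂ N, G N)).toReal < (volume K).toReal + δ := by
    have := ENNReal.toReal_mono hKf (measure_mono hsub)
    linarith
  filter_upwards [h2.eventually_lt_const h3] with n hn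
  refine le_trans (ENNReal.toReal_mono (hGf n) (measure_mono ?_)) hn.le
  exact subset_iUnion₂_of_subset n le_rfl subset_rfl

structure CsSeq (E : Set ℂ) (r R : ℝ) (F : ℕ → ℝ → Set ℂ) (t : ℕ → ℝ) : Prop where
  tpos : ∀ n, 0 < t n
  tlim : Filter.Tendsto t Filter.atTop (nhds 0)
  tr : ∀ n, t n < r
  op : ∀ n s, IsOpen (F n s)
  bd : ∀ n s, F n s ⊆ ball 0 R
  p1 : ∀ n, ∀ s ∈ Icc (t n) r, ∀ z ∈ F n s, ∀ w, dist w z < s - t n → w ∈ F n (t n)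
  p2 : ∀ δ > 0, ∀ᶠ n in Filter.atTop, (volume (F n (t n) \ E)).toReal ≤ δ
  p3 : ∀ δ > 0, ∀ᶠ n in Filter.atTop, ∀ s ∈ Icc (t n) r,
    (volume E).toReal * (1 - s / r) + Real.pi * s ^ 2 - δ ≤ (volume (F n s)).toReal
  p4 : ∀ s1 s2, 0 < s1 → s1 < s2 → s2 ≤ r → ∀ᶠ n in Filter.atTop, ∃ s ∈ Ioo s1 s2, IsConnected (F n s)

lemma cs_seq {E Ω : Set ℂ} {r R : ℝ} (hr : 0 < r) (hrR : 2 * r ≤ R) (hEm : MeasurableSet E) (hEΩ : E ⊆ Ω) (hΩ : Ω ⊆ ball 0 (R / 2 - 1))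
    (hE : 0 < (volume E).toReal) (hap : CsApx E ((volume E).toReal / r))
    (hV : IsPreconnected (closure Ω)ᶜ) (hi : interior (closure Ω) = Ω)
    (hK : (volume {z : ℂ | ball z r ⊆ Ω}).toReal ≤ Real.pi * r ^ 2) :
    ∃ F t, CsSeq E r R F t := by
  have hpi := Real.pi_pos
  have hR : 0 < R := by linarith
  set P := (volume E).toReal / r with hPdef
  have hP : P * r = (volume E).toReal := div_mul_cancel₀ _ hr.ne'
  have hB := fun n : ℕ => cs_B hr hrR hEΩ hΩ hP hE hap (ε := 1 / ((n:ℝ) + 1)) (by positivity)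
  choose F t h1 h2 h3 h4 h5 h6 h7 h8 h9 h10 using hB
  have hεlim : Filter.Tendsto (fun n : ℕ => 1 / ((n:ℝ) + 1)) Filter.atTop (nhds 0) := tendsto_one_div_add_atTop_nhds_zero_nat
  have htlim : Filter.Tendsto t Filter.atTop (nhds 0) :=
    squeeze_zero (fun n => (h1 n).le) (fun n => (h2 n).le) hεlim
  have hEb : Bornology.IsBounded E := (isBounded_ball.subset hΩ).subset hEΩ
  have hEfin : volume E ≠ ⊤ := hEb.measure_lt_top.ne
  have hFfin : ∀ n s, volume (F n s) ≠ ⊤ := fun n s => (isBounded_ball.subset (h5 n s)).measure_lt_top.ne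
  have hKb : {z : ℂ | ball z r ⊆ Ω} ⊆ ball 0 (R / 2 - 1) := fun z hz => hΩ (hz (mem_ball_self hr))
  have hesc : ∀ z, (∃ᶠ n in Filter.atTop, z ∈ F n r) → z ∈ {z : ℂ | ball z r ⊆ Ω} := by
    intro z hz
    by_contra hc
    have hc' : ¬ ball z r ⊆ closure Ω := fun h => hc (by
      have := interior_maximal h isOpen_ball
      rwa [hi] at this)
    obtain ⟨v, hv, hvc⟩ := not_subset.1 hc'
    rw [mem_ball] at hv
    refine hz ?_
    by_cases hvR : ‖v‖ ≤ R
    · obtain ⟨L, hLc, hLR, hLp, hRL, hvL, hLΩ⟩ := cs_escape hR hΩ hV hvc hvR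
      have hdis : Disjoint (closure Ω) L := Set.disjoint_left.2 fun x h1 h2 => hLΩ h2 h1
      obtain ⟨δ, hδ, hd⟩ := Disjoint.exists_thickenings hdis.symm hLc isClosed_closure
      filter_upwards [hεlim.eventually_lt_const hδ, htlim.eventually_lt_const (sub_pos.2 hv)] with n hn1 hn2 hzn
      have := h10 n L hLR hLp hRL (by
        refine Set.disjoint_left.2 fun x hx hx' => Set.disjoint_left.1 hd (self_subset_thickening hδ L hx) ?_
        exact thickening_mono hn1.le _ (thickening_subset_of_subset _ subset_closure hx'))
      exact Set.disjoint_left.1 this hvL (h6 n r ⟨(h3 n).le, le_rfl⟩ z hzn v (by linarith))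
    · filter_upwards [htlim.eventually_lt_const (sub_pos.2 hv)] with n hn2 hzn
      have := h5 n _ (h6 n r ⟨(h3 n).le, le_rfl⟩ z hzn v (by linarith))
      rw [mem_ball, dist_zero_right] at this
      exact hvR this.le
  have hsup : ∀ δ > 0, ∀ᶠ n in Filter.atTop, (volume (F n r)).toReal ≤ Real.pi * r ^ 2 + δ := fun δ hδ => by
    filter_upwards [cs_limsup (fun n => h4 n r) (fun n => h5 n r) hesc (isBounded_ball.subset hKb).measure_lt_top.ne hδ] with n hn
    linarith
  have hdiff : ∀ n, (volume (F n (t n) \ E)).toReal = (volume (F n (t n))).toReal - (volume E).toReal + (volume (E \ F n (t n))).toReal := by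
    intro n
    have a1 := measure_inter_add_sdiff (μ := volume) (F n (t n)) hEm
    have a2 := measure_inter_add_sdiff (μ := volume) E (h4 n (t n)).measurableSet
    rw [← a1, ← a2, inter_comm E, ENNReal.toReal_add, ENNReal.toReal_add]
    · ring
    · exact ne_top_of_le_ne_top hEfin (measure_mono inter_subset_right)
    · exact ne_top_of_le_ne_top hEfin (measure_mono diff_subset)
    · exact ne_top_of_le_ne_top hEfin (measure_mono inter_subset_right)
    · exact ne_top_of_le_ne_top (hFfin n _) (measure_mono diff_subset)
  have hlo : ∀ n : ℕ, (volume E).toReal - 1 / ((n:ℝ) + 1) ≤ (volume (F n (t n))).toReal := fun n => by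
    have := hdiff n
    have h0 : 0 ≤ (volume (F n (t n) \ E)).toReal := ENNReal.toReal_nonneg
    linarith [h7 n]
  have hP' : r * P = (volume E).toReal := by rw [mul_comm]; exact hP
  refine ⟨F, t, h1, htlim, h3, h4, h5, h6, ?_, ?_, ?_⟩
  · intro δ hδ
    filter_upwards [hsup (δ / 2) (by positivity), hεlim.eventually_lt_const (show (0:ℝ) < δ / 4 by positivity)] with n hn1 hn2
    have := h8 n r ⟨(h3 n).le, le_rfl⟩
    rw [hdiff n]
    linarith [h7 n]
  · intro δ hδ
    filter_upwards [hεlim.eventually_lt_const (show (0:ℝ) < δ / 2 by positivity)] with n hn2 s hs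
    have := h8 n s hs
    have e1 : (volume E).toReal * (1 - s / r) = (volume E).toReal - s * P := by rw [hPdef]; ring
    linarith [hlo n]
  · intro s1 s2 hs1 hs12 hs2
    have hpos : 0 < Real.pi * (s2 - s1) ^ 2 := mul_pos hpi (pow_pos (sub_pos.2 hs12) 2)
    filter_upwards [hsup (Real.pi * (s2 - s1) ^ 2 / 2) (by positivity), htlim.eventually_lt_const hs1,
      hεlim.eventually_lt_const (show (0:ℝ) < Real.pi * (s2 - s1) ^ 2 / 4 by positivity)] with n hn1 hn2 hn3
    rcases h9 n s1 s2 hn2 hs12 hs2 with h | h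
    · exact h
    · exfalso
      linarith [hlo n]

/-- points that are limits of centers of balls in the approximating sets. -/
lemma CsSeq.mem_Es {E : Set ℂ} {r R : ℝ} {F : ℕ → ℝ → Set ℂ} {t : ℕ → ℝ} (h : CsSeq E r R F t) {s : ℝ} {z : ℂ}
    (hz : ∀ δ > 0, ∃ᶠ n in Filter.atTop, ∃ s' ∈ Icc (t n) r, s - δ < s' ∧ ∃ w ∈ F n s', dist w z < δ) : z ∈ csEs E s := by
  refine csEs_of_approx fun δ hδ => ?_
  have hfin : volume (ball z (s - δ) \ E) ≠ ⊤ := (isBounded_ball.subset diff_subset).measure_lt_top.ne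
  have : (volume (ball z (s - δ) \ E)).toReal ≤ 0 := by
    refine le_of_forall_pos_le_add fun η hη => ?_
    obtain ⟨n, ⟨s', hs', hss, w, hw, hwz⟩, hn1, hn2⟩ := ((hz (δ / 3) (by positivity)).and_eventually
      ((h.tlim.eventually_lt_const (show 0 < δ / 3 by positivity)).and (h.p2 η hη))).exists
    rw [zero_add]
    refine le_trans (ENNReal.toReal_mono ?_ (measure_mono ?_)) hn2
    · exact ((isBounded_ball.subset (h.bd n _)).subset diff_subset).measure_lt_top.ne
    · refine sdiff_subset_sdiff_left fun x hx => h.p1 n s' hs' w hw x ?_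
      rw [mem_ball] at hx
      rw [dist_comm] at hwz
      linarith [dist_triangle x z w]
  exact (ENNReal.toReal_eq_zero_iff _).1 (le_antisymm this ENNReal.toReal_nonneg) |>.resolve_right hfin

lemma cs_toReal_le_zero {a : ℝ≥0∞} (hf : a ≠ ⊤) (h : a.toReal ≤ 0) : a = 0 :=
  (ENNReal.toReal_eq_zero_iff _).1 (le_antisymm h ENNReal.toReal_nonneg) |>.resolve_right hf

/-- If `A` is almost contained in `B` and has at least the same measure, then `B` is almost contained in `A`. -/
lemma cs_null_symm {A B : Set ℂ} (hA : MeasurableSet A) (hB : MeasurableSet B) (hBf : volume B ≠ ⊤)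
    (hAB : volume (A \ B) = 0) (h : (volume B).toReal ≤ (volume A).toReal) : volume (B \ A) = 0 := by
  have a1 := measure_inter_add_sdiff (μ := volume) A hB
  have a2 := measure_inter_add_sdiff (μ := volume) B hA
  rw [hAB, add_zero, inter_comm] at a1
  have f1 : volume (B ∩ A) ≠ ⊤ := ne_top_of_le_ne_top hBf (measure_mono inter_subset_left)
  have f2 : volume (B \ A) ≠ ⊤ := ne_top_of_le_ne_top hBf (measure_mono diff_subset)
  refine cs_toReal_le_zero f2 ?_
  rw [← a1, ← a2, ENNReal.toReal_add f1 f2] at h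
  linarith

/-- Intermediate step: E is the `s`-thickening of a connected compact set. -/
lemma cs_mid {E Ω : Set ℂ} {r R : ℝ} (hr : 0 < r) (hEm : MeasurableSet E) (hEΩ : E ⊆ Ω) (hEf : volume E ≠ ⊤)
    (hi : interior (closure Ω) = Ω)
    (hP2 : ∀ O : Set ℂ, IsOpen O → O ⊆ Ω → ∀ m c : ℝ, (∀ σ > 0, (volume (thickening σ O)).toReal ≤
      (volume O).toReal + m * σ + c * σ ^ 2) → (volume O).toReal ≤ r * m)
    {F : ℕ → ℝ → Set ℂ} {t : ℕ → ℝ} (h : CsSeq E r R F t) {s1 s2 : ℝ} (h1 : 0 < s1) (h12 : s1 < s2) (h2 : s2 < r) :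
    volume (E \ thickening r (csEs E s1)) = 0 := by
  set U : Ultrafilter ℕ := Filter.hyperfilter ℕ with hU
  have hUle : (U : Filter ℕ) ≤ Filter.atTop := by
    rw [← Nat.cofinite_eq_atTop]; exact Filter.hyperfilter_le_cofinite
  have hp4 := h.p4 s1 s2 h1 h12 h2.le
  have hex : ∀ n, ∃ s, s ∈ Icc s1 s2 ∧ ((∃ s ∈ Ioo s1 s2, IsConnected (F n s)) → IsConnected (F n s)) := fun n => by
    by_cases hn : ∃ s ∈ Ioo s1 s2, IsConnected (F n s)
    · obtain ⟨s, hs, hc⟩ := hn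
      exact ⟨s, ⟨hs.1.le, hs.2.le⟩, fun _ => hc⟩
    · exact ⟨s1, ⟨le_rfl, h12.le⟩, fun h => absurd h hn⟩
  choose s hs hsc using hex
  obtain ⟨Z, hZk, hZc, hZ1, hZ2⟩ := cs_ultra U (W := fun n => F n (s n)) (R := R)
    (fun n => (h.bd n _).trans ball_subset_closedBall) ((hp4.filter_mono hUle).mono fun n hn => hsc n hn)
  obtain ⟨s0, hs0, hs0l⟩ := (isCompact_Icc (a := s1) (b := s2)).ultrafilter_le_nhds (U.map s) (by
      rw [Filter.le_principal_iff]
      exact Filter.mem_map.2 (Filter.Eventually.of_forall hs))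
  have hst : Filter.Tendsto s U (nhds s0) := hs0l
  have htn : ∀ᶠ n in (U : Filter ℕ), t n < s1 := (h.tlim.eventually_lt_const h1).filter_mono hUle
  have hs0p : 0 < s0 := h1.trans_le hs0.1
  have hs0r : s0 < r := hs0.2.trans_lt h2
  have hZE : Z ⊆ csEs E s0 := by
    intro z hz
    refine h.mem_Es fun δ hδ => ?_
    have : ∀ᶠ n in (U : Filter ℕ), ∃ s' ∈ Icc (t n) r, s0 - δ < s' ∧ ∃ w ∈ F n s', dist w z < δ := by
      filter_upwards [htn, hZ1 z hz δ hδ, hst.eventually_const_lt (show s0 - δ < s0 by linarith)] with n a1 a2 a3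
      exact ⟨s n, ⟨a1.le.trans (hs n).1, (hs n).2.trans h2.le⟩, a3, a2⟩
    exact this.frequently.filter_mono hUle
  have hvol : (volume E).toReal * (1 - s0 / r) + Real.pi * s0 ^ 2 ≤ (volume Z).toReal := by
    refine le_of_forall_pos_le_add fun δ hδ => ?_
    have hth : ∀ᶠ κ in nhdsWithin (0:ℝ) (Ioi 0), (volume (cthickening κ Z)).toReal < (volume Z).toReal + δ / 4 := by
      have := cs_cth_tendsto hZk (le_refl (0:ℝ))
      simp only [zero_add] at this
      refine this.eventually_lt_const ?_
      rw [cthickening_zero, hZk.isClosed.closure_eq]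
      linarith
    obtain ⟨κ, hκ1, hκ⟩ := (hth.and self_mem_nhdsWithin).exists
    have hlim : Filter.Tendsto (fun n => (volume E).toReal * (1 - s n / r) + Real.pi * s n ^ 2) U
        (nhds ((volume E).toReal * (1 - s0 / r) + Real.pi * s0 ^ 2)) :=
      (((hst.div_const r).const_sub 1).const_mul _).add ((hst.pow 2).const_mul _)
    obtain ⟨n, a1, a2, a3, a4⟩ := (htn.and ((hZ2 κ hκ).and (((h.p3 (δ / 4) (by positivity)).filter_mono hUle).and
      (hlim.eventually_const_lt (show (volume E).toReal * (1 - s0 / r) + Real.pi * s0 ^ 2 - δ / 4 < _ by linarith))))).exists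
    have b1 := a3 (s n) ⟨a1.le.trans (hs n).1, (hs n).2.trans h2.le⟩
    have b2 : (volume (F n (s n))).toReal ≤ (volume (cthickening κ Z)).toReal :=
      ENNReal.toReal_mono (cs_cth_fin hZk κ) (measure_mono (a2.trans (thickening_subset_cthickening _ _)))
    linarith
  have hlow := cs_per_lower hs0p hP2 hZk hZc (fun z hz => csEs_sub hEΩ hi (hZE hz))
  have hbig : (volume E).toReal ≤ (volume (thickening s0 Z)).toReal := by
    have e1 : r * ((volume E).toReal * (1 - s0 / r)) = (volume E).toReal * (r - s0) := by
      field_simp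
    have e2 := mul_le_mul_of_nonneg_left hvol hr.le
    rw [mul_add, e1] at e2
    have : (volume E).toReal * (r - s0) ≤ (volume (thickening s0 Z)).toReal * (r - s0) := by linarith
    exact le_of_mul_le_mul_right this (by linarith)
  have hfin := cs_null_symm isOpen_thickening.measurableSet hEm hEf (csEs_thick hZE) hbig
  refine measure_mono_null (sdiff_subset_sdiff_right ?_) hfin
  exact (thickening_mono hs0r.le Z).trans (thickening_subset_of_subset r (hZE.trans (csEs_anti E hs0.1)))

theorem cs_main {Ω E : Set ℂ} {r : ℝ} (hr : 0 < r) (hΩb : Bornology.IsBounded Ω)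
    (hV : IsPreconnected (closure Ω)ᶜ) (hi : interior (closure Ω) = Ω)
    (hK : IsPreconnected {z : ℂ | ball z r ⊆ Ω})
    (hcl : closure (interior {z : ℂ | ball z r ⊆ Ω}) = {z : ℂ | ball z r ⊆ Ω})
    (hP2 : ∀ O : Set ℂ, IsOpen O → O ⊆ Ω → ∀ m c : ℝ, (∀ σ > 0, (volume (thickening σ O)).toReal ≤
      (volume O).toReal + m * σ + c * σ ^ 2) → (volume O).toReal ≤ r * m)
    (hEm : MeasurableSet E) (hEΩ : E ⊆ Ω) (hE : 0 < (volume E).toReal)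
    (hap : CsApx E ((volume E).toReal / r)) :
    volume (E \ thickening r {z : ℂ | ball z r ⊆ Ω}) = 0 ∧ volume (thickening r {z : ℂ | ball z r ⊆ Ω} \ E) = 0 := by
  set K := {z : ℂ | ball z r ⊆ Ω} with hKdef
  have hpi := Real.pi_pos
  obtain ⟨R, hrR, hΩR⟩ : ∃ R, 2 * r ≤ R ∧ Ω ⊆ ball 0 (R / 2 - 1) := by
    obtain ⟨ρ, hρ⟩ := hΩb.subset_ball (0:ℂ)
    refine ⟨2 * max r (ρ + 1), by linarith [le_max_left r (ρ + 1)], hρ.trans (ball_subset_ball ?_)⟩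
    linarith [le_max_right r (ρ + 1)]
  have hEf : volume E ≠ ⊤ := (hΩb.subset hEΩ).measure_lt_top.ne
  have hKΩ : K ⊆ Ω := fun z hz => hz (mem_ball_self hr)
  have hKcl : IsClosed K := by rw [← hcl]; exact isClosed_closure
  have hKk : IsCompact K := Metric.isCompact_of_isClosed_isBounded hKcl (hΩb.subset hKΩ)
  have hKvol : (volume K).toReal ≤ Real.pi * r ^ 2 := by
    rcases K.eq_empty_or_nonempty with h0 | h0
    · rw [h0]; simp; positivity
    · have := cs_per_lower hr hP2 hKk ⟨h0, hK⟩ (fun z hz => hz)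
      have := le_of_mul_le_mul_left this hr
      linarith
  obtain ⟨F, t, h⟩ := cs_seq hr hrR hEm hEΩ hΩR hE hap hV hi hKvol
  have hEsK : csEs E r ⊆ K := fun z hz => csEs_sub hEΩ hi hz
  have hEsf : volume (csEs E r) ≠ ⊤ := ne_top_of_le_ne_top hKk.measure_lt_top.ne (measure_mono hEsK)
  have hbig : Real.pi * r ^ 2 ≤ (volume (csEs E r)).toReal := by
    refine le_of_forall_pos_le_add fun δ hδ => ?_
    have hl := cs_limsup (fun n => h.op n r) (fun n => h.bd n r) (K := csEs E r) (fun z hz => h.mem_Es fun δ hδ => by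
      refine hz.mono fun n hn => ⟨r, ⟨(h.tr n).le, le_rfl⟩, by linarith, z, hn, by rwa [dist_self]⟩) hEsf
      (show 0 < δ / 2 by positivity)
    obtain ⟨n, a1, a2⟩ := (hl.and (h.p3 (δ / 2) (by positivity))).exists
    have := a2 r ⟨(h.tr n).le, le_rfl⟩
    rw [div_self hr.ne', sub_self, mul_zero] at this
    linarith
  have hEsm := (csEs_closed E r)
  have hnull : volume (K \ csEs E r) = 0 := cs_null_symm hEsm.measurableSet hKcl.measurableSet hKk.measure_lt_top.ne
    (by rw [sdiff_eq_empty.2 hEsK, measure_empty]) (hKvol.trans hbig)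
  have hKE : K ⊆ csEs E r := by
    rw [← hcl]
    refine closure_minimal ?_ hEsm
    by_contra hc
    obtain ⟨v, hv, hvc⟩ := not_subset.1 hc
    have ho : IsOpen (interior K ∩ (csEs E r)ᶜ) := isOpen_interior.inter hEsm.isOpen_compl
    refine (ho.measure_pos volume ⟨v, hv, hvc⟩).ne' (measure_mono_null ?_ hnull)
    exact fun x hx => ⟨interior_subset hx.1, hx.2⟩
  refine ⟨?_, csEs_thick hKE⟩
  -- a.e. point of `E` is within `r` of `K`
  have hK0 : K.Nonempty := by
    by_contra hc
    rw [not_nonempty_iff_eq_empty] at hc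
    rw [hc, subset_empty_iff] at hEsK
    rw [hEsK] at hbig
    simp at hbig
    have : 0 < Real.pi * r ^ 2 := by positivity
    linarith
  have hlev := cs_level hKk ⟨hK0, hK⟩ hr
  set q : ℕ → ℝ := fun j => r - (r / 2) / ((j:ℝ) + 1) with hq
  have hqp : ∀ j, 0 < q j := fun j => by
    simp only [hq]
    have : r / 2 / ((j:ℝ) + 1) ≤ r / 2 := div_le_self (by positivity) (by linarith [Nat.cast_nonneg (α := ℝ) j])
    linarith
  have hqr : ∀ j, q j < r := fun j => by
    simp only [hq]
    have : 0 < r / 2 / ((j:ℝ) + 1) := by positivity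
    linarith
  have hqlim : Filter.Tendsto q Filter.atTop (nhds r) := by
    have := (tendsto_one_div_add_atTop_nhds_zero_nat (𝕜 := ℝ)).const_mul (r / 2)
    have h2 := this.const_sub r
    simp only [mul_zero, sub_zero] at h2
    refine h2.congr fun j => ?_
    simp only [hq]; ring
  have hqm : Monotone q := by
    intro a b hab
    simp only [hq]
    have : r / 2 / ((b:ℝ) + 1) ≤ r / 2 / ((a:ℝ) + 1) := by gcongr
    linarith
  have hae : volume (⋃ j, E \ thickening r (csEs E (q j))) = 0 := measure_iUnion_null fun j =>
    cs_mid hr hEm hEΩ hEf hi hP2 h (hqp j) (show q j < (q j + r) / 2 by linarith [hqr j]) (by linarith [hqr j])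
  have hsub : E \ cthickening r K ⊆ ⋃ j, E \ thickening r (csEs E (q j)) := by
    rintro y ⟨hyE, hy⟩
    by_contra hc
    have hall : ∀ j, y ∈ thickening r (csEs E (q j)) := fun j => by
      by_contra hj
      exact hc (mem_iUnion.2 ⟨j, hyE, hj⟩)
    obtain ⟨z, hz⟩ := IsCompact.nonempty_iInter_of_sequence_nonempty_isCompact_isClosed
      (fun j => csEs E (q j) ∩ closedBall y r)
      (fun j => inter_subset_inter_left _ (csEs_anti E (hqm (Nat.le_succ j))))
      (fun j => by
        obtain ⟨z, hz, hyz⟩ := mem_thickening_iff.1 (hall j)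
        exact ⟨z, hz, by rw [mem_closedBall, dist_comm]; exact hyz.le⟩)
      ((isCompact_closedBall y r).inter_left (csEs_closed E _))
      (fun j => (csEs_closed E _).inter isClosed_closedBall)
    rw [mem_iInter] at hz
    have hzK : z ∈ K := hEsK (csEs_of_approx fun δ hδ => by
      obtain ⟨j, hj⟩ := (hqlim.eventually_const_lt (show r - δ < r by linarith)).exists
      exact csEs_anti E hj.le (hz j).1)
    refine hy (mem_cthickening_of_dist_le y z r K hzK ?_)
    have := (hz 0).2
    rwa [mem_closedBall, dist_comm] at this
  have hn1 : volume (cthickening r K \ thickening r K) = 0 := by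
    refine cs_null_symm isOpen_thickening.measurableSet isClosed_cthickening.measurableSet (cs_cth_fin hKk r) ?_ ?_
    · rw [sdiff_eq_empty.2 (thickening_subset_cthickening r K), measure_empty]
    · rw [hlev]
  refine measure_mono_null (t := (⋃ j, E \ thickening r (csEs E (q j))) ∪ (cthickening r K \ thickening r K)) ?_ (measure_union_null hae hn1)
  rintro y ⟨hyE, hy⟩
  by_cases hyc : y ∈ cthickening r K
  · exact Or.inr ⟨hyc, hy⟩
  · exact Or.inl (hsub ⟨hyE, hyc⟩)

lemma cs_vdiv_cont {φ : EuclideanSpace ℝ (Fin 2) → EuclideanSpace ℝ (Fin 2)} (hφ : ContDiff ℝ 1 φ) :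
    Continuous (vdiv φ) := by
  unfold vdiv
  have h := hφ.continuous_fderiv one_ne_zero
  refine continuous_finsetSum _ fun i _ => ?_
  exact (EuclideanSpace.proj (𝕜 := ℝ) i).continuous.comp (h.clm_apply continuous_const)

lemma cs_vdiv_supp {φ : EuclideanSpace ℝ (Fin 2) → EuclideanSpace ℝ (Fin 2)}
    (hc : HasCompactSupport φ) : HasCompactSupport (vdiv φ) := by
  refine (hc.fderiv (𝕜 := ℝ)).mono fun x hx => ?_
  rw [Function.mem_support] at hx ⊢
  contrapose! hx
  simp [vdiv, hx]

/-- integration by parts against a Lipschitz function -/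
lemma cs_ibp {u : EuclideanSpace ℝ (Fin 2) → ℝ} {C : NNReal} (hu : LipschitzWith C u)
    {φ : EuclideanSpace ℝ (Fin 2) → EuclideanSpace ℝ (Fin 2)} (hφ : ContDiff ℝ 1 φ) (hc : HasCompactSupport φ) :
    ∫ x, u x * vdiv φ x = - ∫ x, fderiv ℝ u x (φ x) := by
  have hg : ∀ i : Fin 2, ContDiff ℝ 1 (fun x => φ x i) := fun i => (EuclideanSpace.proj (𝕜 := ℝ) i).contDiff.comp hφ
  have hgc : ∀ i : Fin 2, HasCompactSupport (fun x => φ x i) := fun i => hc.comp_left (g := fun v : EuclideanSpace ℝ (Fin 2) => v i) rfl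
  have hfd : ∀ (i : Fin 2) x v, fderiv ℝ (fun x => φ x i) x v = fderiv ℝ φ x v i := by
    intro i x v
    have := ((EuclideanSpace.proj (𝕜 := ℝ) i).hasFDerivAt.comp x (hφ.differentiable one_ne_zero x).hasFDerivAt).fderiv
    have h2 : (fun x => φ x i) = (EuclideanSpace.proj (𝕜 := ℝ) i) ∘ φ := rfl
    rw [h2, this]
    rfl
  have key : ∀ i : Fin 2, ∫ x, u x * fderiv ℝ φ x (EuclideanSpace.single i 1) i =
      - ∫ x, lineDeriv ℝ u x (EuclideanSpace.single i 1) * φ x i := by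
    intro i
    obtain ⟨D, hD⟩ := (hg i).lipschitzWith_of_hasCompactSupport (hgc i) one_ne_zero
    rw [hu.integral_lineDeriv_mul_eq hD (hgc i), ← integral_neg]
    congr 1
    ext x
    rw [((hg i).differentiable one_ne_zero x).lineDeriv_eq_fderiv, map_neg, hfd]
    ring
  have i1 : ∀ i : Fin 2, Integrable (fun x => u x * fderiv ℝ φ x (EuclideanSpace.single i 1) i) := fun i => by
    refine Continuous.integrable_of_hasCompactSupport ?_ ?_
    · exact hu.continuous.mul ((EuclideanSpace.proj (𝕜 := ℝ) i).continuous.comp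
        ((hφ.continuous_fderiv one_ne_zero).clm_apply continuous_const))
    · refine (hc.fderiv (𝕜 := ℝ)).mono fun x hx => ?_
      rw [Function.mem_support] at hx ⊢
      contrapose! hx
      simp [hx]
  have i2 : ∀ i : Fin 2, Integrable (fun x => lineDeriv ℝ u x (EuclideanSpace.single i 1) * φ x i) := fun i => by
    have := (hu.locallyIntegrable_lineDeriv (μ := volume) (EuclideanSpace.single i 1)).integrable_smul_right_of_hasCompactSupport
      (hg i).continuous (hgc i)
    simpa [smul_eq_mul] using this
  have e1 : ∫ x, u x * vdiv φ x = ∑ i : Fin 2, ∫ x, u x * fderiv ℝ φ x (EuclideanSpace.single i 1) i := by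
    rw [← integral_finsetSum _ fun i _ => i1 i]
    congr 1; ext x
    rw [vdiv, Finset.mul_sum]
  have e2 : ∫ x, fderiv ℝ u x (φ x) = ∑ i : Fin 2, ∫ x, lineDeriv ℝ u x (EuclideanSpace.single i 1) * φ x i := by
    rw [← integral_finsetSum _ fun i _ => i2 i]
    refine integral_congr_ae ?_
    filter_upwards [hu.ae_differentiableAt (μ := volume)] with x hx
    have hx2 : φ x = ∑ i : Fin 2, (φ x i) • EuclideanSpace.single i (1:ℝ) := by
      ext j
      fin_cases j <;> simp
    conv_lhs => rw [hx2]
    rw [map_sum]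
    refine Finset.sum_congr rfl fun i _ => ?_
    rw [map_smul, hx.lineDeriv_eq_fderiv, smul_eq_mul, mul_comm]
  rw [e1, e2, ← Finset.sum_neg_distrib]
  exact Finset.sum_congr rfl fun i _ => key i

/-- volume growth bounds the perimeter -/
lemma cs_per_le {O : Set (EuclideanSpace ℝ (Fin 2))} (hO : IsOpen O) (hOb : Bornology.IsBounded O) (hne : O.Nonempty) {m c : ℝ}
    (h : ∀ σ > 0, (volume (thickening σ O)).toReal ≤ (volume O).toReal + m * σ + c * σ ^ 2)
    {φ : EuclideanSpace ℝ (Fin 2) → EuclideanSpace ℝ (Fin 2)} (hφ : ContDiff ℝ 1 φ) (hc : HasCompactSupport φ)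
    (hφ1 : ∀ x, ‖φ x‖ ≤ 1) : ∫ x in O, vdiv φ x ≤ m := by
  obtain ⟨M, hM⟩ := (cs_vdiv_supp hc).exists_bound_of_continuous (cs_vdiv_cont hφ)
  have hM0 : 0 ≤ M := (norm_nonneg _).trans (hM 0)
  have hintg : Integrable (vdiv φ) := (cs_vdiv_cont hφ).integrable_of_hasCompactSupport (cs_vdiv_supp hc)
  have hstep : ∀ σ > 0, ∫ x in O, vdiv φ x ≤ m + (c * σ + M * (m * σ + c * σ ^ 2)) := by
    intro σ hσ
    set u : EuclideanSpace ℝ (Fin 2) → ℝ := fun x => max 0 (1 - σ⁻¹ * infDist x O) with hu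
    have hlip : LipschitzWith ⟨σ⁻¹, by positivity⟩ u := by
      refine LipschitzWith.of_dist_le_mul fun x y => ?_
      have h1 : |infDist x O - infDist y O| ≤ dist x y := by
        have := (lipschitz_infDist_pt O).dist_le_mul x y
        simpa [Real.dist_eq] using this
      rw [Real.dist_eq]
      have h2 : (1 - σ⁻¹ * infDist x O) - (1 - σ⁻¹ * infDist y O) = -(σ⁻¹ * (infDist x O - infDist y O)) := by ring
      simp only [hu, max_comm (0:ℝ)]
      refine (abs_max_sub_max_le_abs _ _ _).trans ?_
      rw [h2, abs_neg, abs_mul, abs_of_pos (inv_pos.2 hσ)]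
      exact mul_le_mul_of_nonneg_left h1 (by positivity)
    have hu0 : ∀ x, 0 ≤ u x := fun x => le_max_left _ _
    have hu1 : ∀ x, u x ≤ 1 := fun x => max_le zero_le_one (by
      have : 0 ≤ σ⁻¹ * infDist x O := mul_nonneg (by positivity) infDist_nonneg
      linarith)
    have huO : ∀ x ∈ O, u x = 1 := fun x hx => by simp [hu, infDist_zero_of_mem hx]
    have huT : ∀ x ∉ thickening σ O, u x = 0 := fun x hx => by
      rw [mem_thickening_iff_infDist_lt hne, not_lt] at hx
      simp only [hu]
      refine max_eq_left ?_
      have : 1 ≤ σ⁻¹ * infDist x O := by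
        rw [inv_mul_eq_div, one_le_div hσ]; exact hx
      linarith
    set T := thickening σ O \ O with hT
    have hTm : MeasurableSet T := isOpen_thickening.measurableSet.diff hO.measurableSet
    have hthf : volume (thickening σ O) ≠ ⊤ := hOb.thickening.measure_lt_top.ne
    have hTf : volume T ≠ ⊤ := ne_top_of_le_ne_top hthf (measure_mono diff_subset)
    have hTv : volume.real T ≤ m * σ + c * σ ^ 2 := by
      have h1 : volume.real T = volume.real (thickening σ O) - volume.real O :=
        measureReal_sdiff (self_subset_thickening hσ O) hO.measurableSet
      have h2 := h σ hσ
      rw [h1]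
      simp only [Measure.real]
      linarith
    have hTi : Integrable (T.indicator (fun _ => (1:ℝ))) := (integrable_indicator_iff hTm).2 (integrableOn_const hTf)
    have hTint : ∫ x, T.indicator (fun _ => (1:ℝ)) x = volume.real T := by
      rw [integral_indicator hTm]; simp
    have hder : ∀ x, - fderiv ℝ u x (φ x) ≤ σ⁻¹ * T.indicator (fun _ => (1:ℝ)) x := by
      intro x
      by_cases hx : x ∈ T
      · rw [indicator_of_mem hx, mul_one]
        have h1 := norm_fderiv_le_of_lipschitz ℝ hlip (x₀ := x)
        calc - fderiv ℝ u x (φ x) ≤ ‖fderiv ℝ u x (φ x)‖ := neg_le_abs _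
          _ ≤ ‖fderiv ℝ u x‖ * ‖φ x‖ := ContinuousLinearMap.le_opNorm _ _
          _ ≤ σ⁻¹ * 1 := mul_le_mul h1 (hφ1 x) (norm_nonneg _) (by positivity)
          _ = σ⁻¹ := mul_one _
      · have h0 : fderiv ℝ u x = 0 := by
          by_cases hxO : x ∈ O
          · refine IsLocalMax.fderiv_eq_zero (Filter.Eventually.of_forall fun y => ?_)
            rw [huO x hxO]; exact hu1 y
          · refine IsLocalMin.fderiv_eq_zero (Filter.Eventually.of_forall fun y => ?_)
            rw [huT x fun h => hx ⟨h, hxO⟩]; exact hu0 y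
        rw [h0, indicator_of_notMem hx]; simp
    have hIu : Integrable (fun x => u x * vdiv φ x) :=
      (hlip.continuous.mul (cs_vdiv_cont hφ)).integrable_of_hasCompactSupport (cs_vdiv_supp hc).mul_left
    have hA : ∫ x, u x * vdiv φ x ≤ σ⁻¹ * volume.real T := by
      rw [cs_ibp hlip hφ hc, ← integral_neg, ← hTint, ← integral_const_mul]
      by_cases hi : Integrable (fun x => - fderiv ℝ u x (φ x))
      · exact integral_mono hi (hTi.const_mul _) hder
      · rw [integral_undef hi]
        exact integral_nonneg fun x => mul_nonneg (by positivity) (indicator_nonneg (fun _ _ => zero_le_one) _)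
    have hB : (∫ x in O, vdiv φ x) - ∫ x, u x * vdiv φ x ≤ M * volume.real T := by
      rw [← integral_indicator hO.measurableSet, ← integral_sub (hintg.indicator hO.measurableSet) hIu, ← hTint,
        ← integral_const_mul]
      refine integral_mono ((hintg.indicator hO.measurableSet).sub hIu) (hTi.const_mul _) fun x => ?_
      have hb := abs_le.1 (hM x)
      by_cases hxO : x ∈ O
      · simp only [indicator_of_mem hxO, huO x hxO, one_mul, sub_self]
        exact mul_nonneg hM0 (indicator_nonneg (fun _ _ => zero_le_one) _)
      · simp only [indicator_of_notMem hxO, zero_sub]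
        by_cases hxT : x ∈ thickening σ O
        · rw [indicator_of_mem (show x ∈ T from ⟨hxT, hxO⟩), mul_one]
          nlinarith [hu0 x, hu1 x, hb.1]
        · rw [huT x hxT, indicator_of_notMem (fun h => hxT h.1)]
          simp
    have hC : σ⁻¹ * volume.real T ≤ m + c * σ := by
      calc σ⁻¹ * volume.real T ≤ σ⁻¹ * (m * σ + c * σ ^ 2) := mul_le_mul_of_nonneg_left hTv (by positivity)
        _ = m + c * σ := by field_simp
    have hD := mul_le_mul_of_nonneg_left hTv hM0
    linarith
  have hlim : Filter.Tendsto (fun σ : ℝ => m + (c * σ + M * (m * σ + c * σ ^ 2))) (nhdsWithin 0 (Ioi 0)) (nhds m) := by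
    have : Continuous (fun σ : ℝ => m + (c * σ + M * (m * σ + c * σ ^ 2))) := by fun_prop
    have h2 := (this.tendsto 0).mono_left (nhdsWithin_le_nhds (s := Ioi 0))
    simpa using h2
  refine ge_of_tendsto hlim ?_
  filter_upwards [self_mem_nhdsWithin] with σ hσ
  exact hstep σ hσ

/-- translation of the test field -/
lemma cs_vdiv_shift (φ : EuclideanSpace ℝ (Fin 2) → EuclideanSpace ℝ (Fin 2)) (y x : EuclideanSpace ℝ (Fin 2)) :
    vdiv (fun z => φ (z + y)) x = vdiv φ (x + y) := by
  simp only [vdiv, fderiv_comp_add_right]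

/-- mollification does not increase the variation -/
lemma cs_moll {E : Set (EuclideanSpace ℝ (Fin 2))} (hE : MeasurableSet E) {P : ℝ}
    (hP : ∀ φ : EuclideanSpace ℝ (Fin 2) → EuclideanSpace ℝ (Fin 2), ContDiff ℝ 1 φ → HasCompactSupport φ →
      (∀ x, ‖φ x‖ ≤ 1) → ∫ x in E, vdiv φ x ≤ P)
    {η : EuclideanSpace ℝ (Fin 2) → ℝ} (hη : Continuous η) (hηc : HasCompactSupport η) (hη0 : ∀ x, 0 ≤ η x)
    (hη1 : ∫ x, η x = 1)
    {φ : EuclideanSpace ℝ (Fin 2) → EuclideanSpace ℝ (Fin 2)} (hφ : ContDiff ℝ 1 φ) (hc : HasCompactSupport φ)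
    (hφ1 : ∀ x, ‖φ x‖ ≤ 1) :
    ∫ x, (∫ y, η y * E.indicator (fun _ => (1:ℝ)) (x - y)) * vdiv φ x ≤ P := by
  have hηi : Integrable η := hη.integrable_of_hasCompactSupport hηc
  have hvi : Integrable (vdiv φ) := (cs_vdiv_cont hφ).integrable_of_hasCompactSupport (cs_vdiv_supp hc)
  set g : EuclideanSpace ℝ (Fin 2) → ℝ := E.indicator (fun _ => (1:ℝ)) with hg
  have hgm : Measurable g := measurable_const.indicator hE
  have hg1 : ∀ x, ‖g x‖ ≤ 1 := fun x => by
    rw [hg]; by_cases hx : x ∈ E <;> simp [hx]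
  have hprod : Integrable (fun p : EuclideanSpace ℝ (Fin 2) × EuclideanSpace ℝ (Fin 2) => η p.2 * g (p.1 - p.2) * vdiv φ p.1)
      (volume.prod volume) := by
    have h1 : Integrable (fun p : EuclideanSpace ℝ (Fin 2) × EuclideanSpace ℝ (Fin 2) => vdiv φ p.1 * η p.2) (volume.prod volume) :=
      hvi.mul_prod hηi
    refine h1.mono ?_ ?_
    · refine Measurable.aestronglyMeasurable ?_
      exact ((hη.measurable.comp measurable_snd).mul (hgm.comp (measurable_fst.sub measurable_snd))).mul
        ((cs_vdiv_cont hφ).measurable.comp measurable_fst)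
    · refine Filter.Eventually.of_forall fun p => ?_
      simp only [norm_mul]
      calc ‖η p.2‖ * ‖g (p.1 - p.2)‖ * ‖vdiv φ p.1‖ ≤ ‖η p.2‖ * 1 * ‖vdiv φ p.1‖ := by
            gcongr; exact hg1 _
        _ = _ := by ring
  have e1 : ∫ x, (∫ y, η y * g (x - y)) * vdiv φ x = ∫ x, ∫ y, η y * g (x - y) * vdiv φ x := by
    congr 1; ext x
    rw [← integral_mul_const]
  have e2 : ∀ y, ∫ x, η y * g (x - y) * vdiv φ x = η y * ∫ x in E, vdiv (fun z => φ (z + y)) x := by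
    intro y
    simp_rw [mul_assoc]
    rw [integral_const_mul, ← integral_indicator hE, ← integral_add_right_eq_self _ y]
    congr 1
    congr 1; ext x
    by_cases hx : x ∈ E <;> simp [hg, hx, cs_vdiv_shift]
  rw [e1, integral_integral_swap hprod]
  simp_rw [e2]
  have hle : ∀ y, η y * ∫ x in E, vdiv (fun z => φ (z + y)) x ≤ η y * P := fun y => by
    refine mul_le_mul_of_nonneg_left ?_ (hη0 y)
    refine hP _ (hφ.comp (contDiff_id.add contDiff_const)) ?_ (fun x => hφ1 _)
    exact hc.comp_homeomorph (Homeomorph.addRight y)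
  have hi : Integrable (fun y => η y * ∫ x in E, vdiv (fun z => φ (z + y)) x) := by
    have := hprod.integral_prod_right
    simp only at this
    simp_rw [e2] at this
    exact this
  calc _ ≤ ∫ y, η y * P := integral_mono hi (hηi.mul_const P) hle
    _ = P := by rw [integral_mul_const, hη1, one_mul]

/-- total variation of a smooth function -/
lemma cs_tv {u : EuclideanSpace ℝ (Fin 2) → ℝ} (hu : ContDiff ℝ 2 u) (hc : HasCompactSupport u) {P : ℝ}
    (hP : ∀ φ : EuclideanSpace ℝ (Fin 2) → EuclideanSpace ℝ (Fin 2), ContDiff ℝ 1 φ → HasCompactSupport φ →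
      (∀ x, ‖φ x‖ ≤ 1) → ∫ x, u x * vdiv φ x ≤ P) :
    ∫ x, ‖fderiv ℝ u x‖ ≤ P := by
  have hd : ContDiff ℝ 1 (fderiv ℝ u) := hu.fderiv_right (by norm_num)
  set G : EuclideanSpace ℝ (Fin 2) → EuclideanSpace ℝ (Fin 2) := fun x => (InnerProductSpace.toDual ℝ _).symm (fderiv ℝ u x) with hG
  have hGs : ContDiff ℝ 1 G := (InnerProductSpace.toDual ℝ (EuclideanSpace ℝ (Fin 2))).symm.toContinuousLinearEquiv.contDiff.comp hd
  have hGn : ∀ x, ‖G x‖ = ‖fderiv ℝ u x‖ := fun x => LinearIsometryEquiv.norm_map _ _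
  have hGf : ∀ x v, fderiv ℝ u x v = inner ℝ (G x) v := fun x v => by
    rw [hG]; exact (InnerProductSpace.toDual_symm_apply).symm
  have hGc : HasCompactSupport G := (hc.fderiv (𝕜 := ℝ)).comp_left (map_zero _)
  obtain ⟨C, hlip⟩ := (hu.of_le (by norm_num : (1 : WithTop ℕ∞) ≤ 2)).lipschitzWith_of_hasCompactSupport hc one_ne_zero
  set S := tsupport G with hS
  have hSk : IsCompact S := hGc
  have hnc : Continuous (fun x => ‖fderiv ℝ u x‖) := hd.continuous.norm
  have hni : Integrable (fun x => ‖fderiv ℝ u x‖) := hnc.integrable_of_hasCompactSupport (hc.fderiv (𝕜 := ℝ)).norm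
  have hSi : Integrable (S.indicator (fun _ => (1:ℝ))) :=
    (integrable_indicator_iff hSk.measurableSet).2 (integrableOn_const hSk.measure_lt_top.ne)
  have hSint : ∫ x, S.indicator (fun _ => (1:ℝ)) x = volume.real S := by
    rw [integral_indicator hSk.measurableSet]; simp
  have hstep : ∀ ε > 0, ∫ x, ‖fderiv ℝ u x‖ ≤ P + ε * volume.real S := by
    intro ε hε
    have hpos : ∀ x, 0 < ‖G x‖ ^ 2 + ε ^ 2 := fun x => by positivity
    have hsq : ContDiff ℝ 1 (fun x => (Real.sqrt (‖G x‖ ^ 2 + ε ^ 2))⁻¹) := by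
      refine ContDiff.inv (((hGs.norm_sq ℝ).add contDiff_const).sqrt fun x => (hpos x).ne') fun x => ?_
      exact (Real.sqrt_pos.2 (hpos x)).ne'
    set φ : EuclideanSpace ℝ (Fin 2) → EuclideanSpace ℝ (Fin 2) := fun x => -((Real.sqrt (‖G x‖ ^ 2 + ε ^ 2))⁻¹ • G x) with hφdef
    have hφ : ContDiff ℝ 1 φ := (hsq.smul hGs).neg
    have hφc : HasCompactSupport φ := (hGc.smul_left (f := fun x => (Real.sqrt (‖G x‖ ^ 2 + ε ^ 2))⁻¹)).neg
    have hGle : ∀ x, ‖G x‖ ≤ Real.sqrt (‖G x‖ ^ 2 + ε ^ 2) := fun x =>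
      Real.le_sqrt_of_sq_le (by nlinarith)
    have hφ1 : ∀ x, ‖φ x‖ ≤ 1 := fun x => by
      simp only [hφdef]
      rw [norm_neg, norm_smul, norm_inv, Real.norm_eq_abs, abs_of_pos (Real.sqrt_pos.2 (hpos x)), inv_mul_le_one₀ (Real.sqrt_pos.2 (hpos x))]
      exact hGle x
    have h1 := hP φ hφ hφc hφ1
    rw [cs_ibp hlip hφ hφc, ← integral_neg] at h1
    have hi : Integrable (fun x => - fderiv ℝ u x (φ x)) := by
      refine Continuous.integrable_of_hasCompactSupport ?_ ?_
      · exact (hd.continuous.clm_apply hφ.continuous).neg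
      · refine hφc.mono fun x hx => ?_
        rw [Function.mem_support] at hx ⊢
        contrapose! hx
        simp [hx]
    have h2 : ∫ x, (‖fderiv ℝ u x‖ - ε * S.indicator (fun _ => (1:ℝ)) x) ≤ ∫ x, - fderiv ℝ u x (φ x) := by
      refine integral_mono (hni.sub (hSi.const_mul ε)) hi fun x => ?_
      by_cases hx : x ∈ S
      · simp only [indicator_of_mem hx, mul_one]
        rw [hGf, ← hGn]
        simp only [hφdef, inner_neg_right, neg_neg, inner_smul_right, real_inner_self_eq_norm_sq]
        set s := Real.sqrt (‖G x‖ ^ 2 + ε ^ 2) with hs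
        have hs0 : 0 < s := Real.sqrt_pos.2 (hpos x)
        have hss : s ^ 2 = ‖G x‖ ^ 2 + ε ^ 2 := Real.sq_sqrt (hpos x).le
        rw [inv_mul_eq_div, le_div_iff₀ hs0]
        have h4 : ε ≤ s := Real.le_sqrt_of_sq_le (by nlinarith [norm_nonneg (G x)])
        have h5 : s ≤ ‖G x‖ + ε := by
          rw [hs]; refine Real.sqrt_le_iff.2 ⟨by positivity, by nlinarith [norm_nonneg (G x)]⟩
        nlinarith [norm_nonneg (G x), hGle x]
      · have hGx : G x = 0 := image_eq_zero_of_notMem_tsupport hx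
        have : ‖fderiv ℝ u x‖ = 0 := by rw [← hGn, hGx, norm_zero]
        simp only [indicator_of_notMem hx, this, norm_eq_zero.1 this]
        simp
    rw [integral_sub hni (hSi.const_mul ε), integral_const_mul, hSint] at h2
    linarith
  have hlim : Filter.Tendsto (fun ε : ℝ => P + ε * volume.real S) (nhdsWithin 0 (Ioi 0)) (nhds P) := by
    have : Continuous (fun ε : ℝ => P + ε * volume.real S) := by fun_prop
    have h2 := (this.tendsto 0).mono_left (nhdsWithin_le_nhds (s := Ioi 0))
    simpa using h2
  refine ge_of_tendsto hlim ?_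
  filter_upwards [self_mem_nhdsWithin] with ε hε
  exact hstep ε hε

/-- second order Taylor estimate -/
lemma cs_taylor {u : EuclideanSpace ℝ (Fin 2) → ℝ} (hu : ContDiff ℝ 2 u) (hc : HasCompactSupport u) :
    ∃ M : ℝ, 0 ≤ M ∧ ∀ x y, u x - u y ≤ ‖fderiv ℝ u x‖ * dist x y + M * dist x y ^ 2 := by
  have hd : ContDiff ℝ 1 (fderiv ℝ u) := hu.fderiv_right (by norm_num)
  obtain ⟨C, hlip⟩ := hd.lipschitzWith_of_hasCompactSupport (hc.fderiv (𝕜 := ℝ)) one_ne_zero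
  refine ⟨C, C.2, fun x y => ?_⟩
  have h := Convex.norm_image_sub_le_of_norm_fderiv_le' (𝕜 := ℝ) (f := u) (s := closedBall x (dist x y)) (C := C * dist x y)
    (φ := fderiv ℝ u x) (x := x) (y := y) (fun z _ => hu.differentiable (by norm_num) z) (fun z hz => by
      rw [← dist_eq_norm]
      exact (hlip.dist_le_mul z x).trans (mul_le_mul_of_nonneg_left hz C.2)) (convex_closedBall _ _)
      (mem_closedBall_self dist_nonneg) (by rw [mem_closedBall, dist_comm])
  rw [← dist_eq_norm y x, dist_comm y x, Real.norm_eq_abs] at h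
  have h1 := (abs_le.1 h).1
  have h2 := (abs_le.1 ((fderiv ℝ u x).le_opNorm (y - x))).1
  rw [← dist_eq_norm y x, dist_comm y x] at h2
  nlinarith

lemma cs_select {u a : EuclideanSpace ℝ (Fin 2) → ℝ} (hu : Continuous u) (ha : Continuous a) (ha0 : ∀ x, 0 ≤ a x)
    {S : Set (EuclideanSpace ℝ (Fin 2))} (hS : MeasurableSet S) (hai : IntegrableOn a S) {η : ℝ} (hη2 : η < 1 / 2) :
    ∃ c ∈ Ioo η (1 - η), (volume {x | x ∈ S ∧ c < u x ∧ u x ≤ c + a x}).toReal * (1 - 2 * η) ≤ ∫ x in S, a x := by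
  set Q : Set (ℝ × EuclideanSpace ℝ (Fin 2)) := {p | p.2 ∈ S ∧ p.1 < u p.2 ∧ u p.2 ≤ p.1 + a p.2} with hQ
  have hQm : MeasurableSet Q := by
    refine (measurable_snd hS).inter (MeasurableSet.inter ?_ ?_)
    · exact measurableSet_lt measurable_fst (hu.measurable.comp measurable_snd)
    · exact measurableSet_le (hu.measurable.comp measurable_snd) (measurable_fst.add (ha.measurable.comp measurable_snd))
  set f : ℝ → ℝ≥0∞ := fun c => volume (Prod.mk c ⁻¹' Q) with hf
  have hfm : Measurable f := measurable_measure_prodMk_left hQm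
  have hvI : volume (Ioo η (1 - η)) = ENNReal.ofReal (1 - 2 * η) := by
    rw [Real.volume_Ioo]; congr 1; ring
  have hpos : 0 < 1 - 2 * η := by linarith
  obtain ⟨c, hc, hle⟩ := exists_le_setLAverage (μ := volume) (s := Ioo η (1 - η)) (f := f)
    (by rw [hvI]; exact (ENNReal.ofReal_pos.2 hpos).ne') (by rw [hvI]; exact ENNReal.ofReal_ne_top) hfm.aemeasurable
  have hintg : ∫⁻ c in Ioo η (1 - η), f c ≤ ENNReal.ofReal (∫ x in S, a x) := by
    rw [hf, ← Measure.prod_apply hQm, Measure.prod_apply_symm hQm,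
      ofReal_integral_eq_lintegral_ofReal hai (Filter.Eventually.of_forall ha0), ← lintegral_indicator hS]
    refine lintegral_mono fun x => ?_
    by_cases hx : x ∈ S
    · rw [indicator_of_mem hx]
      refine (Measure.restrict_apply_le _ _).trans ?_
      refine (measure_mono (t := Ico (u x - a x) (u x)) ?_).trans ?_
      · rintro c ⟨-, h1, h2⟩
        exact ⟨by simp only at h2; linarith, h1⟩
      · rw [Real.volume_Ico]
        exact ENNReal.ofReal_le_ofReal (by linarith)
    · rw [indicator_of_notMem hx, nonpos_iff_eq_zero]
      have : (fun c => (c, x)) ⁻¹' Q = ∅ := by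
        ext c; simp [hQ, hx]
      rw [this, measure_empty]
  refine ⟨c, hc, ?_⟩
  have h3 : f c * ENNReal.ofReal (1 - 2 * η) ≤ ENNReal.ofReal (∫ x in S, a x) := by
    rw [setLAverage_eq, hvI] at hle
    refine le_trans ?_ hintg
    exact ENNReal.mul_le_of_le_div hle
  have h4 := ENNReal.toReal_mono ENNReal.ofReal_ne_top h3
  rw [ENNReal.toReal_mul, ENNReal.toReal_ofReal hpos.le, ENNReal.toReal_ofReal (integral_nonneg ha0)] at h4
  exact h4

/-- superlevel sets of a smooth function: thin inner layers -/
lemma cs_layer {u : EuclideanSpace ℝ (Fin 2) → ℝ} (hu : ContDiff ℝ 2 u) (hc : HasCompactSupport u) {P : ℝ} (hP0 : 0 ≤ P)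
    (hP : ∫ x, ‖fderiv ℝ u x‖ ≤ P) {η ε : ℝ} (hη : 0 < η) (hη2 : η < 1 / 2) (hε : 0 < ε) (hηP : 2 * η * (P + ε) ≤ ε / 2) :
    ∃ c ∈ Ioo η (1 - η), ∃ t, 0 < t ∧ t < ε ∧
      (volume {x | c < u x ∧ ∃ y, u y ≤ c ∧ dist x y ≤ t}).toReal ≤ t * (P + ε) := by
  obtain ⟨M, hM, hT⟩ := cs_taylor hu hc
  set S := tsupport u with hS
  have hSk : IsCompact S := hc
  obtain ⟨t, ht, htε, htM⟩ : ∃ t, 0 < t ∧ t < ε ∧ t * (M * volume.real S) ≤ ε / 2 := by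
    refine ⟨min (ε / 2) (ε / 2 / (M * volume.real S + 1)), by positivity, (min_le_left _ _).trans_lt (by linarith), ?_⟩
    have h0 : 0 ≤ M * volume.real S := by positivity
    calc _ ≤ ε / 2 / (M * volume.real S + 1) * (M * volume.real S + 1) :=
          mul_le_mul (min_le_right _ _) (by linarith) h0 (by positivity)
      _ = _ := by field_simp
  have hd : ContDiff ℝ 1 (fderiv ℝ u) := hu.fderiv_right (by norm_num)
  have hnc : Continuous (fun x => ‖fderiv ℝ u x‖) := hd.continuous.norm
  have hni : Integrable (fun x => ‖fderiv ℝ u x‖) := hnc.integrable_of_hasCompactSupport (hc.fderiv (𝕜 := ℝ)).norm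
  set a : EuclideanSpace ℝ (Fin 2) → ℝ := fun x => t * ‖fderiv ℝ u x‖ + M * t ^ 2 with ha
  have hac : Continuous a := (hnc.const_mul t).add continuous_const
  obtain ⟨c, hcI, hle⟩ := cs_select hu.continuous hac (fun x => by positivity) hSk.measurableSet
    (hac.continuousOn.integrableOn_compact hSk) hη2
  refine ⟨c, hcI, t, ht, htε, ?_⟩
  have hI : ∫ x in S, a x ≤ t * P + t * (ε / 2) := by
    have e1 : ∫ x in S, a x = t * (∫ x in S, ‖fderiv ℝ u x‖) + t * (t * (M * volume.real S)) := by
      rw [ha, integral_add (hni.integrableOn.const_mul t) (integrableOn_const hSk.measure_lt_top.ne), integral_const_mul]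
      simp; ring
    have e2 : ∫ x in S, ‖fderiv ℝ u x‖ ≤ ∫ x, ‖fderiv ℝ u x‖ :=
      setIntegral_le_integral hni (Filter.Eventually.of_forall fun x => norm_nonneg _)
    have e3 := mul_le_mul_of_nonneg_left (e2.trans hP) ht.le
    have e4 := mul_le_mul_of_nonneg_left htM ht.le
    rw [e1]; linarith
  have hsub : {x | c < u x ∧ ∃ y, u y ≤ c ∧ dist x y ≤ t} ⊆ {x | x ∈ S ∧ c < u x ∧ u x ≤ c + a x} := by
    rintro x ⟨hx, y, hy, hxy⟩
    refine ⟨subset_tsupport u ?_, hx, ?_⟩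
    · rw [Function.mem_support]
      linarith [hcI.1]
    · have h1 := hT x y
      have h2 : ‖fderiv ℝ u x‖ * dist x y ≤ t * ‖fderiv ℝ u x‖ := by
        rw [mul_comm]; exact mul_le_mul_of_nonneg_right hxy (norm_nonneg _)
      have h3 : M * dist x y ^ 2 ≤ M * t ^ 2 := by gcongr
      simp only [ha]
      linarith
  have hfin : volume {x | x ∈ S ∧ c < u x ∧ u x ≤ c + a x} ≠ ⊤ :=
    ne_top_of_le_ne_top hSk.measure_lt_top.ne (measure_mono fun x hx => hx.1)
  refine le_trans (ENNReal.toReal_mono hfin (measure_mono hsub)) ?_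
  have hpos : 0 < 1 - 2 * η := by linarith
  refine le_of_mul_le_mul_right (hle.trans (hI.trans ?_)) hpos
  have : t * (2 * η * (P + ε)) ≤ t * (ε / 2) := mul_le_mul_of_nonneg_left hηP ht.le
  linarith

lemma cs_apx {E : Set (EuclideanSpace ℝ (Fin 2))} (hE : MeasurableSet E) (hEb : Bornology.IsBounded E) {P : ℝ} (hP0 : 0 ≤ P)
    (hP : ∀ φ : EuclideanSpace ℝ (Fin 2) → EuclideanSpace ℝ (Fin 2), ContDiff ℝ 1 φ → HasCompactSupport φ →
      (∀ x, ‖φ x‖ ≤ 1) → ∫ x in E, vdiv φ x ≤ P) {ε : ℝ} (hε : 0 < ε) :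
    ∃ (X : Set (EuclideanSpace ℝ (Fin 2))) (t1 : ℝ), IsOpen X ∧ 0 < t1 ∧ t1 < ε ∧
      (volume (E \ X)).toReal ≤ ε ∧ X ⊆ thickening ε E ∧
      (volume {x | x ∈ X ∧ ∃ y ∉ X, dist x y ≤ t1}).toReal ≤ t1 * (P + ε) := by
  set g : EuclideanSpace ℝ (Fin 2) → ℝ := E.indicator (fun _ => (1:ℝ)) with hg
  have hEf : volume E ≠ ⊤ := hEb.measure_lt_top.ne
  have hgi : Integrable g := (integrable_indicator_iff hE).2 (integrableOn_const hEf)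
  let b : ℕ → ContDiffBump (0 : EuclideanSpace ℝ (Fin 2)) := fun n =>
    ⟨1 / ((n:ℝ) + 1), 2 * (1 / ((n:ℝ) + 1)), by positivity, by
      have : 0 < 1 / ((n:ℝ) + 1) := by positivity
      linarith⟩
  have hεlim : Filter.Tendsto (fun n : ℕ => 1 / ((n:ℝ) + 1)) Filter.atTop (nhds 0) := tendsto_one_div_add_atTop_nhds_zero_nat
  have hr : Filter.Tendsto (fun n => (b n).rOut) Filter.atTop (nhds 0) := by
    have := hεlim.const_mul 2
    rw [mul_zero] at this
    exact this
  have hae := ContDiffBump.ae_convolution_tendsto_right_of_locallyIntegrable (μ := volume) (φ := b) (K := 2) hr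
    (Filter.Eventually.of_forall fun n => le_rfl) hgi.locallyIntegrable
  set U : ℕ → EuclideanSpace ℝ (Fin 2) → ℝ := fun n => MeasureTheory.convolution ((b n).normed volume) g (ContinuousLinearMap.lsmul ℝ ℝ) volume with hU
  have hUs : ∀ n, ContDiff ℝ 2 (U n) := fun n =>
    (b n).hasCompactSupport_normed.contDiff_convolution_left _ (b n).contDiff_normed hgi.locallyIntegrable
  have hUx : ∀ n x, U n x = ∫ y, (b n).normed volume y * g (x - y) := fun n x => by
    simp only [hU, MeasureTheory.convolution, ContinuousLinearMap.lsmul_apply, smul_eq_mul]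
  have hUsupp : ∀ n, Function.support (U n) ⊆ thickening (b n).rOut E := by
    intro n x hx
    obtain ⟨y, hy, z, hz, rfl⟩ := support_convolution_subset _ hx
    rw [(b n).support_normed_eq, mem_ball, dist_zero_right] at hy
    refine mem_thickening_iff.2 ⟨z, ?_, ?_⟩
    · by_contra h
      exact hz (indicator_of_notMem h _)
    · simpa [dist_eq_norm] using hy
  have hUc : ∀ n, HasCompactSupport (U n) := fun n =>
    Metric.isCompact_of_isClosed_isBounded isClosed_closure (hEb.thickening.subset (hUsupp n)).closure
  obtain ⟨η, hη, hη2, hηP⟩ : ∃ η : ℝ, 0 < η ∧ η < 1 / 2 ∧ 2 * η * (P + ε) ≤ ε / 2 := by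
    refine ⟨min (1 / 4) (ε / 4 / (P + ε)), by positivity, (min_le_left _ _).trans_lt (by norm_num), ?_⟩
    have h1 : min (1 / 4) (ε / 4 / (P + ε)) * (P + ε) ≤ ε / 4 := by
      rw [← le_div_iff₀ (by positivity)]; exact min_le_right _ _
    linarith
  have htv : ∀ n, ∫ x, ‖fderiv ℝ (U n) x‖ ≤ P := fun n => cs_tv (hUs n) (hUc n) fun φ h1 h2 h3 => by
    have := cs_moll hE hP (b n).continuous_normed (b n).hasCompactSupport_normed (fun x => (b n).nonneg_normed x)
      (b n).integral_normed h1 h2 h3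
    simp_rw [hUx]
    exact this
  -- measure convergence
  have hmeas : Filter.Tendsto (fun n => (volume.restrict E) {x | ENNReal.ofReal η ≤ edist (U n x) (g x)}) Filter.atTop (nhds 0) := by
    have : IsFiniteMeasure (volume.restrict E) := ⟨by rw [Measure.restrict_apply_univ]; exact hEf.lt_top⟩
    exact tendstoInMeasure_of_tendsto_ae (fun n => (hUs n).continuous.aestronglyMeasurable) (ae_restrict_of_ae hae) _
      (ENNReal.ofReal_pos.2 hη)
  obtain ⟨n, hn1, hn2⟩ := ((hmeas.eventually_lt_const (ENNReal.ofReal_pos.2 hε)).and (hr.eventually_lt_const hε)).exists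
  obtain ⟨c, hcI, t, ht, htε, hlay⟩ := cs_layer (hUs n) (hUc n) hP0 (htv n) hη hη2 hε hηP
  refine ⟨{x | c < U n x}, t, isOpen_lt continuous_const (hUs n).continuous, ht, htε, ?_, ?_, ?_⟩
  · refine ENNReal.toReal_le_of_le_ofReal hε.le (le_trans ?_ hn1.le)
    rw [Measure.restrict_apply' hE]
    refine measure_mono ?_
    rintro x ⟨hxE, hx⟩
    refine ⟨?_, hxE⟩
    have hx' : U n x ≤ c := not_lt.1 hx
    rw [mem_ofPred_eq, edist_dist, hg, indicator_of_mem hxE, Real.dist_eq, abs_sub_comm]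
    refine ENNReal.ofReal_le_ofReal ((le_abs_self _).trans' ?_)
    linarith [hcI.2]
  · intro x hx
    refine thickening_mono hn2.le _ (hUsupp n ?_)
    rw [Function.mem_support]
    have : c < U n x := hx
    linarith [hcI.1]
  · refine le_trans (le_of_eq ?_) hlay
    congr 2
    ext x
    simp

/-- The standard isometry between `ℂ` and the Euclidean plane. -/
noncomputable def csJ : ℂ ≃ₗᵢ[ℝ] EuclideanSpace ℝ (Fin 2) := Complex.orthonormalBasisOneI.repr

lemma csJ_vol (S : Set (EuclideanSpace ℝ (Fin 2))) : volume (csJ ⁻¹' S) = volume S :=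
  csJ.measurePreserving.measure_preimage_emb csJ.toHomeomorph.measurableEmbedding S

lemma csJ_pre_pre (S : Set ℂ) : csJ ⁻¹' (csJ.symm ⁻¹' S) = S := by ext; simp

lemma csJ_vol' (S : Set ℂ) : volume (csJ.symm ⁻¹' S) = volume S := by
  rw [← csJ_vol, csJ_pre_pre]

lemma csJ_thick (δ : ℝ) (S : Set (EuclideanSpace ℝ (Fin 2))) :
    csJ ⁻¹' (thickening δ S) = thickening δ (csJ ⁻¹' S) := by
  ext x
  simp only [mem_preimage, mem_thickening_iff]
  constructor
  · rintro ⟨y, hy, h⟩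
    refine ⟨csJ.symm y, by simpa using hy, ?_⟩
    rwa [← csJ.dist_map, csJ.apply_symm_apply]
  · rintro ⟨y, hy, h⟩
    exact ⟨csJ y, hy, by rwa [csJ.dist_map]⟩

lemma csJ_thick' (δ : ℝ) (S : Set ℂ) :
    csJ.symm ⁻¹' (thickening δ S) = thickening δ (csJ.symm ⁻¹' S) := by
  have := csJ_thick δ (csJ.symm ⁻¹' S)
  rw [csJ_pre_pre] at this
  rw [← this]; ext; simp

lemma csJ_ball (r : ℝ) (S : Set (EuclideanSpace ℝ (Fin 2))) :
    {z : ℂ | ball z r ⊆ csJ ⁻¹' S} = csJ ⁻¹' {x | ball x r ⊆ S} := by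
  ext z
  simp only [mem_preimage, mem_ofPred_eq]
  rw [← csJ.image_ball, image_subset_iff]

lemma csJ_bdd {S : Set (EuclideanSpace ℝ (Fin 2))} (h : Bornology.IsBounded S) :
    Bornology.IsBounded (csJ ⁻¹' S) := by
  have := csJ.symm.lipschitz.isBounded_image h
  rwa [csJ.symm.image_eq_preimage_symm] at this

lemma csJ_closure (S : Set (EuclideanSpace ℝ (Fin 2))) : csJ ⁻¹' (closure S) = closure (csJ ⁻¹' S) :=
  csJ.toHomeomorph.preimage_closure S

lemma csJ_interior (S : Set (EuclideanSpace ℝ (Fin 2))) : csJ ⁻¹' (interior S) = interior (csJ ⁻¹' S) :=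
  csJ.toHomeomorph.preimage_interior S

lemma csJ_frontier (S : Set (EuclideanSpace ℝ (Fin 2))) : csJ ⁻¹' (frontier S) = frontier (csJ ⁻¹' S) :=
  csJ.toHomeomorph.preimage_frontier S

lemma csJ_conn {S : Set (EuclideanSpace ℝ (Fin 2))} : IsPreconnected (csJ ⁻¹' S) ↔ IsPreconnected S :=
  csJ.toHomeomorph.isPreconnected_preimage

lemma csJ_apx {E : Set (EuclideanSpace ℝ (Fin 2))} (hE : MeasurableSet E) (hEb : Bornology.IsBounded E) {P : ℝ} (hP0 : 0 ≤ P)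
    (hP : ∀ φ : EuclideanSpace ℝ (Fin 2) → EuclideanSpace ℝ (Fin 2), ContDiff ℝ 1 φ → HasCompactSupport φ →
      (∀ x, ‖φ x‖ ≤ 1) → ∫ x in E, vdiv φ x ≤ P) : CsApx (csJ ⁻¹' E) P := by
  intro ε hε
  obtain ⟨X, t, hX, ht, htε, h1, h2, h3⟩ := cs_apx hE hEb hP0 hP hε
  refine ⟨csJ ⁻¹' X, t, hX.preimage csJ.continuous, ht, htε, ?_, ?_, ?_⟩
  · rw [← preimage_sdiff, csJ_vol]; exact h1
  · rw [← csJ_thick]; exact preimage_mono h2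
  · refine le_trans (le_of_eq ?_) h3
    rw [← csJ_vol]
    congr 2
    ext x
    simp only [mem_preimage, mem_ofPred_eq]
    refine and_congr_right fun _ => ⟨?_, ?_⟩
    · rintro ⟨y, hy, h⟩
      exact ⟨csJ y, hy, by rwa [csJ.dist_map]⟩
    · rintro ⟨y, hy, h⟩
      refine ⟨csJ.symm y, by simpa using hy, ?_⟩
      rwa [← csJ.dist_map, csJ.apply_symm_apply]

/-- Parametrization of a Jordan curve. -/
lemma csJ_jordan {Γ : Set (EuclideanSpace ℝ (Fin 2))} (h : IsJordanCurve Γ) : CsJordan (csJ ⁻¹' Γ) := by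
  obtain ⟨f⟩ := h
  intro p hp
  set s := f.symm ⟨csJ p, hp⟩ with hs
  set z0 : ℂ := csJ.symm s with hz0
  have hz0n : ‖z0‖ = 1 := by
    rw [hz0, csJ.symm.norm_map]; simpa using s.2
  have hmem : ∀ t : ℝ, csJ (z0 * Complex.exp (t * (2 * Real.pi * Complex.I))) ∈ sphere (0 : EuclideanSpace ℝ (Fin 2)) 1 := by
    intro t
    rw [mem_sphere_zero_iff_norm, csJ.norm_map, norm_mul, hz0n, one_mul]
    have : (t : ℂ) * (2 * Real.pi * Complex.I) = ((t * (2 * Real.pi) : ℝ) : ℂ) * Complex.I := by push_cast; ring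
    rw [this, Complex.norm_exp_ofReal_mul_I]
  have hz0' : z0 ≠ 0 := by
    intro h; rw [h] at hz0n; simp at hz0n
  set c : ℝ → ℂ := fun t => csJ.symm (f ⟨_, hmem t⟩) with hc
  have hpc : ∀ t : ℝ, z0 * Complex.exp (t * (2 * Real.pi * Complex.I)) = z0 → c t = p := by
    intro t ht
    have : (⟨_, hmem t⟩ : sphere (0 : EuclideanSpace ℝ (Fin 2)) 1) = s := by
      apply Subtype.ext
      simp only [ht]
      rw [hz0, csJ.apply_symm_apply]
    simp only [hc, this, hs, f.apply_symm_apply, csJ.symm_apply_apply]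
  refine ⟨c, ?_, hpc 0 (by simp), hpc 1 (by simp), ?_, ?_⟩
  · refine csJ.symm.continuous.comp (continuous_subtype_val.comp (f.continuous.comp ?_))
    refine Continuous.subtype_mk (csJ.continuous.comp ?_) _
    fun_prop
  · apply subset_antisymm
    · rintro _ ⟨t, -, rfl⟩
      simp [hc]
    · intro q hq
      set w : ℂ := csJ.symm (f.symm ⟨csJ q, hq⟩) with hw
      have hwn : ‖w‖ = 1 := by
        rw [hw, csJ.symm.norm_map]; simpa using (f.symm ⟨csJ q, hq⟩).2
      obtain ⟨t, ht, hte⟩ : ∃ t ∈ Icc (0:ℝ) 1, Complex.exp (t * (2 * Real.pi * Complex.I)) = w / z0 := by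
        have hn : ‖w / z0‖ = 1 := by rw [norm_div, hwn, hz0n, div_one]
        have he : Complex.exp ((w / z0).arg * Complex.I) = w / z0 := by
          have := Complex.norm_mul_exp_arg_mul_I (w / z0)
          rwa [hn, Complex.ofReal_one, one_mul] at this
        have h1 := Complex.neg_pi_lt_arg (w / z0)
        have h2 := Complex.arg_le_pi (w / z0)
        have hpi := Real.pi_pos
        have hpi' : (Real.pi : ℂ) ≠ 0 := by exact_mod_cast hpi.ne'
        rcases le_or_gt 0 (w / z0).arg with h | h
        · refine ⟨(w / z0).arg / (2 * Real.pi), ⟨by positivity, ?_⟩, ?_⟩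
          · rw [div_le_one (by positivity)]; linarith
          · rw [← he]
            congr 1
            rw [he]
            push_cast
            field_simp
        · refine ⟨(w / z0).arg / (2 * Real.pi) + 1, ⟨?_, ?_⟩, ?_⟩
          · have : -1 ≤ (w / z0).arg / (2 * Real.pi) := by rw [le_div_iff₀ (by positivity)]; linarith
            linarith
          · have : (w / z0).arg / (2 * Real.pi) ≤ 0 := div_nonpos_of_nonpos_of_nonneg h.le (by positivity)
            linarith
          · have : (((w / z0).arg / (2 * Real.pi) + 1 : ℝ) : ℂ) * (2 * Real.pi * Complex.I) =
                (w / z0).arg * Complex.I + 2 * Real.pi * Complex.I := by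
              push_cast
              field_simp
            rw [this, Complex.exp_periodic, he]
      refine ⟨t, ht, ?_⟩
      have : (⟨_, hmem t⟩ : sphere (0 : EuclideanSpace ℝ (Fin 2)) 1) = f.symm ⟨csJ q, hq⟩ := by
        apply Subtype.ext
        simp only [hte]
        rw [mul_div_cancel₀ _ hz0', hw, csJ.apply_symm_apply]
      simp only [hc, this, f.apply_symm_apply, csJ.symm_apply_apply]
  · intro t ht u hu h
    have h1 := f.injective (Subtype.ext (csJ.symm.injective h))
    have h2 := mul_left_cancel₀ hz0' (csJ.injective (congrArg Subtype.val h1))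
    obtain ⟨n, hn⟩ := Complex.exp_eq_exp_iff_exists_int.1 h2
    have hpi : (2 * Real.pi * Complex.I : ℂ) ≠ 0 := Complex.two_pi_I_ne_zero
    rw [← add_mul] at hn
    have h3 := mul_right_cancel₀ hpi hn
    have h4 : t = u + n := by exact_mod_cast h3
    have h5 : (n : ℝ) < 1 := by linarith [ht.2, hu.1]
    have h6 : (-1 : ℝ) < n := by linarith [ht.1, hu.2]
    have h7 : n < 1 := by exact_mod_cast h5
    have h8 : -1 < n := by exact_mod_cast h6
    have : n = 0 := by omega
    rw [h4, this]; simp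

lemma csJ_ext {Ω : Set (EuclideanSpace ℝ (Fin 2))} (h : IsJordanDomain Ω) :
    IsPreconnected (closure (csJ ⁻¹' Ω))ᶜ ∧ interior (closure (csJ ⁻¹' Ω)) = csJ ⁻¹' Ω := by
  obtain ⟨Γ, hΓ, ho, hb, hc, hf, hcc⟩ := h
  refine cs_jordan_ext (csJ_jordan hΓ) (ho.preimage csJ.continuous) (csJ_bdd hb) ?_ ?_ ?_
  · exact ⟨hc.1.imp' csJ.symm (by simp), csJ_conn.2 hc.2⟩
  · rw [← csJ_frontier, hf]
  · intro x hx
    have h1 := hcc (csJ x) hx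
    have hxm : csJ x ∈ Γᶜ := by
      rw [← hf]
      exact fun hx' => (disjoint_left.1 (disjoint_frontier_iff_isOpen.2 ho) hx') hx
    have h2 := csJ.symm.toHomeomorph.image_connectedComponentIn hxm
    rw [h1] at h2
    have e1 : ∀ S, csJ.symm.toHomeomorph '' S = csJ ⁻¹' S := fun S => csJ.symm.image_eq_preimage_symm S
    rw [e1, e1] at h2
    rw [h2]
    simp

lemma cs_per_of_le {F : Set (EuclideanSpace ℝ (Fin 2))} {m : ℝ}
    (h : ∀ φ : EuclideanSpace ℝ (Fin 2) → EuclideanSpace ℝ (Fin 2), ContDiff ℝ 1 φ → HasCompactSupport φ →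
      (∀ x, ‖φ x‖ ≤ 1) → ∫ x in F, vdiv φ x ≤ m) : perimeter F ≤ ENNReal.ofReal m :=
  iSup_le fun φ => iSup_le fun h1 => iSup_le fun h2 => iSup_le fun _ => iSup_le fun h4 =>
    ENNReal.ofReal_le_ofReal (h φ h1 h2 h4)

lemma cs_le_per {F : Set (EuclideanSpace ℝ (Fin 2))}
    {φ : EuclideanSpace ℝ (Fin 2) → EuclideanSpace ℝ (Fin 2)} (h1 : ContDiff ℝ 1 φ) (h2 : HasCompactSupport φ)
    (h3 : ∀ x, ‖φ x‖ ≤ 1) : ENNReal.ofReal (∫ x in F, vdiv φ x) ≤ perimeter F :=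
  le_iSup_of_le φ (le_iSup_of_le h1 (le_iSup_of_le h2 (le_iSup_of_le (subset_univ _) (le_iSup_of_le h3 le_rfl))))

lemma cs_per_ball (x : EuclideanSpace ℝ (Fin 2)) {ρ : ℝ} (hρ : 0 < ρ) :
    perimeter (ball x ρ) ≤ ENNReal.ofReal (2 * Real.pi * ρ) := by
  refine cs_per_of_le fun φ h1 h2 h3 => cs_per_le (c := Real.pi) isOpen_ball isBounded_ball ⟨x, mem_ball_self hρ⟩ ?_ h1 h2 h3
  intro σ hσ
  have hv : ∀ s : ℝ, 0 < s → (volume (ball x s)).toReal = Real.pi * s ^ 2 := by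
    intro s hs
    rw [EuclideanSpace.volume_ball_fin_two]
    simp [hs.le, mul_comm, Real.pi_pos.le]
  refine (ENNReal.toReal_mono measure_ball_lt_top.ne (measure_mono (Metric.thickening_ball x σ ρ))).trans ?_
  rw [hv _ (by linarith), hv _ hρ]
  apply le_of_eq; ring

lemma cs_cheeger_lt_top {Ω : Set (EuclideanSpace ℝ (Fin 2))} (ho : IsOpen Ω) (hne : Ω.Nonempty) : cheegerConst Ω < ⊤ := by
  obtain ⟨x, hx⟩ := hne
  obtain ⟨ρ, hρ, hb⟩ := Metric.isOpen_iff.1 ho x hx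
  have hpos : 0 < volume (ball x ρ) := measure_ball_pos _ _ hρ
  refine lt_of_le_of_lt (iInf_le_of_le (ball x ρ) (iInf_le_of_le measurableSet_ball (iInf_le_of_le hb (iInf_le_of_le hpos le_rfl)))) ?_
  exact ENNReal.div_lt_top ((cs_per_ball x hρ).trans_lt ENNReal.ofReal_lt_top).ne hpos.ne'

lemma cs_cheeger_mul_le {Ω F : Set (EuclideanSpace ℝ (Fin 2))} (hF : MeasurableSet F) (hFΩ : F ⊆ Ω) (hp : 0 < volume F) :
    cheegerConst Ω * volume F ≤ perimeter F :=
  ENNReal.mul_le_of_le_div (iInf_le_of_le F (iInf_le_of_le hF (iInf_le_of_le hFΩ (iInf_le_of_le hp le_rfl))))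

lemma cs_innerPar {Ω : Set (EuclideanSpace ℝ (Fin 2))} (h : IsJordanDomain Ω) {r : ℝ} (hr : 0 < r) :
    innerPar Ω r = {x | ball x r ⊆ Ω} := by
  obtain ⟨Γ, ⟨f⟩, ho, hb, hc, hf, hcc⟩ := h
  have hne : (frontier Ω).Nonempty := by
    rw [hf]
    exact ⟨_, (f ⟨EuclideanSpace.single 0 1, by simp⟩).2⟩
  ext x
  simp only [innerPar, mem_ofPred_eq]
  constructor
  · rintro ⟨hx, hd⟩ y hy
    by_contra hyΩ
    have hnf : ∀ w ∈ ball x r, w ∈ closure Ω → w ∈ Ω := by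
      intro w hw1 hw
      by_contra hwΩ
      have hw2 : w ∈ frontier Ω := ⟨hw, by rwa [ho.interior_eq]⟩
      have := infDist_le_dist_of_mem (x := x) hw2
      rw [mem_ball, dist_comm] at hw1
      linarith
    obtain ⟨w, -, hw1, hw2⟩ := (convex_ball x r).isPreconnected Ω (closure Ω)ᶜ ho isClosed_closure.isOpen_compl
      (fun w hw => (em (w ∈ closure Ω)).imp (hnf w hw) id)
      ⟨x, mem_ball_self hr, hx⟩ ⟨y, hy, fun h => hyΩ (hnf y hy h)⟩
    exact hw2 (subset_closure hw1)
  · intro hx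
    refine ⟨hx (mem_ball_self hr), (le_infDist hne).2 fun y hy => ?_⟩
    by_contra hlt
    push Not at hlt
    refine disjoint_left.1 (disjoint_frontier_iff_isOpen.2 ho) hy (hx ?_)
    rwa [mem_ball, dist_comm]

lemma cs_neck_conn {Ω : Set (EuclideanSpace ℝ (Fin 2))} {r : ℝ} (h : HasNoNecks Ω r) :
    IsPreconnected {x | ball x r ⊆ Ω} := by
  refine isPreconnected_of_forall_pair fun x hx y hy => ?_
  obtain ⟨γ, hγ, h0, h1, hb⟩ := h x y hx hy
  refine ⟨γ '' Icc 0 1, ?_, ⟨0, by simp, h0⟩, ⟨1, by simp, h1⟩, isPreconnected_Icc.image _ hγ⟩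
  rintro _ ⟨t, ht, rfl⟩
  exact hb t ht

lemma cs_m_nonneg {m c : ℝ} (h : ∀ σ > 0, 0 ≤ m * σ + c * σ ^ 2) : 0 ≤ m := by
  by_contra hm
  push Not at hm
  have hp : 0 < |c| + 1 := by positivity
  have hs : 0 < -m / (2 * (|c| + 1)) := div_pos (by linarith) (by positivity)
  have h1 := h _ hs
  set σ := -m / (2 * (|c| + 1)) with hσ
  have h2 : (|c| + 1) * σ = -m / 2 := by rw [hσ]; field_simp
  have h3 : c * σ ≤ (|c| + 1) * σ := mul_le_mul_of_nonneg_right (by linarith [le_abs_self c]) hs.le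
  have h4 : m * σ + c * σ ^ 2 = σ * (m + c * σ) := by ring
  rw [h4] at h1
  have h5 := nonneg_of_mul_nonneg_right h1 hs
  linarith

/-- Every Cheeger set coincides a.e. with the union of the balls of radius `r` contained in `Ω`. -/
lemma cs_final (Ω : Set (EuclideanSpace ℝ (Fin 2))) (r : ℝ)
    (hΩ : IsJordanDomain Ω)
    (hr : ENNReal.ofReal r = (cheegerConst Ω)⁻¹)
    (hneck : HasNoNecks Ω r)
    (hcl : closure (interior (innerPar Ω r)) = innerPar Ω r) (E : Set (EuclideanSpace ℝ (Fin 2)))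
    (hE : IsCheegerSet Ω E) :
    E =ᵐ[volume] thickening r {x | ball x r ⊆ Ω} := by
  obtain ⟨hEm, hEΩ, hE0, hEp⟩ := hE
  have hΩ' := hΩ
  obtain ⟨Γ, hΓ, ho, hb, hc, hf, hcc⟩ := hΩ'
  have hh := cs_cheeger_lt_top ho hc.1
  have hr0 : 0 < r := by
    rw [← ENNReal.ofReal_pos, hr]
    exact ENNReal.inv_pos.2 hh.ne
  have hh' : cheegerConst Ω = ENNReal.ofReal (r⁻¹) := by
    rw [ENNReal.ofReal_inv_of_pos hr0, hr, inv_inv]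
  have hfin : ∀ F ⊆ Ω, volume F ≠ ⊤ := fun F hF => (hb.subset hF).measure_lt_top.ne
  have hmul : ∀ F ⊆ Ω, cheegerConst Ω * volume F = ENNReal.ofReal ((volume F).toReal / r) := by
    intro F hF
    rw [hh', div_eq_inv_mul, ENNReal.ofReal_mul (by positivity), ENNReal.ofReal_toReal (hfin F hF)]
  have hperE : perimeter E = ENNReal.ofReal ((volume E).toReal / r) := by
    rw [← hmul E hEΩ, ← hEp, ENNReal.div_mul_cancel hE0.ne' (hfin E hEΩ)]
  have hEr : 0 < (volume E).toReal := ENNReal.toReal_pos hE0.ne' (hfin E hEΩ)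
  have hK := cs_innerPar hΩ hr0
  rw [hK] at hcl
  obtain ⟨hV, hi⟩ := csJ_ext hΩ
  have key := cs_main (Ω := csJ ⁻¹' Ω) (E := csJ ⁻¹' E) hr0 (csJ_bdd hb) hV hi
    (by rw [csJ_ball, csJ_conn]; exact cs_neck_conn hneck)
    (by rw [csJ_ball, ← csJ_interior, ← csJ_closure, hcl])
    ?_ (hEm.preimage csJ.continuous.measurable) (preimage_mono hEΩ) (by rwa [csJ_vol])
    (by
      rw [csJ_vol]
      refine csJ_apx hEm (hb.subset hEΩ) (by positivity) fun φ h1 h2 h3 => ?_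
      have := cs_le_per (F := E) h1 h2 h3
      rw [hperE] at this
      exact (ENNReal.ofReal_le_ofReal_iff (by positivity)).1 this)
  · rw [csJ_ball, ← csJ_thick, ← preimage_sdiff, ← preimage_sdiff, csJ_vol, csJ_vol] at key
    exact ae_eq_set.2 key
  · intro O hO hOΩ m c hg
    rcases O.eq_empty_or_nonempty with rfl | hne
    · have : 0 ≤ m := cs_m_nonneg (c := c) fun σ hσ => by simpa using hg σ hσ
      simp; positivity
    · set U := csJ.symm ⁻¹' O with hU
      have hUΩ : U ⊆ Ω := by
        intro x hx
        simpa using hOΩ hx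
      have hUo : IsOpen U := hO.preimage csJ.symm.continuous
      have hUne : U.Nonempty := by
        obtain ⟨z, hz⟩ := hne
        exact ⟨csJ z, by simpa [hU] using hz⟩
      have hp : perimeter U ≤ ENNReal.ofReal m := by
        refine cs_per_of_le fun φ h1 h2 h3 => cs_per_le (c := c) hUo (hb.subset hUΩ) hUne ?_ h1 h2 h3
        intro σ hσ
        rw [hU, ← csJ_thick', csJ_vol', csJ_vol']
        exact hg σ hσ
      have hpos := hUo.measure_pos volume hUne
      have h1 := (cs_cheeger_mul_le hUo.measurableSet hUΩ hpos).trans hp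
      rw [hmul U hUΩ] at h1
      have h2 : 0 < (volume U).toReal / r := div_pos (ENNReal.toReal_pos hpos.ne' (hfin U hUΩ)) hr0
      have h3 := ENNReal.ofReal_le_ofReal_iff'.1 h1
      have h4 : (volume U).toReal / r ≤ m := h3.resolve_right (by linarith)
      rw [div_le_iff₀ hr0, hU, csJ_vol'] at h4
      linarith

theorem cheeger_set_unique_of_no_necks (Ω : Set (EuclideanSpace ℝ (Fin 2))) (r : ℝ)
    (hΩ : IsJordanDomain Ω) (hbd : volume (frontier Ω) = 0)
    (hr : ENNReal.ofReal r = (cheegerConst Ω)⁻¹)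
    (hneck : HasNoNecks Ω r)
    (hcl : closure (interior (innerPar Ω r)) = innerPar Ω r) :
    ∀ E₁ E₂ : Set (EuclideanSpace ℝ (Fin 2)),
      IsCheegerSet Ω E₁ → IsCheegerSet Ω E₂ → volume (symmDiff E₁ E₂) = 0 := by
  intro E₁ E₂ h1 h2
  rw [measure_symmDiff_eq_zero_iff]
  exact (cs_final Ω r hΩ hr hneck hcl E₁ h1).trans (cs_final Ω r hΩ hr hneck hcl E₂ h2).symm
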